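/- There exists an absolute constant c > 0 such that for every N and every set S of N points in the plane in general position, the number of crossing-free straight-edge spanning cycles of S satisfies sc(S) ≤ c · (30 · 12^{1/4})^N, and in particular sc(N) = O(55.8363^N), where sc(N) is the maximum of sc(S) over all N-point sets S. -/

import Mathlib

open scoped Classical

noncomputable section

/-- Points of the plane. -/
abbrev Pt : Type := ℝ × ℝ

/-- A finite point set is in general position if no three of its points are collinear. -/
def GenPos (S : Finset Pt) : Prop :=
  ∀ p ∈ S, ∀ q ∈ S, ∀ r ∈ S, p ≠ q → p ≠ r → q ≠ r →
    ¬ Collinear ℝ ({p, q, r} : Set Pt)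

/-- The closed straight segment spanned by an unordered pair of points. -/
def seg2 (e : Sym2 Pt) : Set Pt :=
  Sym2.lift ⟨fun p q => segment ℝ p q, fun p q => segment_symm ℝ p q⟩ e

/-- A crossing-free straight-edge graph (plane graph) on the point set `S`:
its edges are straight segments between points of `S`, any two of which
meet only at shared endpoints. -/
structure PlaneGraph (S : Finset Pt) where
  edges : Finset (Sym2 Pt)
  endpoint_mem : ∀ e ∈ edges, ∀ p, p ∈ e → p ∈ S
  not_isDiag : ∀ e ∈ edges, ¬ e.IsDiag
  noncrossing : ∀ e₁ ∈ edges, ∀ e₂ ∈ edges, e₁ ≠ e₂ →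
    ∀ x ∈ seg2 e₁ ∩ seg2 e₂, x ∈ e₁ ∧ x ∈ e₂

/-- A triangulation of `S` is a maximal plane graph on `S`. -/
def IsTriangulation {S : Finset Pt} (T : PlaneGraph S) : Prop :=
  ∀ G : PlaneGraph S, T.edges ⊆ G.edges → G.edges = T.edges

/-- `tr S`: the number of triangulations of `S`. -/
def triCount (S : Finset Pt) : ℕ :=
  Nat.card {T : PlaneGraph S // IsTriangulation T}

/-- A plane graph is a spanning cycle of `S` if its edges form a Hamiltonian
cycle on `S`. -/
def IsSpanningCycle {S : Finset Pt} (G : PlaneGraph S) : Prop :=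
  3 ≤ S.card ∧ ∃ f : Fin S.card ≃ {p : Pt // p ∈ S},
    G.edges =
      Finset.image (fun i : Fin S.card => s(((f i : Pt)), ((f (finRotate S.card i) : Pt)))) Finset.univ

/-- `sc S`: the number of crossing-free straight-edge spanning cycles of `S`. -/
def scCount (S : Finset Pt) : ℕ :=
  Nat.card {G : PlaneGraph S // IsSpanningCycle G}

/-- A plane graph is a perfect matching of `S` if every point of `S` is incident
to exactly one edge. -/
def IsPerfectMatching {S : Finset Pt} (G : PlaneGraph S) : Prop :=
  ∀ p ∈ S, ∃! e, e ∈ G.edges ∧ p ∈ e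

/-- `pm S`: the number of crossing-free straight-edge perfect matchings of `S`. -/
def pmCount (S : Finset Pt) : ℕ :=
  Nat.card {G : PlaneGraph S // IsPerfectMatching G}

/-- The support of a plane graph `G` on `S`: the number of triangulations of `S`
containing all edges of `G`. -/
def supp {S : Finset Pt} (G : PlaneGraph S) : ℕ :=
  Nat.card {T : PlaneGraph S // IsTriangulation T ∧ G.edges ⊆ T.edges}

/-- A finite set of points is in (strictly) convex position. -/
def InConvexPosition (Q : Finset Pt) : Prop :=
  ∀ p ∈ Q, p ∉ convexHull ℝ (↑(Q.erase p) : Set Pt)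

/-- `p q` is an edge of the convex hull boundary of `Q`. -/
def IsHullEdgeOf (Q : Finset Pt) (p q : Pt) : Prop :=
  p ∈ Q ∧ q ∈ Q ∧ p ≠ q ∧
    segment ℝ p q ⊆ frontier (convexHull ℝ (Q : Set Pt))

/-- `e` is a diagonal of the convex polygon with vertex set `Q`. -/
def IsDiagonalOf (Q : Finset Pt) (e : Sym2 Pt) : Prop :=
  ∃ p ∈ Q, ∃ q ∈ Q, e = s(p, q) ∧
    openSegment ℝ p q ⊆ interior (convexHull ℝ (Q : Set Pt))

/-- `F` is a set of ps-flippable (pseudo-simultaneously flippable) edges of the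
triangulation `T`: the edges of `F` are diagonals of pairwise interior-disjoint
(empty) convex polygons whose boundary edges all belong to `T`. -/
def IsPsFlippable {S : Finset Pt} (T : PlaneGraph S) (F : Finset (Sym2 Pt)) : Prop :=
  F ⊆ T.edges ∧
  ∃ 𝒬 : Finset (Finset Pt),
    (∀ Q ∈ 𝒬, ↑Q ⊆ (S : Set Pt) ∧ 3 ≤ Q.card ∧ InConvexPosition Q ∧
      (∀ p q, IsHullEdgeOf Q p q → s(p, q) ∈ T.edges) ∧
      (∀ p ∈ S, p ∉ interior (convexHull ℝ (Q : Set Pt)))) ∧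
    (∀ Q ∈ 𝒬, ∀ Q' ∈ 𝒬, Q ≠ Q' →
      interior (convexHull ℝ (Q : Set Pt)) ∩ interior (convexHull ℝ (Q' : Set Pt)) = ∅) ∧
    (∀ e ∈ F, ∃ Q ∈ 𝒬, IsDiagonalOf Q e)

/-- The drawing of a plane graph: the union of its (closed) edge segments and
its vertex set. -/
def drawing {S : Finset Pt} (G : PlaneGraph S) : Set Pt :=
  (⋃ e ∈ G.edges, seg2 e) ∪ (S : Set Pt)

/-- A convex decomposition of `S`: a plane graph containing all convex hull
boundary edges, whose bounded faces are all convex, and with no isolated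
vertices. -/
def IsConvexDecomposition {S : Finset Pt} (D : PlaneGraph S) : Prop :=
  (∀ p q, IsHullEdgeOf S p q → s(p, q) ∈ D.edges) ∧
  (∀ x ∉ drawing D, Bornology.IsBounded (connectedComponentIn (drawing D)ᶜ x) →
    Convex ℝ (connectedComponentIn (drawing D)ᶜ x)) ∧
  (∀ p ∈ S, ∃ e ∈ D.edges, p ∈ e)

/-- `p` is an interior vertex of `S` (not on the convex hull boundary). -/
def InteriorVtx (S : Finset Pt) (p : Pt) : Prop :=
  p ∈ S ∧ p ∉ frontier (convexHull ℝ (S : Set Pt))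

/-- `p` has a valid triple of edges in `G`. -/
def IsValidAt {S : Finset Pt} (G : PlaneGraph S) (p : Pt) : Prop :=
  ∃ a ∈ S, ∃ b ∈ S, ∃ c ∈ S,
    p ∈ convexHull ℝ ({a, b, c} : Set Pt) ∧
    s(p, a) ∈ G.edges ∧ s(p, b) ∈ G.edges ∧ s(p, c) ∈ G.edges

/-- The degree of a point in a plane graph. -/
def degree {S : Finset Pt} (G : PlaneGraph S) (p : Pt) : ℕ :=
  (G.edges.filter (fun e => p ∈ e)).card

/-- `a b c` span a triangular face of the triangulation `T`. -/
def IsTriFace {S : Finset Pt} (T : PlaneGraph S) (a b c : Pt) : Prop :=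
  a ∈ S ∧ b ∈ S ∧ c ∈ S ∧
  s(a, b) ∈ T.edges ∧ s(b, c) ∈ T.edges ∧ s(a, c) ∈ T.edges ∧
  ∀ p ∈ S, p ∉ interior (convexHull ℝ ({a, b, c} : Set Pt))

/-- An edge of a triangulation is flippable if its two incident triangles form
a convex quadrilateral. -/
def IsFlippable {S : Finset Pt} (T : PlaneGraph S) (e : Sym2 Pt) : Prop :=
  e ∈ T.edges ∧ ∃ a b c d : Pt, e = s(a, b) ∧ c ≠ d ∧
    IsTriFace T a b c ∧ IsTriFace T a b d ∧
    (openSegment ℝ a b ∩ openSegment ℝ c d).Nonempty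

/-- `flip T`: the number of flippable edges of `T`. -/
def flipCount {S : Finset Pt} (T : PlaneGraph S) : ℕ :=
  (T.edges.filter (fun e => IsFlippable T e)).card

/-- `v3 T`: the number of interior vertices of degree 3 in `T`. -/
def v3 {S : Finset Pt} (T : PlaneGraph S) : ℕ :=
  (S.filter (fun p => p ∉ frontier (convexHull ℝ (S : Set Pt)) ∧ degree T p = 3)).card

/-- The number of vertices of `S` on its convex hull boundary. -/
def hullVtxCount (S : Finset Pt) : ℕ :=
  (S.filter (fun p => p ∈ frontier (convexHull ℝ (S : Set Pt)))).card

noncomputable section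
namespace SC

/-- orientation determinant -/
def o (a b c : Pt) : ℝ := (b.1-a.1)*(c.2-a.2)-(b.2-a.2)*(c.1-a.1)

/-- proper crossing of the segments `ab` and `cd` -/
def cr (a b c d : Pt) : Prop := o a b c * o a b d < 0 ∧ o c d a * o c d b < 0

lemma o_rot (a b c : Pt) : o b c a = o a b c := by unfold o; ring
lemma o_swap (a b c : Pt) : o b a c = - o a b c := by unfold o; ring
lemma o_swap' (a b c : Pt) : o a c b = - o a b c := by unfold o; ring
@[simp] lemma o_aab (a b : Pt) : o a a b = 0 := by unfold o; ring
@[simp] lemma o_aba (a b : Pt) : o a b a = 0 := by unfold o; ring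
@[simp] lemma o_abb (a b : Pt) : o a b b = 0 := by unfold o; ring
lemma o_four (a b c d : Pt) : o a b c = o a b d + o b c d + o c a d := by unfold o; ring
lemma o_pl (a b c d e : Pt) : o a b c * o a d e - o a b d * o a c e + o a b e * o a c d = 0 := by
  unfold o; ring

lemma cr_symm {a b c d : Pt} (h : cr a b c d) : cr c d a b := ⟨h.2, h.1⟩
lemma cr_swapR {a b c d : Pt} (h : cr a b c d) : cr a b d c := by
  refine ⟨by have := h.1; linarith, ?_⟩
  have := h.2; rw [o_swap c d a, o_swap c d b]; linarith
lemma cr_swapL {a b c d : Pt} (h : cr a b c d) : cr b a c d := cr_symm (cr_swapR (cr_symm h))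

def GP (X : Finset Pt) : Prop :=
  ∀ a ∈ X, ∀ b ∈ X, ∀ c ∈ X, a ≠ b → a ≠ c → b ≠ c → o a b c ≠ 0

def Tri (X : Finset Pt) (T : Finset (Sym2 Pt)) : Prop :=
  ∀ a b, s(a,b) ∈ T ↔ a ∈ X ∧ b ∈ X ∧ a ≠ b ∧ ∀ c d, s(c,d) ∈ T → ¬ cr a b c d

def lerp (r : ℝ) (a b : Pt) : Pt := (a.1 + r*(b.1-a.1), a.2 + r*(b.2-a.2))

lemma o_lerp (a b c d : Pt) (r : ℝ) : o a b (lerp r c d) = (1-r) * o a b c + r * o a b d := by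
  unfold o lerp; ring

lemma lerp_symm (r : ℝ) (a b : Pt) : lerp (1-r) b a = lerp r a b := by
  unfold lerp; ext <;> simp <;> ring

lemma lerp_lerp (r v : ℝ) (a b : Pt) : lerp v (lerp r a b) a = lerp (r*(1-v)) a b := by
  unfold lerp; ext <;> simp <;> ring

lemma GP.mem_of_zero {X : Finset Pt} (h : GP X) {a b c : Pt} (ha : a ∈ X) (hb : b ∈ X) (hc : c ∈ X)
    (hab : a ≠ b) (h0 : o a b c = 0) : c = a ∨ c = b := by
  by_contra hh
  push Not at hh
  exact h a ha b hb c hc hab (Ne.symm hh.1) (Ne.symm hh.2) h0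

lemma cr_of_meet {X : Finset Pt} (h : GP X) {a b c d : Pt} (ha : a ∈ X) (hb : b ∈ X) (hc : c ∈ X)
    (hd : d ∈ X) (hab : a ≠ b) (hcd : c ≠ d) {r u : ℝ} (hr0 : 0 < r) (hr1 : r < 1) (hu0 : 0 < u)
    (hu1 : u < 1) (he : lerp r a b = lerp u c d) : s(a,b) = s(c,d) ∨ cr a b c d := by
  have h1 : (1-r) * o c d a + r * o c d b = 0 := by
    rw [← o_lerp, he, o_lerp]; simp
  have h2 : (1-u) * o a b c + u * o a b d = 0 := by
    rw [← o_lerp, ← he, o_lerp]; simp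
  by_cases ha0 : o c d a = 0
  · have hb0 : o c d b = 0 := by
      rw [ha0] at h1; simp at h1; rcases h1 with h1 | h1
      · linarith
      · exact h1
    left
    rcases h.mem_of_zero hc hd ha hcd ha0 with rfl | rfl <;>
    rcases h.mem_of_zero hc hd hb hcd hb0 with rfl | rfl
    · exact absurd rfl hab
    · rfl
    · exact Sym2.eq_swap
    · exact absurd rfl hab
  by_cases hc0 : o a b c = 0
  · have hd0 : o a b d = 0 := by
      rw [hc0] at h2; simp at h2; rcases h2 with h2 | h2
      · linarith
      · exact h2
    left
    rcases h.mem_of_zero ha hb hc hab hc0 with rfl | rfl <;>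
    rcases h.mem_of_zero ha hb hd hab hd0 with rfl | rfl
    · exact absurd rfl hcd
    · rfl
    · exact Sym2.eq_swap
    · exact absurd rfl hcd
  right
  constructor
  · have : o a b d = -((1-u)/u) * o a b c := by field_simp; linarith
    rw [this]
    have : 0 < (1-u)/u := div_pos (by linarith) hu0
    have : 0 < (o a b c)^2 := by positivity
    nlinarith
  · have : o c d b = -((1-r)/r) * o c d a := by field_simp; linarith
    rw [this]
    have : 0 < (1-r)/r := div_pos (by linarith) hr0
    have : 0 < (o c d a)^2 := by positivity
    nlinarith

lemma ratio_mem {x y : ℝ} (h : x * y < 0) : 0 < x/(x-y) ∧ x/(x-y) < 1 := by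
  rcases mul_neg_iff.1 h with ⟨h1,h2⟩ | ⟨h1,h2⟩
  · exact ⟨div_pos h1 (by linarith), by rw [div_lt_one (by linarith)]; linarith⟩
  · exact ⟨div_pos_of_neg_of_neg h1 (by linarith), by rw [div_lt_one_of_neg (by linarith)]; linarith⟩

lemma ratio_ne {x y : ℝ} (h : x * y < 0) : x - y ≠ 0 := by
  intro h0; have : x = y := by linarith
  subst this; nlinarith [mul_self_nonneg x]

lemma meet_of_cr {a b c d : Pt} (h : cr a b c d) :
    lerp (o c d a/(o c d a - o c d b)) a b = lerp (o a b c/(o a b c - o a b d)) c d := by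
  have h1 := ratio_ne h.1
  have h2 := ratio_ne h.2
  have h3 : o c d a - o c d b = -(o a b c - o a b d) := by unfold o; ring
  rw [h3, div_neg]
  unfold lerp
  ext
  · simp only; field_simp; unfold o; ring
  · simp only; field_simp; unfold o; ring

lemma exists_meet_of_cr {a b c d : Pt} (h : cr a b c d) :
    ∃ r u : ℝ, 0 < r ∧ r < 1 ∧ 0 < u ∧ u < 1 ∧ lerp r a b = lerp u c d :=
  ⟨_, _, (ratio_mem h.2).1, (ratio_mem h.2).2, (ratio_mem h.1).1, (ratio_mem h.1).2, meet_of_cr h⟩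

/-- affine coordinates -/
def co1 (s a c q : Pt) : ℝ := o s q c / o s a c
def co2 (s a c q : Pt) : ℝ := o s a q / o s a c

lemma co1_lerp (s a c p q : Pt) (r : ℝ) :
    co1 s a c (lerp r p q) = (1-r) * co1 s a c p + r * co1 s a c q := by
  unfold co1 o lerp; simp only; ring
lemma co2_lerp (s a c p q : Pt) (r : ℝ) :
    co2 s a c (lerp r p q) = (1-r) * co2 s a c p + r * co2 s a c q := by
  unfold co2 o lerp; simp only; ring
@[simp] lemma co1_s (s a c : Pt) : co1 s a c s = 0 := by simp [co1]
@[simp] lemma co2_s (s a c : Pt) : co2 s a c s = 0 := by simp [co2]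
@[simp] lemma co2_a (s a c : Pt) : co2 s a c a = 0 := by simp [co2]
@[simp] lemma co1_c (s a c : Pt) : co1 s a c c = 0 := by simp [co1]
lemma co1_a {s a c : Pt} (h : o s a c ≠ 0) : co1 s a c a = 1 := by simp [co1, h]
lemma co2_c {s a c : Pt} (h : o s a c ≠ 0) : co2 s a c c = 1 := by simp [co2, h]

lemma co_fst {s a c : Pt} (h : o s a c ≠ 0) (q : Pt) :
    q.1 = s.1 + co1 s a c q * (a.1-s.1) + co2 s a c q * (c.1-s.1) := by
  unfold co1 co2; field_simp; unfold o; ring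
lemma co_snd {s a c : Pt} (h : o s a c ≠ 0) (q : Pt) :
    q.2 = s.2 + co1 s a c q * (a.2-s.2) + co2 s a c q * (c.2-s.2) := by
  unfold co1 co2; field_simp; unfold o; ring
lemma co_ext {s a c : Pt} (h : o s a c ≠ 0) {p q : Pt} (h1 : co1 s a c p = co1 s a c q)
    (h2 : co2 s a c p = co2 s a c q) : p = q := by
  ext
  · rw [co_fst h p, co_fst h q, h1, h2]
  · rw [co_snd h p, co_snd h q, h1, h2]

/-- orientation in coordinates -/
lemma o_co {s a c : Pt} (h : o s a c ≠ 0) (p q : Pt) :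
    o s p q = o s a c * (co1 s a c p * co2 s a c q - co2 s a c p * co1 s a c q) := by
  have e1 := co_fst h p; have e2 := co_snd h p; have e3 := co_fst h q; have e4 := co_snd h q
  generalize co1 s a c p = x at *
  generalize co2 s a c p = y at *
  generalize co1 s a c q = z at *
  generalize co2 s a c q = w at *
  unfold o; rw [e1,e2,e3,e4]; ring

section basics
variable {X : Finset Pt} {T : Finset (Sym2 Pt)}

lemma Tri.memL (h : Tri X T) {a b : Pt} (e : s(a,b) ∈ T) : a ∈ X := ((h a b).1 e).1
lemma Tri.memR (h : Tri X T) {a b : Pt} (e : s(a,b) ∈ T) : b ∈ X := ((h a b).1 e).2.1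
lemma Tri.ne (h : Tri X T) {a b : Pt} (e : s(a,b) ∈ T) : a ≠ b := ((h a b).1 e).2.2.1
lemma Tri.ncr (h : Tri X T) {a b c d : Pt} (e : s(a,b) ∈ T) (f : s(c,d) ∈ T) : ¬ cr a b c d :=
  ((h a b).1 e).2.2.2 c d f
lemma swp {a b : Pt} (e : s(a,b) ∈ T) : s(b,a) ∈ T := by rwa [Sym2.eq_swap]
lemma Tri.meet_eq (h : Tri X T) (hX : GP X) {a b c d : Pt} (e : s(a,b) ∈ T) (f : s(c,d) ∈ T)
    {r u : ℝ} (hr0 : 0 < r) (hr1 : r < 1) (hu0 : 0 < u)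
    (hu1 : u < 1) (he : lerp r a b = lerp u c d) : s(a,b) = s(c,d) :=
  (cr_of_meet hX (h.memL e) (h.memR e) (h.memL f) (h.memR f) (h.ne e) (h.ne f) hr0 hr1 hu0 hu1
    he).resolve_right (h.ncr e f)
end basics
end SC
end

noncomputable section
namespace SC
section
variable {X : Finset Pt} {T : Finset (Sym2 Pt)}

/-- linear functional based at `s` -/
def lf (m : ℝ × ℝ) (s q : Pt) : ℝ := m.1*(q.1-s.1)+m.2*(q.2-s.2)

lemma lf_lerp (m s a b) (r : ℝ) : lf m s (lerp r a b) = (1-r) * lf m s a + r * lf m s b := by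
  unfold lf lerp; simp only; ring
@[simp] lemma lf_self (m s) : lf m s s = 0 := by unfold lf; ring
lemma lf_co {s a c : Pt} (h : o s a c ≠ 0) (m) (q : Pt) :
    lf m s q = co1 s a c q * lf m s a + co2 s a c q * lf m s c := by
  have e1 := co_fst h q; have e2 := co_snd h q
  generalize co1 s a c q = x at *
  generalize co2 s a c q = y at *
  unfold lf; rw [e1,e2]; ring

lemma lerp_co {s a c : Pt} (h : o s a c ≠ 0) {q : Pt} {t : ℝ} (h1 : co1 s a c q = t)
    (h2 : co2 s a c q = 0) : q = lerp t s a := by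
  apply co_ext h
  · rw [co1_lerp, h1, co1_a h]; simp
  · rw [co2_lerp, h2]; simp
lemma lerp_co' {s a c : Pt} (h : o s a c ≠ 0) {q : Pt} {t : ℝ} (h1 : co2 s a c q = t)
    (h2 : co1 s a c q = 0) : q = lerp t s c := by
  apply co_ext h
  · rw [co1_lerp, h2]; simp
  · rw [co2_lerp, h1, co2_c h]; simp

/-- pick the endpoint with positive value -/
lemma pick_pos {T : Finset (Sym2 Pt)} {a b : Pt} {y : Pt} {u : ℝ} (e : s(a,b) ∈ T) (hu0 : 0 < u) (hu1 : u < 1)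
    (hy : y = lerp u a b) (φ : Pt → ℝ) (hφ : ∀ r p q, φ (lerp r p q) = (1-r) * φ p + r * φ q)
    (h : 0 < φ y) : ∃ g k v, s(g,k) ∈ T ∧ 0 < v ∧ v < 1 ∧ y = lerp v g k ∧ 0 < φ g ∧ s(g,k) = s(a,b) := by
  rw [hy, hφ] at h
  by_cases ha : 0 < φ a
  · exact ⟨a, b, u, e, hu0, hu1, hy, ha, rfl⟩
  · have hb : 0 < φ b := by
      by_contra hb; push Not at ha hb
      nlinarith
    exact ⟨b, a, 1-u, swp e, by linarith, by linarith, by rw [lerp_symm]; exact hy, hb, Sym2.eq_swap⟩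

lemma pick_pos' {T : Finset (Sym2 Pt)} {a b : Pt} {y : Pt} {u : ℝ} (e : s(a,b) ∈ T) (hu0 : 0 < u) (hu1 : u < 1)
    (hy : y = lerp u a b) (φ : Pt → ℝ) (hφ : ∀ r p q, φ (lerp r p q) = (1-r) * φ p + r * φ q)
    (h : φ y = 0) (hne : φ a ≠ 0) : ∃ g k v, s(g,k) ∈ T ∧ 0 < v ∧ v < 1 ∧ y = lerp v g k ∧ 0 < φ g ∧ s(g,k) = s(a,b) := by
  rw [hy, hφ] at h
  by_cases ha : 0 < φ a
  · exact ⟨a, b, u, e, hu0, hu1, hy, ha, rfl⟩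
  · have ha : φ a < 0 := lt_of_le_of_ne (not_lt.1 ha) hne
    have hb : 0 < φ b := by
      by_contra hb; push Not at hb
      nlinarith
    exact ⟨b, a, 1-u, swp e, by linarith, by linarith, by rw [lerp_symm]; exact hy, hb, Sym2.eq_swap⟩

set_option maxHeartbeats 1000000 in
lemma exists_nbr (hX : GP X) (hT : Tri X T) {s z0 : Pt} (hs : s ∈ X) (hz0 : z0 ∈ X) (m : ℝ × ℝ)
    (hm : 0 < lf m s z0) : ∃ z, s(s,z) ∈ T ∧ 0 < lf m s z := by
  have hsz : s ≠ z0 := by rintro rfl; simp at hm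
  by_cases hin : s(s,z0) ∈ T
  · exact ⟨z0, hin, hm⟩
  -- crossing edges
  let K := ((X ×ˢ X).filter (fun e : Pt × Pt => s(e.1,e.2) ∈ T ∧ cr s z0 e.1 e.2))
  have hK : K.Nonempty := by
    rw [hT] at hin
    push Not at hin
    obtain ⟨c, d, hcd, hc⟩ := hin hs hz0 hsz
    exact ⟨(c,d), by simp [K, hcd, hc, hT.memL hcd, hT.memR hcd]⟩
  obtain ⟨⟨f0,g0⟩, hfg, hmin⟩ := K.exists_min_image (fun e => o e.1 e.2 s/(o e.1 e.2 s - o e.1 e.2 z0)) hK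
  simp only [K, Finset.mem_filter, Finset.mem_product] at hfg hmin
  obtain ⟨-, hfgT, hcr⟩ := hfg
  set t := o f0 g0 s/(o f0 g0 s - o f0 g0 z0) with ht
  have ht0 : 0 < t := (ratio_mem hcr.2).1
  have ht1 : t < 1 := (ratio_mem hcr.2).2
  have hx := meet_of_cr hcr
  rw [← ht] at hx
  -- minimality in a usable form
  have hmin' : ∀ c d r u, s(c,d) ∈ T → 0 < r → r < t → 0 < u → u < 1 → lerp r s z0 ≠ lerp u c d := by
    intro c d r u hcd hr0 hr1 hu0 hu1 he
    rcases cr_of_meet hX hs hz0 (hT.memL hcd) (hT.memR hcd) hsz (hT.ne hcd) hr0 (by linarith) hu0 hu1 he with h | h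
    · rw [h] at hin; exact hin hcd
    · have h1 := hmin (c,d) ⟨⟨hT.memL hcd, hT.memR hcd⟩, hcd, h⟩
      simp only at h1
      have h2 : (1-r) * o c d s + r * o c d z0 = 0 := by
        rw [← o_lerp, he, o_lerp]; simp
      have h3 : r = o c d s / (o c d s - o c d z0) := by
        rw [eq_div_iff (ratio_ne h.2)]; linarith
      linarith
  have hlfx : 0 < lf m s (lerp t s z0) := by
    rw [lf_lerp]; simp; positivity
  obtain ⟨f, g, u, hfgT', hu0, hu1, hxf, hmf, hsame⟩ :=
    pick_pos hfgT (ratio_mem hcr.1).1 (ratio_mem hcr.1).2 hx (lf m s) (fun r p q => lf_lerp m s p q r) hlfx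
  have hcrf : cr s z0 f g := by
    rcases Sym2.eq_iff.1 hsame with ⟨rfl,rfl⟩ | ⟨rfl,rfl⟩
    · exact hcr
    · exact cr_swapR hcr
  have hD : o s z0 f ≠ 0 := by
    intro h; have := hcrf.1; rw [h] at this; simp at this
  have hfX := hT.memL hfgT'
  have hgX := hT.memR hfgT'
  set α := co1 s z0 f with hα
  set β := co2 s z0 f with hβ
  have αl : ∀ r p q, α (lerp r p q) = (1-r) * α p + r * α q := fun r p q => co1_lerp _ _ _ _ _ _
  have βl : ∀ r p q, β (lerp r p q) = (1-r) * β p + r * β q := fun r p q => co2_lerp _ _ _ _ _ _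
  have αs : α s = 0 := co1_s _ _ _
  have βs : β s = 0 := co2_s _ _ _
  have αz : α z0 = 1 := co1_a hD
  have βz : β z0 = 0 := co2_a _ _ _
  have αf : α f = 0 := co1_c _ _ _
  have βf : β f = 1 := co2_c hD
  have ex1 : (1-u) * α f + u * α g = t := by
    rw [← αl, ← hxf, αl, αs, αz]; ring
  have ex2 : (1-u) * β f + u * β g = 0 := by
    rw [← βl, ← hxf, βl, βs, βz]; ring
  rw [αf] at ex1; rw [βf] at ex2
  have hβg : β g < 0 := by
    by_contra h; push Not at h
    nlinarith
  -- the line fg is α + tβ = t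
  have hlg : α g + t * β g = t := by
    have : u * (α g + t * β g - t) = 0 := by linear_combination ex1 + t * ex2
    have := (mul_eq_zero.1 this).resolve_left (by linarith); linarith
  -- candidates
  let Z := X.filter (fun z => 0 < β z ∧ 0 ≤ α z ∧ α z + t * β z ≤ t)
  have hZ : Z.Nonempty := ⟨f, by simp [Z, hfX, αf, βf]⟩
  obtain ⟨z, hz, hzmax⟩ := Z.exists_max_image (fun z => α z / β z) hZ
  simp only [Z, Finset.mem_filter] at hz hzmax
  obtain ⟨hzX, hz1, hz2, hz3⟩ := hz
  have hszne : s ≠ z := by rintro rfl; linarith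
  have hmz : 0 < lf m s z := by
    rw [lf_co hD]
    change 0 < α z * _ + β z * _
    have := mul_pos hz1 hmf
    have := mul_nonneg hz2 hm.le
    linarith
  refine ⟨z, ?_, hmz⟩
  rw [hT]
  refine ⟨hs, hzX, hszne, ?_⟩
  intro c d hcd hc
  obtain ⟨r, v, hr0, hr1, hv0, hv1, hy⟩ := exists_meet_of_cr hc
  let δ : Pt → ℝ := fun q => α q * β z - β q * α z
  have δl : ∀ r p q, δ (lerp r p q) = (1-r) * δ p + r * δ q := by
    intro r p q; simp only [δ, αl, βl]; ring
  have hδy : δ (lerp r s z) = 0 := by rw [δl]; simp [δ, αs, βs]; right; ring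
  have hδc : δ c ≠ 0 := by
    intro h
    have h1 : o s z c = 0 := by
      rw [o_co hD]; change _ * (α z * β c - β z * α c) = 0
      have : α z * β c - β z * α c = - δ c := by simp only [δ]; ring
      rw [this, h]; simp
    have := hc.1; rw [h1] at this; simp at this
  obtain ⟨g', h', w, hgh, hw0, hw1, hyw, hδ, -⟩ := pick_pos' hcd hv0 hv1 hy δ δl hδy hδc
  have hgX' := hT.memL hgh
  set y := lerp r s z with hydef
  have αy : α y = r * α z := by rw [hydef, αl, αs]; ring
  have βy : β y = r * β z := by rw [hydef, βl, βs]; ring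
  have hβy : 0 < β y := by rw [βy]; positivity
  have hlamy : α y + t * β y < t := by rw [αy, βy]; nlinarith
  -- points on the segment y g'
  have hpt : ∀ k, lerp k y g' = lerp (w*(1-k)) g' h' := by
    intro k; rw [hyw]; exact lerp_lerp _ _ _ _
  have key : ∀ k, 0 < k → k ≤ 1 → 0 ≤ β (lerp k y g') → α (lerp k y g') + t * β (lerp k y g') = t → False := by
    intro k hk0 hk1 hb hl
    have hδk : 0 < δ (lerp k y g') := by rw [δl, hδy, mul_zero, zero_add]; exact mul_pos hk0 hδ
    obtain ⟨q, hq⟩ : ∃ q, q = lerp k y g' := ⟨_, rfl⟩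
    rw [← hq] at hb hl hδk
    have hαq : 0 < α q := by
      simp only [δ] at hδk; nlinarith
    have hbq : β q < 1 := by nlinarith
    have hqe : q = lerp (u * (1 - β q)) f g := by
      apply co_ext hD
      · change α q = α _
        rw [αl, αf]; linear_combination hl - (1-β q)*ex1
      · change β q = β _
        rw [βl, βf]; linear_combination -(1-β q)*ex2
    have hk1' : k < 1 := by
      rcases lt_or_eq_of_le hk1 with h | h
      · exact h
      · exfalso
        have hqg : q = g' := by rw [hq, h]; unfold lerp; ext <;> simp
        have hz : o f g g' = 0 := by
          rw [← hqg, hqe, o_lerp]; simp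
        rcases hX.mem_of_zero hfX hgX hgX' (hT.ne hfgT') hz with h2 | h2
        · rw [hqg, h2, βf] at hbq; exact lt_irrefl _ hbq
        · rw [hqg, h2] at hb; linarith
    have hsame := hT.meet_eq hX hgh hfgT' (r := w*(1-k)) (u := u * (1 - β q)) (mul_pos hw0 (by linarith)) (mul_lt_one_of_nonneg_of_lt_one_left hw0.le hw1 (by linarith))
      (mul_pos hu0 (by linarith)) (mul_lt_one_of_nonneg_of_lt_one_left hu0.le hu1 (by linarith)) (by rw [← hpt, ← hq]; exact hqe)
    have hlg' : α g' + t * β g' = t ∧ α h' + t * β h' = t := by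
      rcases Sym2.eq_iff.1 hsame with ⟨rfl,rfl⟩ | ⟨rfl,rfl⟩
      · exact ⟨by rw [αf,βf]; ring, hlg⟩
      · exact ⟨hlg, by rw [αf,βf]; ring⟩
    have : α y + t * β y = t := by
      rw [hyw, αl, βl]; linear_combination (1-w) * hlg'.1 + w * hlg'.2
    linarith
  -- case distinction
  have hlamg : 0 ≤ β g' → t < α g' + t * β g' ∨ False := by
    intro hb
    have hαg : 0 < α g' := by simp only [δ] at hδ; nlinarith
    rcases hb.lt_or_eq with hb | hb
    · left
      by_contra hcon; push Not at hcon
      have h1 := hzmax g' ⟨hgX', hb, hαg.le, hcon⟩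
      rw [div_le_div_iff₀ hb hz1] at h1
      simp only [δ] at hδ; linarith
    · left
      have : o s z0 g' = 0 := by rw [o_co hD]; change _ * (α z0 * β g' - β z0 * α g') = 0; rw [← hb, βz]; simp
      rcases hX.mem_of_zero hs hz0 hgX' hsz this with h2 | h2
      · rw [h2, αs] at hαg; linarith
      · rw [h2, αz, βz]; linarith
  by_cases hb : 0 ≤ β g'
  · have hl := (hlamg hb).resolve_right id
    -- crossing parameter with line
    set L : ℝ := α y + t * β y
    set M : ℝ := α g' + t * β g'
    have hML : 0 < M - L := by linarith
    refine key ((t-L)/(M-L)) (div_pos (by linarith) hML) ((div_le_one hML).2 (by linarith)) ?_ ?_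
    · rw [βl]
      have : 0 ≤ 1 - (t-L)/(M-L) := by
        have := (div_le_one hML).2 (show t - L ≤ M - L by linarith); linarith
      have := mul_nonneg this hβy.le
      have := mul_nonneg (div_pos (show 0 < t - L by linarith) hML).le hb
      linarith
    · rw [αl, βl]
      have : (t-L)/(M-L) * (M - L) = t - L := div_mul_cancel₀ _ (by linarith)
      simp only [L, M] at this ⊢
      linear_combination this
  · push Not at hb
    -- point on β = 0
    set k0 := β y / (β y - β g') with hk0
    have hden : 0 < β y - β g' := by linarith
    have hk00 : 0 < k0 := div_pos hβy hden
    have hk01 : k0 < 1 := (div_lt_one hden).2 (by linarith)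
    have hβk : β (lerp k0 y g') = 0 := by
      rw [βl]
      have : k0 * (β y - β g') = β y := div_mul_cancel₀ _ (by linarith)
      linear_combination -this
    have hδk : 0 < δ (lerp k0 y g') := by rw [δl, hδy, mul_zero, zero_add]; exact mul_pos hk00 hδ
    have hαk : 0 < α (lerp k0 y g') := by
      simp only [δ, hβk] at hδk; nlinarith
    by_cases hlt : α (lerp k0 y g') < t
    · refine hmin' g' h' (α (lerp k0 y g')) (w*(1-k0)) hgh hαk hlt (mul_pos hw0 (by linarith)) (mul_lt_one_of_nonneg_of_lt_one_left hw0.le hw1 (by linarith)) ?_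
      rw [← hpt]
      exact (lerp_co hD rfl hβk).symm
    · push Not at hlt
      set L : ℝ := α y + t * β y with hL
      set A0 := α (lerp k0 y g') with hA0
      have hA0' : A0 = (1-k0) * α y + k0 * α g' := by rw [hA0, αl]
      have hB0' : 0 = (1-k0) * β y + k0 * β g' := by rw [← βl, hβk]
      have hML : 0 < A0 - L := by linarith
      set j := (t-L)/(A0-L) with hj
      have hj0 : 0 < j := div_pos (by linarith) hML
      have hj1 : j ≤ 1 := (div_le_one hML).2 (by linarith)
      have hjm : j * (A0 - L) = t - L := div_mul_cancel₀ _ (by linarith)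
      refine key (j*k0) (by positivity) (by nlinarith) ?_ ?_
      · rw [βl]
        have : (1 - j*k0) * β y + j*k0 * β g' = (1-j) * β y := by linear_combination -j * hB0'
        rw [this]; exact mul_nonneg (by linarith) hβy.le
      · rw [αl, βl]
        linear_combination hjm - j * t * hB0' - j * hA0' - hL + j*hL
end
end SC
end

noncomputable section
namespace SC
section
variable {X : Finset Pt} {T : Finset (Sym2 Pt)}

lemma exit2 {αy βy αg βg : ℝ} (h1 : 0 < αy) (h2 : 0 < βy) (h : ¬ (0 < αg ∧ 0 < βg)) :
    ∃ k, 0 < k ∧ k ≤ 1 ∧ (((1-k)*αy+k*αg = 0 ∧ 0 ≤ (1-k)*βy+k*βg) ∨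
      ((1-k)*βy+k*βg = 0 ∧ 0 ≤ (1-k)*αy+k*αg)) := by
  have A : ∀ {x y : ℝ}, 0 < x → y ≤ 0 → 0 < x/(x-y) ∧ x/(x-y) ≤ 1 ∧ (1-x/(x-y))*x + x/(x-y)*y = 0 := by
    intro x y hx hy
    have hd : 0 < x - y := by linarith
    refine ⟨div_pos hx hd, (div_le_one hd).2 (by linarith), ?_⟩
    have : x/(x-y)*(x-y) = x := div_mul_cancel₀ _ (by linarith)
    linear_combination -this
  by_cases ha : 0 < αg
  · have hb : βg ≤ 0 := by by_contra hb; exact h ⟨ha, not_le.1 hb⟩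
    obtain ⟨k0, k1, k2⟩ := A h2 hb
    refine ⟨_, k0, k1, Or.inr ⟨k2, ?_⟩⟩
    have := mul_nonneg (sub_nonneg.2 k1) h1.le
    have := mul_nonneg k0.le ha.le
    linarith
  · push Not at ha
    obtain ⟨k0, k1, k2⟩ := A h1 ha
    by_cases hb : 0 ≤ (1-αy/(αy-αg))*βy + αy/(αy-αg)*βg
    · exact ⟨_, k0, k1, Or.inl ⟨k2, hb⟩⟩
    · push Not at hb
      set k := αy/(αy-αg)
      have hbg : βg ≤ 0 := by
        by_contra hc; push Not at hc
        have := mul_nonneg (sub_nonneg.2 k1) h2.le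
        have := mul_nonneg k0.le hc.le
        linarith
      obtain ⟨j0, j1, j2⟩ := A h2 hbg
      set j := βy/(βy-βg)
      refine ⟨j, j0, j1, Or.inr ⟨j2, ?_⟩⟩
      have hjk : j ≤ k := by
        by_contra hc; push Not at hc
        nlinarith
      nlinarith

lemma wedge_exit (hX : GP X) (hT : Tri X T) {s a c g h y : Pt} {w : ℝ} (hD : o s a c ≠ 0)
    (ha : s(s,a) ∈ T) (hc : s(s,c) ∈ T) (hg : s(g,h) ∈ T) (hw0 : 0 < w) (hw1 : w < 1)
    (hy : y = lerp w g h) (h1 : 0 < co1 s a c y) (h2 : 0 < co2 s a c y)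
    (hl : co1 s a c y + co2 s a c y ≤ 1) (hlg : co1 s a c g + co2 s a c g < 1)
    (hn : ¬ (0 < co1 s a c g ∧ 0 < co2 s a c g)) : g = s := by
  obtain ⟨k, k0, k1, hk⟩ := exit2 h1 h2 hn
  have hQ : lerp k y g = lerp (w*(1-k)) g h := by rw [hy]; exact lerp_lerp _ _ _ _
  have hlQ : co1 s a c (lerp k y g) + co2 s a c (lerp k y g) < 1 := by
    rw [co1_lerp, co2_lerp]
    have := mul_le_mul_of_nonneg_left hl (sub_nonneg.2 k1)
    have := mul_lt_mul_of_pos_left hlg k0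
    nlinarith
  rw [← co1_lerp, ← co2_lerp] at hk
  have hu1 : w*(1-k) < 1 := mul_lt_one_of_nonneg_of_lt_one_left hw0.le hw1 (by linarith)
  have hgX := hT.memL hg
  have hsX := hT.memL ha
  -- common treatment
  have main : ∀ e, s(s,e) ∈ T → ∀ t, 0 ≤ t → t < 1 → lerp k y g = lerp t s e → s(s,e) ≠ s(g,h) → g = s := by
    intro e he t ht0 ht1 hq hne
    rcases k1.lt_or_eq with hk1 | hk1
    · have hu0 : 0 < w*(1-k) := mul_pos hw0 (by linarith)
      rcases ht0.lt_or_eq with ht0 | ht0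
      · exact absurd (hT.meet_eq hX he hg ht0 ht1 hu0 hu1 (by rw [← hq, hQ])) hne
      · have hs : lerp k y g = s := by rw [hq, ← ht0]; unfold lerp; simp
        have h0 : o g h s = 0 := by rw [← hs, hQ, o_lerp]; simp
        rcases hX.mem_of_zero hgX (hT.memR hg) hsX (hT.ne hg) h0 with h3 | h3
        · exact h3.symm
        · exfalso
          rw [hQ, h3] at hs
          have hgh := hT.ne hg
          apply hgh
          have e1 := congrArg Prod.fst hs
          have e2 := congrArg Prod.snd hs
          simp only [lerp] at e1 e2
          have hne : (1 - w*(1-k)) ≠ 0 := by linarith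
          ext
          · apply mul_left_cancel₀ hne; linear_combination e1
          · apply mul_left_cancel₀ hne; linear_combination e2
    · have hs : lerp k y g = g := by rw [hk1]; unfold lerp; simp
      have h0 : o s e g = 0 := by rw [← hs, hq, o_lerp]; simp
      rcases hX.mem_of_zero hsX (hT.memR he) hgX (hT.ne he) h0 with h3 | h3
      · exact h3
      · exfalso
        rw [hs, h3] at hq
        have hse := hT.ne he
        apply hse
        have e1 := congrArg Prod.fst hq
        have e2 := congrArg Prod.snd hq
        simp only [lerp] at e1 e2
        have hne : (1 - t) ≠ 0 := by linarith
        ext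
        · apply mul_left_cancel₀ hne; linear_combination -e1
        · apply mul_left_cancel₀ hne; linear_combination -e2
  rcases hk with ⟨hk1, hk2⟩ | ⟨hk1, hk2⟩
  · refine main c hc _ hk2 (by linarith) (lerp_co' hD rfl hk1) ?_
    intro hE
    have : co1 s a c g = 0 ∧ co1 s a c h = 0 := by
      rcases Sym2.eq_iff.1 hE with ⟨rfl,rfl⟩ | ⟨rfl,rfl⟩ <;> simp
    rw [hy, co1_lerp, this.1, this.2] at h1; simp at h1
  · refine main a ha _ hk2 (by linarith) (lerp_co hD rfl hk1) ?_
    intro hE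
    have : co2 s a c g = 0 ∧ co2 s a c h = 0 := by
      rcases Sym2.eq_iff.1 hE with ⟨rfl,rfl⟩ | ⟨rfl,rfl⟩ <;> simp
    rw [hy, co2_lerp, this.1, this.2] at h2; simp at h2

lemma wedge_nbr (hX : GP X) (hT : Tri X T) {s a c q : Pt} (hD : o s a c ≠ 0)
    (ha : s(s,a) ∈ T) (hc : s(s,c) ∈ T) (hq : q ∈ X) (h1 : 0 < co1 s a c q) (h2 : 0 < co2 s a c q)
    (hl : co1 s a c q + co2 s a c q < 1) :
    ∃ z, s(s,z) ∈ T ∧ 0 < co1 s a c z ∧ 0 < co2 s a c z := by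
  let Z := X.filter (fun z => 0 < co1 s a c z ∧ 0 < co2 s a c z)
  have hZ : Z.Nonempty := ⟨q, by simp [Z, hq, h1, h2]⟩
  obtain ⟨z, hz, hzmin⟩ := Z.exists_min_image (fun z => co1 s a c z + co2 s a c z) hZ
  simp only [Z, Finset.mem_filter] at hz hzmin
  obtain ⟨hzX, hz1, hz2⟩ := hz
  have hz3 := (hzmin q ⟨hq, h1, h2⟩).trans_lt hl
  refine ⟨z, ?_, hz1, hz2⟩
  rw [hT]
  refine ⟨hT.memL ha, hzX, ?_, ?_⟩
  · rintro rfl; simp at hz1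
  intro e f hef hcr
  obtain ⟨r, v, hr0, hr1, hv0, hv1, hy⟩ := exists_meet_of_cr hcr
  set φ : Pt → ℝ := fun q => (co1 s a c z + co2 s a c z) - (co1 s a c q + co2 s a c q) with hφ
  have φl : ∀ r p q, φ (lerp r p q) = (1-r) * φ p + r * φ q := by
    intro r p q; simp only [hφ, co1_lerp, co2_lerp]; ring
  have hφy : 0 < φ (lerp r s z) := by
    rw [φl]; simp only [hφ, co1_s, co2_s]; nlinarith
  obtain ⟨g, k, w, hgk, hw0, hw1, hyw, hφg, hE⟩ := pick_pos hef hv0 hv1 hy φ φl hφy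
  have := wedge_exit hX hT hD ha hc hgk hw0 hw1 hyw
    (by rw [co1_lerp, co1_s]; simp; positivity) (by rw [co2_lerp, co2_s]; simp; positivity)
    (by rw [co1_lerp, co2_lerp, co1_s, co2_s]; nlinarith) (by simp only [hφ] at hφg; linarith)
    (by rintro ⟨h3, h4⟩
        have := hzmin g ⟨hT.memL hgk, h3, h4⟩
        simp only [hφ] at hφg; linarith)
  subst this
  rcases Sym2.eq_iff.1 hE with ⟨rfl,rfl⟩ | ⟨rfl,rfl⟩
  · have := hcr.1; simp at this
  · have := hcr.1; simp at this

lemma wedge_close (hX : GP X) (hT : Tri X T) {s a c : Pt} (hD : o s a c ≠ 0)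
    (ha : s(s,a) ∈ T) (hc : s(s,c) ∈ T)
    (hn : ∀ z, s(s,z) ∈ T → ¬ (0 < co1 s a c z ∧ 0 < co2 s a c z)) : s(a,c) ∈ T := by
  have hac : a ≠ c := by rintro rfl; simp at hD
  rw [hT]
  refine ⟨hT.memR ha, hT.memR hc, hac, ?_⟩
  intro e f hef hcr
  obtain ⟨r, v, hr0, hr1, hv0, hv1, hy⟩ := exists_meet_of_cr hcr
  set φ : Pt → ℝ := fun q => 1 - (co1 s a c q + co2 s a c q) with hφ
  have φl : ∀ r p q, φ (lerp r p q) = (1-r) * φ p + r * φ q := by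
    intro r p q; simp only [hφ, co1_lerp, co2_lerp]; ring
  have ha1 := co1_a hD
  have hc1 := co2_c hD
  have hφy : φ (lerp r a c) = 0 := by
    rw [φl]; simp only [hφ, ha1, hc1, co2_a, co1_c]; ring
  have hφo : ∀ q, o a c q = o s a c * φ q := by
    intro q
    simp only [hφ, co1, co2]; field_simp; unfold o; ring
  have hφe : φ e ≠ 0 := by
    intro h0
    have := hcr.1; rw [hφo e, h0] at this; simp at this
  obtain ⟨g, k, w, hgk, hw0, hw1, hyw, hφg, hE⟩ := pick_pos' hef hv0 hv1 hy φ φl hφy hφe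
  have hy1 : 0 < co1 s a c (lerp r a c) := by rw [co1_lerp, ha1, co1_c]; linarith
  have hy2 : 0 < co2 s a c (lerp r a c) := by rw [co2_lerp, hc1, co2_a]; linarith
  have := wedge_exit hX hT hD ha hc hgk hw0 hw1 hyw hy1 hy2
    (by simp only [hφ] at hφy; linarith) (by simp only [hφ] at hφg; linarith)
    (by rintro ⟨h3, h4⟩
        obtain ⟨z, hz, hz1⟩ := wedge_nbr hX hT hD ha hc (hT.memL hgk) h3 h4 (by simp only [hφ] at hφg; linarith)
        exact hn z hz hz1)
  subst this
  apply hn k hgk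
  rw [hyw, co1_lerp, co1_s, mul_zero, zero_add] at hy1
  rw [hyw, co2_lerp, co2_s, mul_zero, zero_add] at hy2
  exact ⟨pos_of_mul_pos_right hy1 hw0.le, pos_of_mul_pos_right hy2 hw0.le⟩

def Face (X : Finset Pt) (T : Finset (Sym2 Pt)) (a b c : Pt) : Prop :=
  0 < o a b c ∧ s(a,b) ∈ T ∧ s(b,c) ∈ T ∧ s(c,a) ∈ T ∧
    ∀ q ∈ X, ¬ (0 < o a b q ∧ 0 < o b c q ∧ 0 < o c a q)

lemma Face.rot {a b c : Pt} (h : Face X T a b c) : Face X T b c a :=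
  ⟨by rw [o_rot]; exact h.1, h.2.2.1, h.2.2.2.1, h.2.1, fun q hq hh => h.2.2.2.2 q hq ⟨hh.2.2, hh.1, hh.2.1⟩⟩

lemma co1_pos {s a c q : Pt} (hD : 0 < o s a c) : 0 < co1 s a c q ↔ 0 < o s q c := by
  unfold co1; rw [div_pos_iff_of_pos_right hD]
lemma co2_pos {s a c q : Pt} (hD : 0 < o s a c) : 0 < co2 s a c q ↔ 0 < o s a q := by
  unfold co2; rw [div_pos_iff_of_pos_right hD]
lemma co_lt {s a c q : Pt} (hD : 0 < o s a c) : co1 s a c q + co2 s a c q < 1 ↔ 0 < o a c q := by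
  unfold co1 co2; rw [← add_div, div_lt_one hD]
  have : o a c q = o s a c - (o s q c + o s a q) := by unfold o; ring
  rw [this]; constructor <;> intro h <;> linarith

lemma exists_face (hX : GP X) (hT : Tri X T) {a b q : Pt} (hab : s(a,b) ∈ T) (hq : q ∈ X)
    (hl : 0 < o a b q) : ∃ c, Face X T a b c := by
  set m : ℝ × ℝ := (-(b.2-a.2), b.1-a.1)
  have hm : ∀ q, lf m a q = o a b q := by intro q; simp only [lf, m, o]; ring
  obtain ⟨z0, hz0, hz0'⟩ := exists_nbr hX hT (hT.memL hab) hq m (by rw [hm]; exact hl)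
  rw [hm] at hz0'
  let N := X.filter (fun z => s(a,z) ∈ T ∧ 0 < o a b z)
  let dt : Pt → ℝ := fun z => (b.1-a.1)*(z.1-a.1)+(b.2-a.2)*(z.2-a.2)
  have hN : N.Nonempty := ⟨z0, by simp [N, hz0, hz0', hT.memR hz0]⟩
  obtain ⟨c, hc, hmax⟩ := N.exists_max_image (fun z => dt z / o a b z) hN
  simp only [N, Finset.mem_filter] at hc hmax
  obtain ⟨hcX, hcT, hc0⟩ := hc
  have hD : o a b c ≠ 0 := hc0.ne'
  have hn : ∀ z, s(a,z) ∈ T → ¬ (0 < co1 a b c z ∧ 0 < co2 a b c z) := by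
    rintro z hz ⟨h1, h2⟩
    rw [co1_pos hc0] at h1
    rw [co2_pos hc0] at h2
    have h3 := hmax z ⟨hT.memR hz, hz, h2⟩
    rw [div_le_div_iff₀ h2 hc0] at h3
    have h4 : ((b.1-a.1)^2+(b.2-a.2)^2) * o a z c = dt z * o a b c - dt c * o a b z := by
      simp only [dt, o]; ring
    have h5 : 0 < (b.1-a.1)^2+(b.2-a.2)^2 := by
      by_contra h
      have e1 : (b.1-a.1) = 0 := by nlinarith [sq_nonneg (b.1-a.1), sq_nonneg (b.2-a.2)]
      have e2 : (b.2-a.2) = 0 := by nlinarith [sq_nonneg (b.1-a.1), sq_nonneg (b.2-a.2)]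
      simp [o, e1, e2] at hc0
    nlinarith
  refine ⟨c, hc0, hab, wedge_close hX hT hD hab hcT hn, swp hcT, ?_⟩
  rintro q hq ⟨h1, h2, h3⟩
  obtain ⟨z, hz, hz'⟩ := wedge_nbr hX hT hD hab hcT hq
    ((co1_pos hc0).2 (by rw [o_rot c a q]; exact h3))
    ((co2_pos hc0).2 h1) ((co_lt hc0).2 h2)
  exact hn z hz hz'

lemma Face.angle (hX : GP X) (hT : Tri X T) {a b c q : Pt} (hF : Face X T a b c) (hq : s(a,q) ∈ T)
    (h1 : 0 < o a b q) (h2 : 0 < o a q c) : False := by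
  have h2' : 0 < o c a q := by rw [← o_rot]; exact h2
  rcases lt_trichotomy (o b c q) 0 with h | h | h
  · apply hT.ncr hq hF.2.2.1
    refine ⟨?_, ?_⟩
    · rw [o_swap']; nlinarith
    · rw [o_rot]; nlinarith [hF.1]
  · rcases hX.mem_of_zero (hT.memL hF.2.2.1) (hT.memR hF.2.2.1) (hT.memR hq) (hT.ne hF.2.2.1) h with rfl | rfl
    · simp at h1
    · simp at h2
  · exact hF.2.2.2.2 q (hT.memR hq) ⟨h1, h, h2'⟩

lemma Face.unique (hX : GP X) (hT : Tri X T) {a b c d : Pt} (h1 : Face X T a b c) (h2 : Face X T a b d) :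
    c = d := by
  rcases lt_trichotomy (o a c d) 0 with h | h | h
  · exact (h1.angle hX hT (swp h2.2.2.2.1) h2.1 (by rw [o_swap']; linarith)).elim
  · rcases hX.mem_of_zero (hT.memR h1.2.2.2.1) (hT.memL h1.2.2.2.1) (hT.memL h2.2.2.2.1) (hT.ne h1.2.2.2.1).symm h with h3 | h3
    · exact absurd h3 (hT.ne h2.2.2.2.1)
    · exact h3.symm
  · exact (h2.angle hX hT (swp h1.2.2.2.1) h1.1 h).elim

lemma Face.inside_aux (hX : GP X) (hT : Tri X T) {a b c x f g : Pt} {w : ℝ} (hF : Face X T a b c)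
    (hfg : s(f,g) ∈ T) (hw0 : 0 < w) (hw1 : w < 1) (hx : x = lerp w f g) (h1 : 0 < o a b x)
    (h2 : 0 < o b c x) (h3 : 0 < o c a x) : f = a ∨ g = a := by
  have hD := hF.1.ne'
  have e1 : 0 < co1 a b c x := (co1_pos hF.1).2 (by rw [o_rot c a x]; exact h3)
  have e2 : 0 < co2 a b c x := (co2_pos hF.1).2 h1
  have e3 : co1 a b c x + co2 a b c x < 1 := (co_lt hF.1).2 h2
  set φ : Pt → ℝ := fun q => 1 - (co1 a b c q + co2 a b c q) with hφ
  have φl : ∀ r p q, φ (lerp r p q) = (1-r) * φ p + r * φ q := by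
    intro r p q; simp only [hφ, co1_lerp, co2_lerp]; ring
  obtain ⟨g', k, v, hgk, hv0, hv1, hyw, hφg, hE⟩ := pick_pos hfg hw0 hw1 hx φ φl (by simp only [hφ]; linarith)
  have := wedge_exit hX hT hD hF.2.1 (swp hF.2.2.2.1) hgk hv0 hv1 hyw e1 e2 e3.le (by simp only [hφ] at hφg; linarith)
    (by rintro ⟨h4, h5⟩
        refine hF.2.2.2.2 g' (hT.memL hgk) ⟨(co2_pos hF.1).1 h5, (co_lt hF.1).1 (by simp only [hφ] at hφg; linarith), ?_⟩
        have := (co1_pos hF.1).1 h4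
        rwa [o_rot c a g'] at this)
  rcases Sym2.eq_iff.1 hE with ⟨rfl,rfl⟩ | ⟨rfl,rfl⟩
  · exact Or.inl this
  · exact Or.inr this

/-- no edge passes through the interior of a face -/
lemma Face.inside (hX : GP X) (hT : Tri X T) {a b c x f g : Pt} {w : ℝ} (hF : Face X T a b c)
    (hfg : s(f,g) ∈ T) (hw0 : 0 < w) (hw1 : w < 1) (hx : x = lerp w f g) (h1 : 0 < o a b x)
    (h2 : 0 < o b c x) (h3 : 0 < o c a x) : False := by
  have A := hF.inside_aux hX hT hfg hw0 hw1 hx h1 h2 h3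
  have B := hF.rot.inside_aux hX hT hfg hw0 hw1 hx h2 h3 h1
  have C := hF.rot.rot.inside_aux hX hT hfg hw0 hw1 hx h3 h1 h2
  have n1 := hT.ne hF.2.1
  have n2 := hT.ne hF.2.2.1
  have n3 := hT.ne hF.2.2.2.1
  grind
end
end SC
end

noncomputable section
namespace SC
section
variable {X : Finset Pt} {T : Finset (Sym2 Pt)} {A B C : Pt}

structure Cfg (X : Finset Pt) (A B C : Pt) : Prop where
  gp : GP X
  hA : A ∈ X
  hB : B ∈ X
  hC : C ∈ X
  ccw : 0 < o A B C
  ins : ∀ q ∈ X, q ≠ A → q ≠ B → q ≠ C → 0 < o A B q ∧ 0 < o B C q ∧ 0 < o C A q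
  xinj : ∀ p ∈ X, ∀ q ∈ X, p.1 = q.1 → p = q
  xA : ∀ q ∈ X, q ≠ A → A.1 < q.1
  xB : ∀ q ∈ X, q ≠ B → q.1 < B.1
  xC : ∀ q ∈ X, q ≠ B → q ≠ C → q.1 < C.1

def rr (d : ℝ × ℝ) (v q : Pt) : ℝ := d.1*(q.2-v.2) - d.2*(q.1-v.1)
def ee (d : ℝ × ℝ) (v q : Pt) : ℝ := d.1*(q.1-v.1) + d.2*(q.2-v.2)

lemma rr_ee (d v b b') : (d.1^2+d.2^2) * o v b b' = ee d v b * rr d v b' - rr d v b * ee d v b' := by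
  unfold ee rr o; ring

lemma dir_exists (hX : GP X) (hT : Tri X T) {v : Pt} (hv : v ∈ X) (d : ℝ × ℝ)
    (hgen : ∀ q ∈ X, q ≠ v → rr d v q ≠ 0) (hr : ∃ q ∈ X, rr d v q < 0)
    (hl : ∀ b, s(v,b) ∈ T → rr d v b < 0 → ∃ q ∈ X, 0 < o v b q) :
    ∃ b c, Face X T v b c ∧ rr d v b < 0 ∧ 0 < rr d v c := by
  obtain ⟨q0, hq0, hq0'⟩ := hr
  have hm : ∀ q, lf (d.2, -d.1) v q = - rr d v q := by intro q; simp only [lf, rr]; ring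
  obtain ⟨z0, hz0, hz0'⟩ := exists_nbr hX hT hv hq0 (d.2, -d.1) (by rw [hm]; linarith)
  rw [hm] at hz0'
  let N := X.filter (fun z => s(v,z) ∈ T ∧ rr d v z < 0)
  have hN : N.Nonempty := ⟨z0, by simp [N, hz0, hT.memR hz0]; linarith⟩
  obtain ⟨b, hb, hmin⟩ := N.exists_min_image (fun z => ee d v z / rr d v z) hN
  simp only [N, Finset.mem_filter] at hb hmin
  obtain ⟨hbX, hbT, hb0⟩ := hb
  obtain ⟨q, hq, hql⟩ := hl b hbT hb0
  obtain ⟨c, hF⟩ := exists_face hX hT hbT hq hql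
  refine ⟨b, c, hF, hb0, ?_⟩
  have hcT := swp hF.2.2.2.1
  rcases lt_trichotomy (rr d v c) 0 with h | h | h
  · exfalso
    have h1 := hmin c ⟨hT.memR hcT, hcT, h⟩
    rw [← neg_div_neg_eq (ee d v b), ← neg_div_neg_eq (ee d v c), div_le_div_iff₀ (by linarith) (by linarith)] at h1
    have h2 := rr_ee d v b c
    have h3 := hF.1
    have h4 : 0 < d.1^2 + d.2^2 := by
      by_contra hh
      have e1 : d.1 = 0 := by nlinarith [sq_nonneg d.1, sq_nonneg d.2]
      have e2 : d.2 = 0 := by nlinarith [sq_nonneg d.1, sq_nonneg d.2]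
      simp [rr, e1, e2] at hb0
    nlinarith
  · exact absurd h (hgen c (hT.memR hcT) (hT.ne hcT).symm)
  · exact h

lemma dir_unique_aux (hX : GP X) (hT : Tri X T) {v : Pt} (d : ℝ × ℝ) {b c b' c' : Pt}
    (h1 : Face X T v b c) (hb : rr d v b < 0) (hc : 0 < rr d v c)
    (h2 : Face X T v b' c') (hb' : rr d v b' < 0) : ¬ 0 < o v b b' := by
  intro h
  refine h1.angle hX hT h2.2.1 h ?_
  have id1 : o v b b' * rr d v c - o v b c * rr d v b' + o v b' c * rr d v b = 0 := by
    unfold o rr; ring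
  have h3 := mul_pos h hc
  have h4 := mul_neg_of_pos_of_neg h1.1 hb'
  by_contra h5; push Not at h5
  have := mul_nonneg_of_nonpos_of_nonpos h5 hb.le
  linarith

lemma dir_unique (hX : GP X) (hT : Tri X T) {v : Pt} (d : ℝ × ℝ) {b c b' c' : Pt}
    (h1 : Face X T v b c) (hb : rr d v b < 0) (hc : 0 < rr d v c)
    (h2 : Face X T v b' c') (hb' : rr d v b' < 0) (hc' : 0 < rr d v c') : b = b' ∧ c = c' := by
  have hbb : b = b' := by
    rcases lt_trichotomy (o v b b') 0 with h | h | h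
    · exact absurd (by rw [o_swap']; linarith) (dir_unique_aux hX hT d h2 hb' hc' h1 hb)
    · rcases hX.mem_of_zero (hT.memL h1.2.1) (hT.memR h1.2.1) (hT.memR h2.2.1) (hT.ne h1.2.1) h with h3 | h3
      · exact absurd h3 (hT.ne h2.2.1).symm
      · exact h3.symm
    · exact absurd h (dir_unique_aux hX hT d h1 hb hc h2 hb')
  subst hbb
  exact ⟨rfl, h1.unique hX hT h2⟩

lemma Cfg.nonneg (h : Cfg X A B C) {q : Pt} (hq : q ∈ X) : 0 ≤ o A B q ∧ 0 ≤ o B C q ∧ 0 ≤ o C A q := by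
  have hc := h.ccw
  have e1 : o B C A = o A B C := o_rot A B C
  have e2 : o C A B = o A B C := by rw [← o_rot, ← o_rot]
  by_cases h1 : q = A
  · subst h1; simp [e1, hc.le]
  by_cases h2 : q = B
  · subst h2; simp [e2, hc.le]
  by_cases h3 : q = C
  · subst h3; simp [hc.le]
  obtain ⟨a,b,c⟩ := h.ins q hq h1 h2 h3
  exact ⟨a.le,b.le,c.le⟩

lemma Cfg.AB (h : Cfg X A B C) : A ≠ B ∧ B ≠ C ∧ C ≠ A := by
  have hc := h.ccw
  refine ⟨?_, ?_, ?_⟩ <;> rintro rfl <;> simp at hc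

lemma Cfg.hull (h : Cfg X A B C) (hT : Tri X T) : s(A,B) ∈ T ∧ s(B,C) ∈ T ∧ s(C,A) ∈ T := by
  have key : ∀ P Q, P ∈ X → Q ∈ X → P ≠ Q → (∀ q ∈ X, 0 ≤ o P Q q) → s(P,Q) ∈ T := by
    intro P Q hP hQ hPQ hn
    rw [hT]
    refine ⟨hP, hQ, hPQ, fun c d hcd hcr => ?_⟩
    have := mul_nonneg (hn c (hT.memL hcd)) (hn d (hT.memR hcd))
    have := hcr.1
    linarith
  exact ⟨key _ _ h.hA h.hB h.AB.1 (fun q hq => (h.nonneg hq).1),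
    key _ _ h.hB h.hC h.AB.2.1 (fun q hq => (h.nonneg hq).2.1),
    key _ _ h.hC h.hA h.AB.2.2 (fun q hq => (h.nonneg hq).2.2)⟩

lemma bary (A B C a b q : Pt) :
    o A B C * o a b q = o B C q * o a b A + o C A q * o a b B + o A B q * o a b C := by
  unfold o; ring

lemma Cfg.left_of_int (h : Cfg X A B C) {a b v : Pt} (ha : a ∈ X) (hb : b ∈ X) (hab : a ≠ b)
    (hv : v = a ∨ v = b) (h1 : v ≠ A) (h2 : v ≠ B) (h3 : v ≠ C) : ∃ q ∈ X, 0 < o a b q := by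
  by_contra hcon
  push Not at hcon
  have hvX : v ∈ X := by rcases hv with rfl | rfl <;> assumption
  have hz : o a b v = 0 := by rcases hv with rfl | rfl <;> simp
  obtain ⟨p1, p2, p3⟩ := h.ins v hvX h1 h2 h3
  have hb' := bary A B C a b v
  rw [hz, mul_zero] at hb'
  have a1 := hcon A h.hA
  have a2 := hcon B h.hB
  have a3 := hcon C h.hC
  have z1 : o a b A = 0 := by
    by_contra hne
    have := mul_neg_of_pos_of_neg p2 (lt_of_le_of_ne a1 hne)
    have := mul_nonpos_of_nonneg_of_nonpos p3.le a2
    have := mul_nonpos_of_nonneg_of_nonpos p1.le a3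
    linarith
  have z2 : o a b B = 0 := by
    by_contra hne
    have := mul_neg_of_pos_of_neg p3 (lt_of_le_of_ne a2 hne)
    have := mul_nonpos_of_nonneg_of_nonpos p2.le a1
    have := mul_nonpos_of_nonneg_of_nonpos p1.le a3
    linarith
  have z3 : o a b C = 0 := by
    by_contra hne
    have := mul_neg_of_pos_of_neg p1 (lt_of_le_of_ne a3 hne)
    have := mul_nonpos_of_nonneg_of_nonpos p2.le a1
    have := mul_nonpos_of_nonneg_of_nonpos p3.le a2
    linarith
  have k1 := h.gp.mem_of_zero ha hb h.hA hab z1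
  have k2 := h.gp.mem_of_zero ha hb h.hB hab z2
  have k3 := h.gp.mem_of_zero ha hb h.hC hab z3
  have := h.AB
  grind

lemma Cfg.left_iff (h : Cfg X A B C) {a b : Pt} (ha : a ∈ X) (hb : b ∈ X) (hab : a ≠ b) :
    (∃ q ∈ X, 0 < o a b q) ↔ ¬ ((a = B ∧ b = A) ∨ (a = C ∧ b = B) ∨ (a = A ∧ b = C)) := by
  have hc := h.ccw
  have e1 : o B C A = o A B C := o_rot A B C
  have e2 : o C A B = o A B C := by rw [← o_rot, ← o_rot]
  constructor
  · rintro ⟨q, hq, hq0⟩ hh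
    obtain ⟨n1, n2, n3⟩ := h.nonneg hq
    rcases hh with ⟨rfl, rfl⟩ | ⟨rfl, rfl⟩ | ⟨rfl, rfl⟩ <;> rw [o_swap] at hq0 <;> linarith
  · intro hh
    by_cases hai : a = A ∨ a = B ∨ a = C
    · by_cases hbi : b = A ∨ b = B ∨ b = C
      · rcases hai with rfl | rfl | rfl <;> rcases hbi with rfl | rfl | rfl <;> simp at hh hab
        · exact ⟨C, h.hC, hc⟩
        · exact ⟨A, h.hA, by linarith⟩
        · exact ⟨B, h.hB, by linarith⟩
      · push Not at hbi
        exact h.left_of_int ha hb hab (Or.inr rfl) hbi.1 hbi.2.1 hbi.2.2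
    · push Not at hai
      exact h.left_of_int ha hb hab (Or.inl rfl) hai.1 hai.2.1 hai.2.2

/-- ordered faces -/
def OF (X : Finset Pt) (T : Finset (Sym2 Pt)) : Finset (Pt × Pt × Pt) :=
  (X ×ˢ X ×ˢ X).filter (fun t => Face X T t.1 t.2.1 t.2.2)

lemma mem_OF (hT : Tri X T) {a b c : Pt} : (a,b,c) ∈ OF X T ↔ Face X T a b c := by
  simp only [OF, Finset.mem_filter, Finset.mem_product]
  exact ⟨fun h => h.2, fun h => ⟨⟨hT.memL h.2.1, hT.memR h.2.1, hT.memR h.2.2.1⟩, h⟩⟩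

/-- directed edges -/
def DE (X : Finset Pt) (T : Finset (Sym2 Pt)) : Finset (Pt × Pt) :=
  (X ×ˢ X).filter (fun t => s(t.1,t.2) ∈ T)

lemma mem_DE (hT : Tri X T) {a b : Pt} : (a,b) ∈ DE X T ↔ s(a,b) ∈ T := by
  simp only [DE, Finset.mem_filter, Finset.mem_product]
  exact ⟨fun h => h.2, fun h => ⟨⟨hT.memL h, hT.memR h⟩, h⟩⟩

lemma card_DE (hT : Tri X T) : (DE X T).card = 2 * T.card := by
  have hmaps : ∀ x ∈ DE X T, s(x.1,x.2) ∈ T := by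
    rintro ⟨a,b⟩ h; exact (mem_DE hT).1 h
  rw [Finset.card_eq_sum_card_fiberwise (f := fun x : Pt × Pt => s(x.1,x.2)) hmaps]
  rw [Finset.sum_const_nat (m := 2), mul_comm]
  intro e he
  induction e using Sym2.ind with
  | _ a b =>
    have : (DE X T).filter (fun x : Pt × Pt => s(x.1,x.2) = s(a,b)) = {(a,b),(b,a)} := by
      ext ⟨x,y⟩
      simp only [Finset.mem_filter, mem_DE hT, Finset.mem_insert, Finset.mem_singleton, Sym2.eq_iff, Prod.mk.injEq]
      constructor
      · rintro ⟨-, h⟩; exact h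
      · rintro (⟨rfl,rfl⟩ | ⟨rfl,rfl⟩)
        · exact ⟨he, by simp⟩
        · exact ⟨swp he, by simp⟩
    rw [this, Finset.card_pair]
    have := hT.ne he
    intro h; simp at h; exact this h.1

lemma card_OF_edges (h : Cfg X A B C) (hT : Tri X T) : (OF X T).card + 3 = 2 * T.card := by
  rw [← card_DE hT]
  have hsub : ({(B,A),(C,B),(A,C)} : Finset (Pt × Pt)) ⊆ DE X T := by
    obtain ⟨h1,h2,h3⟩ := h.hull hT
    intro x hx
    simp only [Finset.mem_insert, Finset.mem_singleton] at hx
    rcases hx with rfl | rfl | rfl <;> rw [mem_DE hT]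
    exacts [swp h1, swp h2, swp h3]
  have hc3 : ({(B,A),(C,B),(A,C)} : Finset (Pt × Pt)).card = 3 := by
    have := h.AB
    rw [Finset.card_eq_three]
    refine ⟨_, _, _, ?_, ?_, ?_, rfl⟩ <;> simp <;> grind
  rw [← Finset.card_sdiff_add_card_eq_card hsub, hc3]
  congr 1
  apply Finset.card_bij (fun t _ => (t.1, t.2.1))
  · rintro ⟨a,b,c⟩ ht
    rw [mem_OF hT] at ht
    simp only [Finset.mem_sdiff, mem_DE hT, Finset.mem_insert, Finset.mem_singleton, Prod.mk.injEq]
    refine ⟨ht.2.1, ?_⟩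
    exact (h.left_iff (hT.memL ht.2.1) (hT.memR ht.2.1) (hT.ne ht.2.1)).1 ⟨c, hT.memR ht.2.2.1, ht.1⟩
  · rintro ⟨a,b,c⟩ ht ⟨a',b',c'⟩ ht' he
    rw [mem_OF hT] at ht ht'
    simp only [Prod.mk.injEq] at he
    obtain ⟨rfl, rfl⟩ := he
    rw [ht.unique h.gp hT ht']
  · rintro ⟨a,b⟩ ht
    simp only [Finset.mem_sdiff, mem_DE hT, Finset.mem_insert, Finset.mem_singleton, Prod.mk.injEq] at ht
    obtain ⟨q, hq, hq0⟩ := (h.left_iff (hT.memL ht.1) (hT.memR ht.1) (hT.ne ht.1)).2 ht.2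
    obtain ⟨c, hc⟩ := exists_face h.gp hT ht.1 hq hq0
    exact ⟨(a,b,c), (mem_OF hT).2 hc, rfl⟩

def upF (X : Finset Pt) (T : Finset (Sym2 Pt)) : Finset (Pt × Pt × Pt) :=
  (OF X T).filter (fun t => t.1.1 < t.2.1.1 ∧ t.2.2.1 < t.1.1)
def dnF (X : Finset Pt) (T : Finset (Sym2 Pt)) : Finset (Pt × Pt × Pt) :=
  (OF X T).filter (fun t => t.2.1.1 < t.1.1 ∧ t.1.1 < t.2.2.1)

lemma card_up (h : Cfg X A B C) (hT : Tri X T) : (upF X T).card = (X \ {A,B,C}).card := by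
  apply Finset.card_bij (fun t _ => t.1)
  · rintro ⟨v,b,c⟩ ht
    simp only [upF, Finset.mem_filter, mem_OF hT] at ht
    obtain ⟨hF, h1, h2⟩ := ht
    have hbX := hT.memR hF.2.1
    have hcX := hT.memR hF.2.2.1
    have hvX := hT.memL hF.2.1
    simp only [Finset.mem_sdiff, Finset.mem_insert, Finset.mem_singleton]
    refine ⟨hvX, ?_⟩
    rintro (rfl | rfl | rfl)
    · have := h.xA c hcX (by rintro rfl; linarith); linarith
    · have := h.xB b hbX (by rintro rfl; linarith); linarith
    · have : b = B := by
        by_contra hb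
        have := h.xC b hbX hb (by rintro rfl; linarith); linarith
      subst this
      have := (h.left_iff hvX hbX (hT.ne hF.2.1)).1 ⟨c, hcX, hF.1⟩
      simp at this
  · rintro ⟨v,b,c⟩ ht ⟨v',b',c'⟩ ht' (rfl : v = v')
    simp only [upF, Finset.mem_filter, mem_OF hT] at ht ht'
    obtain ⟨rfl, rfl⟩ := dir_unique h.gp hT (0,1) ht.1 (by simp [rr]; linarith) (by simp [rr]; linarith) ht'.1
      (by simp [rr]; linarith) (by simp [rr]; linarith)
    rfl
  · intro v hv
    simp only [Finset.mem_sdiff, Finset.mem_insert, Finset.mem_singleton, not_or] at hv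
    obtain ⟨hvX, n1, n2, n3⟩ := hv
    obtain ⟨b, c, hF, h1, h2⟩ := dir_exists h.gp hT hvX (0,1)
      (by intro q hq hne hz; simp [rr] at hz; exact hne (h.xinj q hq v hvX (by linarith)))
      ⟨B, h.hB, by have := h.xB v hvX n2; simp [rr]; linarith⟩
      (fun b hb _ => h.left_of_int hvX (hT.memR hb) (hT.ne hb) (Or.inl rfl) n1 n2 n3)
    refine ⟨(v,b,c), ?_, rfl⟩
    simp only [upF, Finset.mem_filter, mem_OF hT]
    simp [rr] at h1 h2
    exact ⟨hF, by linarith, by linarith⟩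

lemma card_dn (h : Cfg X A B C) (hT : Tri X T) : (dnF X T).card = (X \ {A,B}).card := by
  apply Finset.card_bij (fun t _ => t.1)
  · rintro ⟨v,b,c⟩ ht
    simp only [dnF, Finset.mem_filter, mem_OF hT] at ht
    obtain ⟨hF, h1, h2⟩ := ht
    have hbX := hT.memR hF.2.1
    have hcX := hT.memR hF.2.2.1
    have hvX := hT.memL hF.2.1
    simp only [Finset.mem_sdiff, Finset.mem_insert, Finset.mem_singleton]
    refine ⟨hvX, ?_⟩
    rintro (rfl | rfl)
    · have := h.xA b hbX (by rintro rfl; linarith); linarith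
    · have := h.xB c hcX (by rintro rfl; linarith); linarith
  · rintro ⟨v,b,c⟩ ht ⟨v',b',c'⟩ ht' (rfl : v = v')
    simp only [dnF, Finset.mem_filter, mem_OF hT] at ht ht'
    obtain ⟨rfl, rfl⟩ := dir_unique h.gp hT (0,-1) ht.1 (by simp [rr]; linarith) (by simp [rr]; linarith) ht'.1
      (by simp [rr]; linarith) (by simp [rr]; linarith)
    rfl
  · intro v hv
    simp only [Finset.mem_sdiff, Finset.mem_insert, Finset.mem_singleton, not_or] at hv
    obtain ⟨hvX, n1, n2⟩ := hv
    obtain ⟨b, c, hF, h1, h2⟩ := dir_exists h.gp hT hvX (0,-1)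
      (by intro q hq hne hz; simp [rr] at hz; exact hne (h.xinj q hq v hvX (by linarith)))
      ⟨A, h.hA, by have := h.xA v hvX n1; simp [rr]; linarith⟩
      (fun b hb hbr => by
        rw [h.left_iff hvX (hT.memR hb) (hT.ne hb)]
        simp only [n1, n2, false_and, false_or, or_false]
        rintro ⟨rfl, rfl⟩
        have := h.xB v hvX n2
        simp [rr] at hbr; linarith)
    refine ⟨(v,b,c), ?_, rfl⟩
    simp only [dnF, Finset.mem_filter, mem_OF hT]
    simp [rr] at h1 h2
    exact ⟨hF, by linarith, by linarith⟩

def rotE : (Pt × Pt × Pt) ≃ (Pt × Pt × Pt) :=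
  ⟨fun t => (t.2.1, t.2.2, t.1), fun t => (t.2.2, t.1, t.2.1), fun _ => rfl, fun _ => rfl⟩

lemma card_OF_mid (h : Cfg X A B C) (hT : Tri X T) :
    (OF X T).card = 3 * ((upF X T).card + (dnF X T).card) := by
  set M := (OF X T).filter (fun t => (t.1.1 < t.2.1.1 ∧ t.2.2.1 < t.1.1) ∨ (t.2.1.1 < t.1.1 ∧ t.1.1 < t.2.2.1)) with hM
  have hMc : M.card = (upF X T).card + (dnF X T).card := by
    rw [hM, Finset.filter_or, Finset.card_union_of_disjoint]
    · rfl
    · rw [Finset.disjoint_filter]; rintro ⟨a,b,c⟩ - h1 h2; linarith [h1.1, h2.1]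
  have hU : OF X T = M ∪ (M.map rotE.toEmbedding ∪ M.map (rotE.trans rotE).toEmbedding) := by
    ext ⟨a,b,c⟩
    simp only [Finset.mem_union, Finset.mem_map_equiv, hM, Finset.mem_filter, mem_OF hT, rotE, Equiv.symm_trans_apply, Equiv.coe_fn_symm_mk]
    constructor
    · intro hF
      have hF2 := hF.rot
      have hF3 := hF2.rot
      have a1 : a.1 ≠ b.1 := fun e => hT.ne hF.2.1 (h.xinj _ (hT.memL hF.2.1) _ (hT.memR hF.2.1) e)
      have a2 : b.1 ≠ c.1 := fun e => hT.ne hF.2.2.1 (h.xinj _ (hT.memL hF.2.2.1) _ (hT.memR hF.2.2.1) e)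
      have a3 : c.1 ≠ a.1 := fun e => hT.ne hF.2.2.2.1 (h.xinj _ (hT.memL hF.2.2.2.1) _ (hT.memR hF.2.2.2.1) e)
      simp only [hF, hF2, hF3, true_and]
      rcases lt_or_gt_of_ne a1 with a1 | a1 <;> rcases lt_or_gt_of_ne a2 with a2 | a2 <;>
      rcases lt_or_gt_of_ne a3 with a3 | a3 <;> simp [a1, a2, a3] <;> linarith
    · rintro (h1 | h1 | h1)
      · exact h1.1
      · exact h1.1.rot
      · exact h1.1.rot.rot
  have hd2 : Disjoint (M.map rotE.toEmbedding) (M.map (rotE.trans rotE).toEmbedding) := by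
    rw [Finset.disjoint_left]
    rintro ⟨a,b,c⟩ h1 h2
    simp only [Finset.mem_map_equiv, hM, Finset.mem_filter, rotE, Equiv.symm_trans_apply, Equiv.coe_fn_symm_mk] at h1 h2
    rcases h1.2 with h1 | h1 <;> rcases h2.2 with h2 | h2 <;> linarith [h1.1,h1.2,h2.1,h2.2]
  have hd1 : Disjoint M (M.map rotE.toEmbedding ∪ M.map (rotE.trans rotE).toEmbedding) := by
    rw [Finset.disjoint_left]
    rintro ⟨a,b,c⟩ h1 h2
    simp only [Finset.mem_union, Finset.mem_map_equiv, hM, Finset.mem_filter, rotE, Equiv.symm_trans_apply, Equiv.coe_fn_symm_mk] at h1 h2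
    rcases h2 with h2 | h2 <;> rcases h1.2 with h1 | h1 <;> rcases h2.2 with h2 | h2 <;> linarith [h1.1,h1.2,h2.1,h2.2]
  rw [hU, Finset.card_union_of_disjoint hd1, Finset.card_union_of_disjoint hd2, Finset.card_map, Finset.card_map, hMc]
  ring

lemma Cfg.card3 (h : Cfg X A B C) : (X \ {A,B,C}).card + 3 = X.card ∧ (X \ {A,B}).card + 2 = X.card := by
  have hh := h.AB
  constructor
  · rw [← Finset.card_sdiff_add_card_eq_card (s := {A,B,C}) (t := X)]
    · congr 1
      rw [Finset.card_eq_three.2 ⟨A,B,C,hh.1,hh.2.2.symm,hh.2.1,rfl⟩]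
    · intro x hx; simp at hx; rcases hx with rfl | rfl | rfl
      exacts [h.hA, h.hB, h.hC]
  · rw [← Finset.card_sdiff_add_card_eq_card (s := {A,B}) (t := X)]
    · congr 1
      rw [Finset.card_pair hh.1]
    · intro x hx; simp at hx; rcases hx with rfl | rfl
      exacts [h.hA, h.hB]

/-- number of edges of a triangulation -/
lemma card_Tri (h : Cfg X A B C) (hT : Tri X T) : T.card + 6 = 3 * X.card := by
  have h1 := card_OF_edges h hT
  have h2 := card_OF_mid h hT
  rw [card_up h hT, card_dn h hT] at h2
  have h3 := h.card3
  omega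

lemma card_OF (h : Cfg X A B C) (hT : Tri X T) : (OF X T).card + 15 = 6 * X.card := by
  have h1 := card_OF_edges h hT
  have h2 := card_Tri h hT
  have := h.card3
  omega

/-- plane graphs -/
def Plane (X : Finset Pt) (G : Finset (Sym2 Pt)) : Prop :=
  ∀ a b, s(a,b) ∈ G → a ∈ X ∧ b ∈ X ∧ a ≠ b ∧ ∀ c d, s(c,d) ∈ G → ¬ cr a b c d

lemma Tri.plane (hT : Tri X T) : Plane X T := fun a b h => (hT a b).1 h

lemma Plane.mono {G H : Finset (Sym2 Pt)} (h : Plane X G) (hs : H ⊆ G) : Plane X H := fun a b hab => by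
  obtain ⟨h1,h2,h3,h4⟩ := h a b (hs hab)
  exact ⟨h1,h2,h3,fun c d hcd => h4 c d (hs hcd)⟩

lemma Plane.insert {G : Finset (Sym2 Pt)} (h : Plane X G) {a b : Pt} (ha : a ∈ X) (hb : b ∈ X) (hab : a ≠ b)
    (hn : ∀ c d, s(c,d) ∈ G → ¬ cr a b c d) : Plane X (insert s(a,b) G) := by
  have ncself : ∀ a b : Pt, ¬ cr a b a b := by intro a b hh; have := hh.1; simp at this
  have ncself' : ∀ a b : Pt, ¬ cr a b b a := by intro a b hh; have := hh.1; simp at this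
  intro c d hcd
  rw [Finset.mem_insert, Sym2.eq_iff] at hcd
  rcases hcd with (⟨rfl,rfl⟩ | ⟨rfl,rfl⟩) | hcd
  · refine ⟨ha, hb, hab, fun e f hef hcr => ?_⟩
    rw [Finset.mem_insert, Sym2.eq_iff] at hef
    rcases hef with (⟨rfl,rfl⟩ | ⟨rfl,rfl⟩) | hef
    · exact ncself _ _ hcr
    · exact ncself' _ _ hcr
    · exact hn e f hef hcr
  · refine ⟨hb, ha, hab.symm, fun e f hef hcr => ?_⟩
    rw [Finset.mem_insert, Sym2.eq_iff] at hef
    rcases hef with (⟨rfl,rfl⟩ | ⟨rfl,rfl⟩) | hef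
    · exact ncself' _ _ hcr
    · exact ncself _ _ hcr
    · exact hn e f hef (cr_swapL hcr)
  · obtain ⟨h1,h2,h3,h4⟩ := h c d hcd
    refine ⟨h1, h2, h3, fun e f hef hcr => ?_⟩
    rw [Finset.mem_insert, Sym2.eq_iff] at hef
    rcases hef with (⟨rfl,rfl⟩ | ⟨rfl,rfl⟩) | hef
    · exact hn c d hcd (cr_symm hcr)
    · exact hn c d hcd (cr_symm (cr_swapR hcr))
    · exact h4 e f hef hcr

lemma Plane.sub {G : Finset (Sym2 Pt)} (h : Plane X G) : G ⊆ X.sym2 := by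
  intro e he
  induction e using Sym2.ind with
  | _ a b => obtain ⟨h1,h2,-⟩ := h a b he; simp [h1,h2]

lemma Plane.extend {G : Finset (Sym2 Pt)} (h : Plane X G) : ∃ T, Tri X T ∧ G ⊆ T := by
  let P := X.sym2.powerset.filter (fun H => Plane X H ∧ G ⊆ H)
  have hP : P.Nonempty := ⟨G, by simp [P, h, h.sub]⟩
  obtain ⟨T, hT, hmax⟩ := P.exists_max_image Finset.card hP
  simp only [P, Finset.mem_filter, Finset.mem_powerset] at hT hmax
  obtain ⟨-, hTp, hGT⟩ := hT
  refine ⟨T, ?_, hGT⟩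
  intro a b
  refine ⟨fun hab => hTp a b hab, ?_⟩
  rintro ⟨h1,h2,h3,h4⟩
  by_contra hab
  have hi := hTp.insert h1 h2 h3 h4
  have := hmax _ ⟨hi.sub, hi, hGT.trans (Finset.subset_insert _ _)⟩
  rw [Finset.card_insert_of_notMem hab] at this
  omega

lemma Plane.tri {G : Finset (Sym2 Pt)} (hC : Cfg X A B C) (h : Plane X G) (hc : 3 * X.card ≤ G.card + 6) : Tri X G := by
  obtain ⟨T, hT, hs⟩ := h.extend
  have := card_Tri hC hT
  rw [Finset.eq_of_subset_of_card_le hs (by omega)]; exact hT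

lemma Plane.card_le {G : Finset (Sym2 Pt)} (hC : Cfg X A B C) (h : Plane X G) : G.card + 6 ≤ 3 * X.card := by
  obtain ⟨T, hT, hs⟩ := h.extend
  have := card_Tri hC hT
  have := Finset.card_le_card hs
  omega

lemma quad_pos {a b c d : Pt} (h1 : 0 < o a b c) (h : cr a b c d) :
    0 < o b c d ∧ 0 < o c a d ∧ o a b d < 0 := by
  have h2 : o a b d < 0 := by
    have := h.1; by_contra hh; push Not at hh; nlinarith [mul_nonneg h1.le hh]
  have h3 := h.2
  have e1 : o c d b = o b c d := by unfold o; ring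
  have e2 : o c d a = - o c a d := by unfold o; ring
  rw [e1, e2] at h3
  have h4 := o_four a b c d
  have h5 : 0 < o c a d * o b c d := by linarith
  rcases pos_and_pos_or_neg_and_neg_of_mul_pos h5 with ⟨x,y⟩ | ⟨x,y⟩
  · exact ⟨y,x,h2⟩
  · linarith

lemma flip_ncr (hX : GP X) (hT : Tri X T) {a b c d f g : Pt} (h1 : Face X T a b c) (h2 : Face X T b a d)
    (hcr : cr a b c d) (hfg : s(f,g) ∈ T) (hne : s(f,g) ≠ s(a,b)) : ¬ cr c d f g := by
  intro hc
  obtain ⟨u, r, hu0, hu1, hr0, hr1, he⟩ := exists_meet_of_cr hc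
  obtain ⟨p1, p2, p3⟩ := quad_pos h1.1 hcr
  obtain ⟨p4, p5, p6⟩ := quad_pos h2.1 (cr_swapR (cr_swapL hcr))
  rcases lt_trichotomy (o a b (lerp u c d)) 0 with h | h | h
  · refine h2.inside hX hT hfg hr0 hr1 he (by rw [o_swap]; linarith) ?_ ?_
    · rw [o_lerp]; simp; nlinarith
    · rw [o_lerp]; simp; nlinarith
  · obtain ⟨r', u', hr0', hr1', hu0', hu1', he'⟩ := exists_meet_of_cr hcr
    have h5 : (1-u') * o a b c + u' * o a b d = 0 := by rw [← o_lerp, ← he', o_lerp]; simp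
    rw [o_lerp] at h
    have : u = u' := by
      have : (u - u') * (o a b d - o a b c) = 0 := by linear_combination h - h5
      rcases mul_eq_zero.1 this with h6 | h6
      · linarith
      · have := h1.1; linarith
    subst this
    exact hne (hT.meet_eq hX hfg h1.2.1 hr0 hr1 hr0' hr1' (by rw [← he, he']))
  · refine h1.inside hX hT hfg hr0 hr1 he h ?_ ?_
    · rw [o_lerp]; simp; nlinarith
    · rw [o_lerp]; simp; nlinarith

lemma flip_tri (hC : Cfg X A B C) (hT : Tri X T) {a b c d : Pt} (h1 : Face X T a b c) (h2 : Face X T b a d)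
    (hcr : cr a b c d) : Tri X (insert s(c,d) (T.erase s(a,b))) ∧ s(c,d) ∉ T := by
  have hn : s(c,d) ∉ T := fun h => hT.ncr h1.2.1 h hcr
  refine ⟨?_, hn⟩
  have hcd : c ≠ d := by rintro rfl; have := hcr.2; simp at this
  apply Plane.tri hC
  · apply (hT.plane.mono (Finset.erase_subset _ _)).insert (hT.memR h1.2.2.1) (hT.memR h2.2.2.1) hcd
    intro f g hfg
    rw [Finset.mem_erase] at hfg
    exact flip_ncr hC.gp hT h1 h2 hcr hfg.2 hfg.1
  · rw [Finset.card_insert_of_notMem (fun h => hn (Finset.mem_of_mem_erase h)), Finset.card_erase_of_mem h1.2.1]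
    have := card_Tri hC hT
    have : 0 < T.card := Finset.card_pos.2 ⟨_, h1.2.1⟩
    omega

end
end SC
end

noncomputable section
namespace SC
section Forest

abbrev DN := DualNumber ℤ

def w1 : DN := 1 + DualNumber.eps

inductive Rch : DN → Prop
  | one : Rch 1
  | step {a b : DN} : Rch a → Rch b → Rch (1 + w1 * (a * b))

inductive RchK : ℕ → DN → Prop
  | zero : RchK 0 1
  | succ {k : ℕ} {x r : DN} : RchK k x → Rch r → RchK (k+1) (x * r)

lemma RchK.mono1 {k : ℕ} {x : DN} (h : RchK k x) : RchK (k+1) x := by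
  have := RchK.succ h Rch.one
  rwa [mul_one] at this

lemma RchK.mono {k l : ℕ} {x : DN} (h : RchK k x) (hl : k ≤ l) : RchK l x := by
  induction l, hl using Nat.le_induction with
  | base => exact h
  | succ n _ ih => exact ih.mono1

lemma RchK.rch {x : DN} (h : RchK 2 x) : Rch (1 + w1 * x) := by
  rcases h with _ | ⟨h, h1⟩
  rcases h with _ | ⟨h, h2⟩
  rcases h
  rw [one_mul]; exact Rch.step h2 h1

def GoodP (a s : ℤ) : Prop :=
  (a = 1 ∧ 0 ≤ s) ∨ (a = 2 ∧ 1 ≤ s) ∨ (a = 3 ∧ 3 ≤ s) ∨ (a = 4 ∧ 6 ≤ s) ∨ (a = 5 ∧ 8 ≤ s) ∨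
  (6 ≤ a ∧ 2*a ≤ s ∧ 3*a-6 ≤ s ∧ 7*a-28 ≤ 2*s ∧ 4*a-28 ≤ s)

def GoodE (a s : ℤ) : Prop :=
  (a = 1 ∧ 0 = s) ∨ (a = 2 ∧ 1 = s) ∨ (a = 3 ∧ 3 = s) ∨ (a = 4 ∧ 6 = s) ∨ (a = 5 ∧ 8 = s) ∨
  (6 ≤ a ∧ 2*a ≤ s ∧ 3*a-6 ≤ s ∧ 7*a-28 ≤ 2*s ∧ 4*a-28 ≤ s)

lemma GoodP.exact {a s : ℤ} (h : GoodP a s) : 1 ≤ a ∧ ∃ s', s' ≤ s ∧ 0 ≤ s' ∧ GoodE a s' := by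
  unfold GoodP at h
  refine ⟨by omega, ?_⟩
  rcases h with ⟨rfl, h⟩ | ⟨rfl, h⟩ | ⟨rfl, h⟩ | ⟨rfl, h⟩ | ⟨rfl, h⟩ | h
  · exact ⟨0, h, by norm_num, by simp [GoodE]⟩
  · exact ⟨1, h, by norm_num, by simp [GoodE]⟩
  · exact ⟨3, h, by norm_num, by simp [GoodE]⟩
  · exact ⟨6, h, by norm_num, by simp [GoodE]⟩
  · exact ⟨8, h, by norm_num, by simp [GoodE]⟩
  · exact ⟨s, le_rfl, by omega, by unfold GoodE; right; right; right; right; right; exact h⟩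

lemma GoodP.mono {a s s' : ℤ} (h : GoodP a s) (hs : s ≤ s') : GoodP a s' := by
  unfold GoodP at *; omega

lemma GoodP.step {a s b t : ℤ} (h1 : GoodP a s) (h2 : GoodP b t) :
    GoodP (1+a*b) (a*b + s*b + a*t) := by
  obtain ⟨ha, s', hs, hs0, h1⟩ := h1.exact
  obtain ⟨hb, t', ht, ht0, h2⟩ := h2.exact
  have k1 : s'*b ≤ s*b := mul_le_mul_of_nonneg_right hs (by omega)
  have k2 : a*t' ≤ a*t := mul_le_mul_of_nonneg_left ht (by omega)
  refine GoodP.mono (s := a*b + s'*b + a*t') ?_ (by linarith)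
  clear k1 k2 hs ht
  unfold GoodE at *
  unfold GoodP
  rcases h1 with ⟨rfl, rfl⟩ | ⟨rfl, rfl⟩ | ⟨rfl, rfl⟩ | ⟨rfl, rfl⟩ | ⟨rfl, rfl⟩ | h1 <;>
  rcases h2 with ⟨rfl, rfl⟩ | ⟨rfl, rfl⟩ | ⟨rfl, rfl⟩ | ⟨rfl, rfl⟩ | ⟨rfl, rfl⟩ | h2
  all_goals try omega
  obtain ⟨h, h', h'', h3, h4⟩ := h1
  obtain ⟨g, g', g'', g3, g4⟩ := h2
  have e1 : 2*(a*b) ≤ s'*b := by nlinarith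
  have e2 : 2*(a*b) ≤ a*t' := by nlinarith
  have e3 : 36 ≤ a*b := by nlinarith
  right; right; right; right; right
  refine ⟨?_,?_,?_,?_,?_⟩ <;> linarith

lemma GoodP.fin {a s b t c u : ℤ} (h1 : GoodP a s) (h2 : GoodP b t) (h3 : GoodP c u) :
    4*(a*b*c) - (s*b*c + a*t*c + a*b*u) ≤ 28 := by
  have big : ∀ {a s b t c u : ℤ}, 6 ≤ a → 2*a ≤ s → 6 ≤ b → 2*b ≤ t → 1 ≤ c → 0 ≤ u →
      4*(a*b*c) - (s*b*c + a*t*c + a*b*u) ≤ 28 := by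
    intro a s b t c u h1 h2 h3 h4 h5 h6
    have e1 : 0 ≤ (s-2*a)*(b*c) := mul_nonneg (by linarith) (mul_nonneg (by linarith) (by linarith))
    have e2 : 0 ≤ (t-2*b)*(a*c) := mul_nonneg (by linarith) (mul_nonneg (by linarith) (by linarith))
    have e3 : 0 ≤ u*(a*b) := mul_nonneg (by linarith) (mul_nonneg (by linarith) (by linarith))
    linarith
  obtain ⟨ha, s', hs, hs0, h1⟩ := h1.exact
  obtain ⟨hb, t', ht, ht0, h2⟩ := h2.exact
  obtain ⟨hc, u', hu, hu0, h3⟩ := h3.exact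
  have k1 : 0 ≤ (s-s')*(b*c) := mul_nonneg (by linarith) (mul_nonneg (by linarith) (by linarith))
  have k2 : 0 ≤ (t-t')*(a*c) := mul_nonneg (by linarith) (mul_nonneg (by linarith) (by linarith))
  have k3 : 0 ≤ (u-u')*(a*b) := mul_nonneg (by linarith) (mul_nonneg (by linarith) (by linarith))
  suffices hh : 4*(a*b*c) - (s'*b*c + a*t'*c + a*b*u') ≤ 28 by linarith
  clear k1 k2 k3 hs ht hu
  unfold GoodE at *
  rcases h1 with ⟨rfl, rfl⟩ | ⟨rfl, rfl⟩ | ⟨rfl, rfl⟩ | ⟨rfl, rfl⟩ | ⟨rfl, rfl⟩ | h1 <;>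
  rcases h2 with ⟨rfl, rfl⟩ | ⟨rfl, rfl⟩ | ⟨rfl, rfl⟩ | ⟨rfl, rfl⟩ | ⟨rfl, rfl⟩ | h2 <;>
  rcases h3 with ⟨rfl, rfl⟩ | ⟨rfl, rfl⟩ | ⟨rfl, rfl⟩ | ⟨rfl, rfl⟩ | ⟨rfl, rfl⟩ | h3
  all_goals try omega
  all_goals first
  | (have := big h1.1 h1.2.1 h2.1 h2.2.1 hc hu0; linarith)
  | (have := big h1.1 h1.2.1 h3.1 h3.2.1 hb ht0; linarith)
  | (have := big h2.1 h2.2.1 h3.1 h3.2.1 ha hs0; linarith)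

lemma Rch.good {x : DN} (h : Rch x) : GoodP x.fst x.snd := by
  induction h with
  | one => left; simp
  | @step a b _ _ ih1 ih2 =>
    have := ih1.step ih2
    convert this using 1
    · simp [w1]
    · simp [w1]; ring

lemma RchK.bound {x : DN} (h : RchK 3 x) : 4 * x.fst - x.snd ≤ 28 := by
  rcases h with _ | ⟨h, h1⟩
  rcases h with _ | ⟨h, h2⟩
  rcases h with _ | ⟨h, h3⟩
  rcases h
  have := h3.good.fin h2.good h1.good
  refine le_trans (le_of_eq ?_) this
  simp
  ring

variable {ι : Type*} (par : ι → Option ι)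

def IsIdeal (N W : Finset ι) : Prop :=
  W ⊆ N ∧ ∀ v ∈ W, ∀ u, par v = some u → u ∈ W

def Zf (N : Finset ι) (y : ι → DN) : DN :=
  ∑ W ∈ N.powerset.filter (fun W => IsIdeal par N W), ∏ v ∈ W, y v

variable {par}

lemma Zf_split {N : Finset ι} (y : ι → DN) {v : ι} (hv : v ∈ N) (hleaf : ∀ w ∈ N, par w ≠ some v) :
    Zf par N y = ∑ W ∈ (N.erase v).powerset.filter (fun W => IsIdeal par (N.erase v) W),
      (if ∀ u, par v = some u → u ∈ W then (∏ w ∈ W, y w) * (1 + y v) else ∏ w ∈ W, y w) := by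
  unfold Zf
  have : ∀ W : Finset ι, (if ∀ u, par v = some u → u ∈ W then (∏ w ∈ W, y w) * (1 + y v) else ∏ w ∈ W, y w)
      = (∏ w ∈ W, y w) + (if ∀ u, par v = some u → u ∈ W then (∏ w ∈ W, y w) * y v else 0) := by
    intro W; split_ifs <;> ring
  simp only [this]
  rw [Finset.sum_add_distrib, ← Finset.sum_filter_add_sum_filter_not _ (fun W => v ∉ W)]
  congr 1
  · apply Finset.sum_congr _ (fun _ _ => rfl)
    ext W
    simp only [Finset.mem_filter, Finset.mem_powerset]; unfold IsIdeal
    constructor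
    · rintro ⟨⟨h1, -, h2⟩, h3⟩
      have : W ⊆ N.erase v := fun x hx => Finset.mem_erase.2 ⟨fun h => h3 (h ▸ hx), h1 hx⟩
      exact ⟨this, this, h2⟩
    · rintro ⟨h1, -, h2⟩
      have : W ⊆ N := h1.trans (Finset.erase_subset _ _)
      exact ⟨⟨this, this, h2⟩, fun h => (Finset.mem_erase.1 (h1 h)).1 rfl⟩
  · rw [← Finset.sum_filter]
    refine Finset.sum_bij' (fun W _ => W.erase v) (fun W _ => insert v W) ?_ ?_ ?_ ?_ ?_
    · intro W hW
      simp only [Finset.mem_filter, Finset.mem_powerset, not_not] at hW ⊢; unfold IsIdeal at *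
      obtain ⟨⟨h1, -, h2⟩, h3⟩ := hW
      have : W.erase v ⊆ N.erase v := Finset.erase_subset_erase _ h1
      refine ⟨⟨this, this, ?_⟩, ?_⟩
      · intro w hw u hu
        refine Finset.mem_erase.2 ⟨?_, h2 w (Finset.mem_of_mem_erase hw) u hu⟩
        rintro rfl; exact hleaf w (h1 (Finset.mem_of_mem_erase hw)) hu
      · intro u hu
        refine Finset.mem_erase.2 ⟨?_, h2 v h3 u hu⟩
        rintro rfl; exact hleaf u hv hu
    · intro W hW
      simp only [Finset.mem_filter, Finset.mem_powerset, not_not] at hW ⊢; unfold IsIdeal at *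
      obtain ⟨⟨h1, -, h2⟩, h3⟩ := hW
      have : insert v W ⊆ N := Finset.insert_subset hv (h1.trans (Finset.erase_subset _ _))
      refine ⟨⟨this, this, ?_⟩, Finset.mem_insert_self _ _⟩
      intro w hw u hu
      rcases Finset.mem_insert.1 hw with rfl | hw
      · exact Finset.mem_insert_of_mem (h3 u hu)
      · exact Finset.mem_insert_of_mem (h2 w hw u hu)
    · intro W hW
      simp only [Finset.mem_filter, not_not] at hW
      exact Finset.insert_erase hW.2
    · intro W hW
      simp only [Finset.mem_filter, Finset.mem_powerset] at hW
      exact Finset.erase_insert (fun h => (Finset.mem_erase.1 (hW.1.1 h)).1 rfl)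
    · intro W hW
      simp only [Finset.mem_filter, not_not] at hW
      rw [mul_comm, Finset.mul_prod_erase _ _ hW.2]

lemma Zf_main (H : ι → ℝ) (n : ℕ) : ∀ (N : Finset ι) (y : ι → DN) (k0 : ℕ) (x0 : DN), N.card = n →
    (∀ v ∈ N, ∀ u ∈ N, par v = some u → H v < H u) → RchK k0 x0 →
    k0 + (N.filter (fun v => par v = none)).card ≤ 3 →
    (∀ u ∈ N, ∃ k x, RchK k x ∧ y u = w1 * x ∧ k + (N.filter (fun v => par v = some u)).card ≤ 2) →
    RchK 3 (Zf par N y * x0) := by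
  induction n with
  | zero =>
    intro N y k0 x0 hN _ hx hk _
    rw [Finset.card_eq_zero] at hN
    subst hN
    have : Zf par ∅ y = 1 := by
      unfold Zf
      rw [Finset.sum_eq_single ∅]
      · simp
      · intro b hb hb'; simp at hb; exact absurd hb.1 hb'
      · intro h; simp [IsIdeal] at h
    rw [this, one_mul]
    exact hx.mono (by omega)
  | succ n ih =>
    intro N y k0 x0 hN hH hx hk hy
    have hne : N.Nonempty := by rw [← Finset.card_pos]; omega
    obtain ⟨v, hv, hmin⟩ := N.exists_min_image H hne
    have hleaf : ∀ w ∈ N, par w ≠ some v := by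
      intro w hw hp
      have := hH w hw v hv hp
      have := hmin w hw
      linarith
    obtain ⟨kv, xv, hxv, hyv, hkv⟩ := hy v hv
    have hr : Rch (1 + y v) := by rw [hyv]; exact (hxv.mono (by omega)).rch
    have hcard : (N.erase v).card = n := by rw [Finset.card_erase_of_mem hv]; omega
    have hH' : ∀ w ∈ N.erase v, ∀ u ∈ N.erase v, par w = some u → H w < H u := fun w hw u hu =>
      hH w (Finset.mem_of_mem_erase hw) u (Finset.mem_of_mem_erase hu)
    have hfilt : ∀ o, ((N.erase v).filter (fun w => par w = o)).card ≤ (N.filter (fun w => par w = o)).card :=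
      fun o => Finset.card_le_card (Finset.filter_subset_filter _ (Finset.erase_subset _ _))
    have hfilt' : ∀ o, par v = o → ((N.erase v).filter (fun w => par w = o)).card + 1 = (N.filter (fun w => par w = o)).card := by
      intro o ho
      rw [Finset.filter_erase, Finset.card_erase_add_one]
      simp [hv, ho]
    rw [Zf_split y hv hleaf]
    rcases hp : par v with _ | u
    · have := ih (N.erase v) y (k0+1) (x0 * (1 + y v)) hcard hH' (hx.succ hr)
        (by have := hfilt' _ hp; omega)
        (fun u hu => by
          obtain ⟨k, x, h1, h2, h3⟩ := hy u (Finset.mem_of_mem_erase hu)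
          exact ⟨k, x, h1, h2, by have := hfilt (some u); omega⟩)
      convert this using 1
      simp only [reduceCtorEq, false_implies, implies_true, if_true]
      rw [← Finset.sum_mul]; unfold Zf; ring
    · by_cases hu : u ∈ N
      · have huv : u ≠ v := by rintro rfl; exact hleaf u hv hp
        have := ih (N.erase v) (Function.update y u (y u * (1 + y v))) k0 x0 hcard hH' hx
          (by have := hfilt none; omega)
          (fun u' hu' => by
            obtain ⟨k, x, h1, h2, h3⟩ := hy u' (Finset.mem_of_mem_erase hu')
            by_cases hh : u' = u
            · subst hh
              refine ⟨k+1, x * (1 + y v), h1.succ hr, ?_, ?_⟩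
              · rw [Function.update_self, h2, mul_assoc]
              · have := hfilt' _ hp; omega
            · exact ⟨k, x, h1, by rw [Function.update_of_ne hh, h2], by have := hfilt (some u'); omega⟩)
        convert this using 2
        unfold Zf
        apply Finset.sum_congr rfl
        intro W hW
        by_cases huW : u ∈ W
        · rw [if_pos (by intro u' h; simp at h; rwa [← h]), ← Finset.mul_prod_erase _ _ huW,
            ← Finset.mul_prod_erase _ (Function.update _ _ _) huW, Function.update_self]
          have hpe : ∏ x ∈ W.erase u, Function.update y u (y u * (1 + y v)) x = ∏ x ∈ W.erase u, y x :=
            Finset.prod_congr rfl (fun w hw => by rw [Function.update_of_ne (Finset.mem_erase.1 hw).1])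
          rw [hpe]; ring
        · rw [if_neg (by intro h; exact huW (h u rfl))]
          apply Finset.prod_congr rfl
          intro w hw; rw [Function.update_of_ne]; rintro rfl; exact huW hw
      · have := ih (N.erase v) y k0 x0 hcard hH' hx (by have := hfilt none; omega)
          (fun u hu => by
            obtain ⟨k, x, h1, h2, h3⟩ := hy u (Finset.mem_of_mem_erase hu)
            exact ⟨k, x, h1, h2, by have := hfilt (some u); omega⟩)
        convert this using 2
        unfold Zf
        apply Finset.sum_congr rfl
        intro W hW
        rw [if_neg]
        intro h
        simp only [Finset.mem_filter, Finset.mem_powerset] at hW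
        exact hu (Finset.mem_of_mem_erase (hW.1 (h u rfl)))

theorem forest (H : ι → ℝ) (N : Finset ι)
    (hH : ∀ v ∈ N, ∀ u ∈ N, par v = some u → H v < H u)
    (h0 : (N.filter (fun v => par v = none)).card ≤ 3)
    (h2 : ∀ u ∈ N, (N.filter (fun v => par v = some u)).card ≤ 2) :
    ∑ W ∈ N.powerset.filter (fun W => IsIdeal par N W), (4 - (W.card : ℤ)) ≤ 28 := by
  have h := Zf_main (par := par) H N.card N (fun _ => w1) 0 1 rfl hH RchK.zero (by omega)
    (fun u hu => ⟨0, 1, RchK.zero, by simp, by have := h2 u hu; omega⟩)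
  rw [mul_one] at h
  refine le_trans (le_of_eq ?_) h.bound
  have hp : ∀ n : ℕ, (w1 ^ n).fst = 1 ∧ (w1^n).snd = n := by
    intro n
    induction n with
    | zero => simp
    | succ n ih => rw [pow_succ]; simp [ih, w1]; ring
  unfold Zf
  rw [TrivSqZeroExt.fst_sum, TrivSqZeroExt.snd_sum, Finset.mul_sum, ← Finset.sum_sub_distrib]
  apply Finset.sum_congr rfl
  intro W _
  rw [Finset.prod_const, (hp _).1, (hp _).2]; ring

end Forest
end SC
end

noncomputable section
namespace SC
section Heights
variable {X : Finset Pt} {T : Finset (Sym2 Pt)} {A B C : Pt}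

def D4 (h : Pt → ℝ) (a b c d : Pt) : ℝ :=
  o a b c * h d - (o b c d * h a + o c a d * h b + o a b d * h c)

lemma D4_swap (h : Pt → ℝ) (a b c d : Pt) : D4 h b a d c = D4 h a b c d := by
  unfold D4 o; ring
lemma D4_neg (h : Pt → ℝ) (a b c d : Pt) : D4 h a c d b = D4 h a b c d := by
  unfold D4 o; ring

/-- generic convex heights -/
def Ht (X : Finset Pt) (h : Pt → ℝ) : Prop :=
  (∀ a ∈ X, ∀ b ∈ X, ∀ c ∈ X, ∀ d ∈ X, 0 < o a b d → 0 < o b c d → 0 < o c a d → D4 h a b c d < 0) ∧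
  (∀ a ∈ X, ∀ b ∈ X, ∀ c ∈ X, ∀ d ∈ X, a ≠ b → a ≠ c → b ≠ c → d ≠ a → d ≠ b → d ≠ c → D4 h a b c d ≠ 0)

def sqh (q : Pt) : ℝ := q.1^2+q.2^2

lemma sqh_neg {a b c d : Pt} (h1 : 0 < o a b d) (h2 : 0 < o b c d) (h3 : 0 < o c a d) : D4 sqh a b c d < 0 := by
  have h4 : o a b c = o a b d + o b c d + o c a d := o_four a b c d
  have hab : 0 < (a.1-b.1)^2 + (a.2-b.2)^2 := by
    by_contra hh
    have e1 : a.1 - b.1 = 0 := by nlinarith [sq_nonneg (a.1-b.1), sq_nonneg (a.2-b.2)]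
    have e2 : a.2 - b.2 = 0 := by nlinarith [sq_nonneg (a.1-b.1), sq_nonneg (a.2-b.2)]
    have : a = b := by ext <;> linarith
    subst this; simp at h1
  have key : o a b c * D4 sqh a b c d = -(o b c d * o c a d * ((a.1-b.1)^2 + (a.2-b.2)^2) +
      o c a d * o a b d * ((b.1-c.1)^2 + (b.2-c.2)^2) + o a b d * o b c d * ((c.1-a.1)^2 + (c.2-a.2)^2)) := by
    unfold D4 sqh o; ring
  have p1 : 0 < o b c d * o c a d * ((a.1-b.1)^2 + (a.2-b.2)^2) := by positivity
  have p2 : 0 ≤ o c a d * o a b d * ((b.1-c.1)^2 + (b.2-c.2)^2) := by positivity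
  have p3 : 0 ≤ o a b d * o b c d * ((c.1-a.1)^2 + (c.2-a.2)^2) := by positivity
  have p4 : 0 < o a b c := by linarith
  by_contra hh
  push Not at hh
  have := mul_nonneg p4.le hh
  linarith

def D4l (a b c d : Pt) : (Pt → ℝ) →ₗ[ℝ] ℝ where
  toFun h := D4 h a b c d
  map_add' x y := by simp [D4]; ring
  map_smul' r x := by simp [D4]; ring

lemma exists_generic (hX : GP X) : ∃ g : Pt → ℝ, ∀ a ∈ X, ∀ b ∈ X, ∀ c ∈ X, ∀ d ∈ X, a ≠ b → a ≠ c → b ≠ c →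
    d ≠ a → d ≠ b → d ≠ c → D4 g a b c d ≠ 0 := by
  let Q := (X ×ˢ X ×ˢ X ×ˢ X).filter (fun t => t.1 ≠ t.2.1 ∧ t.1 ≠ t.2.2.1 ∧ t.2.1 ≠ t.2.2.1 ∧
    t.2.2.2 ≠ t.1 ∧ t.2.2.2 ≠ t.2.1 ∧ t.2.2.2 ≠ t.2.2.1)
  let F := Q.image (fun t => LinearMap.ker (D4l t.1 t.2.1 t.2.2.1 t.2.2.2))
  have hF : ⊤ ∉ F := by
    intro h
    simp only [F, Finset.mem_image] at h
    obtain ⟨⟨a,b,c,d⟩, ht, he⟩ := h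
    simp only [Q, Finset.mem_filter, Finset.mem_product] at ht
    obtain ⟨⟨h1,h2,h3,h4⟩,n1,n2,n3,n4,n5,n6⟩ := ht
    have : (Pi.single d 1 : Pt → ℝ) ∈ LinearMap.ker (D4l a b c d) := by rw [he]; trivial
    rw [LinearMap.mem_ker] at this
    change D4 _ a b c d = 0 at this
    simp [D4, Pi.single_apply, n4.symm, n5.symm, n6.symm] at this
    exact hX a h1 b h2 c h3 n1 n2 n3 this
  have := Subspace.biUnion_ne_univ_of_top_notMem hF
  obtain ⟨g, hg⟩ := (Set.ne_univ_iff_exists_notMem _).1 this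
  refine ⟨g, fun a ha b hb c hc d hd n1 n2 n3 n4 n5 n6 h0 => hg ?_⟩
  simp only [Set.mem_iUnion]
  refine ⟨LinearMap.ker (D4l a b c d), ?_, ?_⟩
  · simp only [F, Finset.mem_image]
    refine ⟨(a,b,c,d), ?_, rfl⟩
    simp only [Q, Finset.mem_filter, Finset.mem_product]
    exact ⟨⟨ha,hb,hc,hd⟩,n1,n2,n3,n4,n5,n6⟩
  · exact h0

lemma exists_Ht (hX : GP X) : ∃ h, Ht X h := by
  obtain ⟨g, hg⟩ := exists_generic hX
  have hD : ∀ (t : ℝ) a b c d, D4 (fun q => sqh q + t * g q) a b c d = D4 sqh a b c d + t * D4 g a b c d := by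
    intros; unfold D4; ring
  have hcont : ∀ a b c d : Pt, Filter.Tendsto (fun t : ℝ => D4 sqh a b c d + t * D4 g a b c d)
      (nhdsWithin 0 (Set.Ioi 0)) (nhds (D4 sqh a b c d)) := by
    intro a b c d
    have : Continuous (fun t : ℝ => D4 sqh a b c d + t * D4 g a b c d) := by fun_prop
    have := this.tendsto 0
    simp only [zero_mul, add_zero] at this
    exact this.mono_left nhdsWithin_le_nhds
  have h1 : ∀ᶠ t : ℝ in nhdsWithin 0 (Set.Ioi 0), ∀ q ∈ X ×ˢ X ×ˢ X ×ˢ X, 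
      (0 < o q.1 q.2.1 q.2.2.2 → 0 < o q.2.1 q.2.2.1 q.2.2.2 → 0 < o q.2.2.1 q.1 q.2.2.2 →
        D4 sqh q.1 q.2.1 q.2.2.1 q.2.2.2 + t * D4 g q.1 q.2.1 q.2.2.1 q.2.2.2 < 0) ∧
      (D4 g q.1 q.2.1 q.2.2.1 q.2.2.2 ≠ 0 → D4 sqh q.1 q.2.1 q.2.2.1 q.2.2.2 + t * D4 g q.1 q.2.1 q.2.2.1 q.2.2.2 ≠ 0) := by
    rw [Filter.eventually_all_finset]
    rintro ⟨a,b,c,d⟩ -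
    simp only
    refine Filter.Eventually.and ?_ ?_
    · by_cases hh : 0 < o a b d ∧ 0 < o b c d ∧ 0 < o c a d
      · filter_upwards [(hcont a b c d).eventually_lt_const (sqh_neg hh.1 hh.2.1 hh.2.2)] with t ht _ _ _ using ht
      · exact Filter.Eventually.of_forall (fun t a b c => absurd ⟨a,b,c⟩ hh)
    · by_cases hh : D4 sqh a b c d = 0
      · filter_upwards [self_mem_nhdsWithin] with t ht hne
        rw [hh, zero_add]
        exact mul_ne_zero (ne_of_gt ht) hne
      · filter_upwards [(hcont a b c d).eventually_ne hh] with t ht _ using ht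
  obtain ⟨t, ht⟩ := h1.exists
  refine ⟨fun q => sqh q + t * g q, ?_, ?_⟩
  · intro a ha b hb c hc d hd e1 e2 e3
    rw [hD]
    exact (ht (a,b,c,d) (by simp [ha,hb,hc,hd])).1 e1 e2 e3
  · intro a ha b hb c hc d hd n1 n2 n3 n4 n5 n6
    rw [hD]
    exact (ht (a,b,c,d) (by simp [ha,hb,hc,hd])).2 (hg a ha b hb c hc d hd n1 n2 n3 n4 n5 n6)

/-- locally convex edge -/
def GE (h : Pt → ℝ) (X : Finset Pt) (T : Finset (Sym2 Pt)) (e : Sym2 Pt) : Prop :=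
  ∀ a b c d, e = s(a,b) → Face X T a b c → Face X T b a d → 0 < D4 h a b c d

def hl (h : Pt → ℝ) (r : ℝ) (a b : Pt) : ℝ := (1-r) * h a + r * h b

def PL (h : Pt → ℝ) (a b c q : Pt) : ℝ := (o b c q * h a + o c a q * h b + o a b q * h c) / o a b c

lemma PL_lerp (h : Pt → ℝ) (a b c p q : Pt) (r : ℝ) :
    PL h a b c (lerp r p q) = (1-r) * PL h a b c p + r * PL h a b c q := by
  unfold PL; rw [o_lerp, o_lerp, o_lerp]; ring

lemma PL_rot (h : Pt → ℝ) (a b c q : Pt) : PL h b c a q = PL h a b c q := by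
  unfold PL; rw [o_rot a b c]; ring

lemma PL_a (h : Pt → ℝ) {a b c : Pt} (h0 : o a b c ≠ 0) : PL h a b c a = h a := by
  unfold PL; rw [o_rot a b c]; simp; field_simp

lemma PL_b (h : Pt → ℝ) {a b c : Pt} (h0 : o a b c ≠ 0) : PL h a b c b = h b := by
  rw [← PL_rot]; exact PL_a h (by rwa [o_rot])

lemma PL_c (h : Pt → ℝ) {a b c : Pt} (h0 : o a b c ≠ 0) : PL h a b c c = h c := by
  rw [← PL_rot, ← PL_rot]; exact PL_a h (by rwa [o_rot, o_rot])

lemma hl_symm (h : Pt → ℝ) (r : ℝ) (a b : Pt) : hl h (1-r) b a = hl h r a b := by unfold hl; ring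

/-- a point on line bc -/
lemma on_line {a b c y : Pt} (h0 : 0 < o a b c) (h1 : o b c y = 0) : y = lerp (o a b y / o a b c) b c := by
  have h0' := h0.ne'
  have e : o a b c = o a b y + o b c y + o c a y := o_four a b c y
  rw [h1] at e
  have hD : o b c a ≠ 0 := by rw [o_rot]; exact h0'
  have f1 := co_fst hD y
  have f2 := co_snd hD y
  have g2 : co2 b c a y = 0 := by unfold co2; rw [h1, zero_div]
  have g1 : co1 b c a y = o a b y / o a b c := by
    unfold co1; rw [o_rot a b c]; congr 1; unfold o; ring
  rw [g1, g2] at f1 f2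
  unfold lerp
  ext
  · simp only; linarith
  · simp only; linarith

lemma exit_aux (hX : GP X) {h : Pt → ℝ} {a b c x a1 b1 y e : Pt} {r k M v : ℝ} (hD : o a b c ≠ 0) (hT : Tri X T)
    (ha1 : a1 ∈ X) (hb1 : b1 ∈ X) (hab1 : a1 ≠ b1) (hce : s(c,e) ∈ T) (hPe : PL h a b c e = h e)
    (hx2 : x = lerp r a1 b1) (hr0 : 0 < r) (hr1 : r < 1) (hae : a1 ≠ e)
    (hbx : o c e x ≠ 0) (hM0 : 0 ≤ M)
    (hM : ∀ f g u r', s(f,g) ∈ T → 0 < u → u < 1 → 0 < r' → r' < 1 → cr a1 b1 f g →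
      lerp r' a1 b1 = lerp u f g → hl h u f g - hl h r' a1 b1 ≤ M)
    (hk0 : 0 < k) (hk1 : k ≤ 1) (hy : y = lerp k x a1) (hv0 : 0 ≤ v) (hv1 : v < 1) (hol : y = lerp v c e) :
    ∃ r', r' < r ∧ PL h a b c (lerp r' a1 b1) - hl h r' a1 b1 ≤ M := by
  have hy1 : o c e y = 0 := by rw [hol, o_lerp]; simp
  have hyy : y = lerp (r*(1-k)) a1 b1 := by rw [hy, hx2, lerp_lerp]
  refine ⟨r*(1-k), by nlinarith, ?_⟩
  rw [← hyy]
  have hcX := hT.memL hce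
  have heX := hT.memR hce
  have hbc := hT.ne hce
  rcases hk1.lt_or_eq with hk1 | hk1
  · have q0 : 0 < r*(1-k) := mul_pos hr0 (by linarith)
    have q1 : r*(1-k) < 1 := by nlinarith
    rcases hv0.lt_or_eq with hv0 | hv0
    · have hcr := (cr_of_meet hX ha1 hb1 hcX heX hab1 hbc q0 q1 hv0 hv1 (by rw [← hyy, ← hol])).resolve_left (by
        intro he
        apply hbx
        rw [hx2, o_lerp]
        rcases Sym2.eq_iff.1 he with ⟨e1,e2⟩ | ⟨e1,e2⟩ <;> rw [e1,e2] <;> simp)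
      have := hM c e _ _ hce hv0 hv1 q0 q1 hcr (by rw [← hyy, ← hol])
      have hp : PL h a b c y = hl h v c e := by
        conv_lhs => rw [hol]
        rw [PL_lerp, PL_c h hD, hPe]; rfl
      rw [hp]; exact this
    · exfalso
      have hyc : y = c := by
        rw [hol, ← hv0]; unfold lerp; ext <;> simp
      have : o a1 b1 c = 0 := by rw [← hyc, hyy, o_lerp]; simp
      rcases hX.mem_of_zero ha1 hb1 hcX hab1 this with hc | hc
      · have h1 : lerp k x a1 = a1 := by rw [← hy, hyc, hc]
        have : (1-k) * o c e x + k * o c e a1 = o c e a1 := by rw [← o_lerp, h1]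
        rw [← hc] at this; simp at this
        rcases this with h | h
        · linarith
        · exact hbx h
      · rw [← hc] at hx2
        have h1 : o c e y = (1-k) * o c e x + k * o c e a1 := by rw [hy, o_lerp]
        have h2 : o c e x = (1-r) * o c e a1 := by rw [hx2, o_lerp]; simp
        rw [hy1] at h1
        rw [h2] at h1
        have h3 : (1 - r*(1-k)) * o c e a1 = 0 := by linarith
        rcases mul_eq_zero.1 h3 with h | h
        · linarith
        · apply hbx; rw [h2, h, mul_zero]
  · subst hk1
    have hya : y = a1 := by rw [hy]; unfold lerp; ext <;> simp
    have hac : a1 = c := by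
      rw [hya] at hy1
      rcases hX.mem_of_zero hcX heX ha1 hbc hy1 with hc | hc
      · exact hc
      · exact absurd hc hae
    rw [hya, hac, PL_c h hD]; unfold hl; simp; exact hM0

lemma exit_bound (hX : GP X) (hT : Tri X T) {h : Pt → ℝ} {a b c x a1 b1 : Pt} {w r M : ℝ} (hF : Face X T a b c)
    (ha1 : a1 ∈ X) (hb1 : b1 ∈ X) (hab1 : a1 ≠ b1) (hx1 : x = lerp w a b) (hw0 : 0 < w) (hw1 : w < 1)
    (hx2 : x = lerp r a1 b1) (hr0 : 0 < r) (hr1 : r < 1) (hl1 : 0 < o a b a1) (hM0 : 0 ≤ M)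
    (hM : ∀ f g u r', s(f,g) ∈ T → 0 < u → u < 1 → 0 < r' → r' < 1 → cr a1 b1 f g →
      lerp r' a1 b1 = lerp u f g → hl h u f g - hl h r' a1 b1 ≤ M) :
    ∃ r', r' < r ∧ PL h a b c (lerp r' a1 b1) - hl h r' a1 b1 ≤ M := by
  have x1 : o a b x = 0 := by rw [hx1, o_lerp]; simp
  have x2 : 0 < o b c x := by
    rw [hx1, o_lerp, o_rot a b c]; simp; exact mul_pos (by linarith) hF.1
  have x3 : 0 < o c a x := by
    rw [hx1, o_lerp, o_rot b c a, o_rot a b c]; simp; exact mul_pos (by linarith) hF.1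
  have hn : ¬ (0 < o b c a1 ∧ 0 < o c a a1) := fun hh => hF.2.2.2.2 a1 ha1 ⟨hl1, hh.1, hh.2⟩
  obtain ⟨k, hk0, hk1, hk⟩ := exit2 x2 x3 hn
  rw [← o_lerp, ← o_lerp] at hk
  have hab : a1 ≠ b := by rintro rfl; simp at hl1
  have haa : a1 ≠ a := by rintro rfl; simp at hl1
  have hD := hF.1.ne'
  obtain ⟨y, hy⟩ : ∃ y, y = lerp k x a1 := ⟨_, rfl⟩
  rw [← hy] at hk
  have hy3 : 0 < o a b y := by rw [hy, o_lerp, x1]; simp; exact mul_pos hk0 hl1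
  have e : o a b c = o a b y + o b c y + o c a y := o_four a b c y
  rcases hk with ⟨e1, e2⟩ | ⟨e1, e2⟩
  · refine exit_aux hX (y := y) (e := b) (v := 1 - o a b y / o a b c) hD hT ha1 hb1 hab1 (swp hF.2.2.1) (PL_b h hD)
      hx2 hr0 hr1 hab ?_ hM0 hM hk0 hk1 hy ?_ ?_ ?_
    · rw [o_swap]; linarith
    · rw [sub_nonneg, div_le_one hF.1]; linarith
    · have := div_pos hy3 hF.1; linarith
    · rw [lerp_symm]; exact on_line hF.1 e1
  · refine exit_aux hX (y := y) (e := a) (v := o b c y / o b c a) hD hT ha1 hb1 hab1 hF.2.2.2.1 (PL_a h hD)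
      hx2 hr0 hr1 haa x3.ne' hM0 hM hk0 hk1 hy ?_ ?_ ?_
    · rw [o_rot a b c]; exact div_nonneg e2 hF.1.le
    · rw [o_rot a b c, div_lt_one hF.1]; linarith
    · exact on_line (by rw [o_rot a b c]; exact hF.1) e1

/-- convexity step: a good edge cannot carry the maximal gap -/
lemma conv_step (hX : GP X) (hT : Tri X T) {h : Pt → ℝ} {a b x a1 b1 c d : Pt} {w r M : ℝ}
    (h1 : Face X T a b c) (h2 : Face X T b a d) (hg : 0 < D4 h a b c d)
    (ha1 : a1 ∈ X) (hb1 : b1 ∈ X) (hab1 : a1 ≠ b1) (hx1 : x = lerp w a b) (hw0 : 0 < w) (hw1 : w < 1)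
    (hx2 : x = lerp r a1 b1) (hr0 : 0 < r) (hr1 : r < 1) (hl1 : 0 < o a b a1) (hl2 : o a b b1 < 0) (hM0 : 0 ≤ M)
    (hM : ∀ f g u r', s(f,g) ∈ T → 0 < u → u < 1 → 0 < r' → r' < 1 → cr a1 b1 f g →
      lerp r' a1 b1 = lerp u f g → hl h u f g - hl h r' a1 b1 ≤ M) :
    hl h w a b - hl h r a1 b1 < M := by
  obtain ⟨r1, hr1', hb1'⟩ := exit_bound hX hT h1 ha1 hb1 hab1 hx1 hw0 hw1 hx2 hr0 hr1 hl1 hM0 hM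
  obtain ⟨r2, hr2', hb2'⟩ := exit_bound hX hT (w := 1-w) (r := 1-r) (x := x) h2 hb1 ha1 hab1.symm
    (by rw [lerp_symm]; exact hx1) (by linarith) (by linarith)
    (by rw [lerp_symm]; exact hx2) (by linarith) (by linarith) (by rw [o_swap]; linarith) hM0
    (by
      intro f g u r' e1 e2 e3 e4 e5 e6 e7
      have := hM f g u (1-r') e1 e2 e3 (by linarith) (by linarith) (cr_swapL e6) (by rw [lerp_symm]; exact e7)
      rwa [hl_symm] at this)
  rw [← hl_symm h r2, ← lerp_symm r2] at hb2'
  obtain ⟨r3, hr3⟩ : ∃ r3, r3 = 1 - r2 := ⟨_, rfl⟩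
  rw [← hr3] at hb2'
  have hr3' : r < r3 := by linarith
  have hD1 := h1.1.ne'
  have hD2 := h2.1.ne'
  have hdiff : ∀ q, PL h b a d q = PL h a b c q - D4 h a b c d / (o a b c * o b a d) * o a b q := by
    intro q
    unfold PL
    rw [div_sub' hD1, div_eq_div_iff hD2 hD1]
    field_simp
    unfold D4 o; ring
  have hz : o a b (lerp r3 a1 b1) < 0 := by
    have e1 : (1-r) * o a b a1 + r * o a b b1 = 0 := by rw [← o_lerp, ← hx2, hx1, o_lerp]; simp
    have e2 : o a b (lerp r3 a1 b1) = (r3 - r) * (o a b b1 - o a b a1) := by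
      rw [o_lerp]; linear_combination e1
    rw [e2]
    exact mul_neg_of_pos_of_neg (by linarith) (by linarith)
  have hk : 0 < D4 h a b c d / (o a b c * o b a d) := div_pos hg (mul_pos h1.1 h2.1)
  have hlt : PL h a b c (lerp r3 a1 b1) - hl h r3 a1 b1 < M := by
    have := hdiff (lerp r3 a1 b1)
    have := mul_neg_of_pos_of_neg hk hz
    linarith
  have hxv : PL h a b c x = hl h w a b := by rw [hx1, PL_lerp, PL_a h hD1, PL_b h hD1]; rfl
  rw [← hxv, hx2]
  rw [PL_lerp] at hb1' hlt ⊢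
  unfold hl at *
  obtain ⟨u, hu⟩ : ∃ u, u = PL h a b c a1 - h a1 := ⟨_, rfl⟩
  obtain ⟨v, hv⟩ : ∃ v, v = PL h a b c b1 - h b1 := ⟨_, rfl⟩
  have i1 : (1-r1)*u + r1*v ≤ M := by rw [hu, hv]; linarith
  have i2 : (1-r3)*u + r3*v < M := by rw [hu, hv]; linarith
  have i3 : (1-r)*u+r*v < M := by
    have f1 : 0 ≤ (M - ((1-r1)*u + r1*v)) * (r3 - r) := mul_nonneg (by linarith) (by linarith)
    have f2 : 0 < (M - ((1-r3)*u + r3*v)) * (r - r1) := mul_pos (by linarith) (by linarith)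
    have f3 : 0 < (M - ((1-r)*u+r*v)) * (r3 - r1) := by linarith
    have := (pos_iff_pos_of_mul_pos f3).2 (by linarith)
    linarith
  rw [hu, hv] at i3; linarith

lemma cross_exists {T1 T2 : Finset (Sym2 Pt)} (hC : Cfg X A B C) (h1 : Tri X T1) (h2 : Tri X T2) (hne : T1 ≠ T2) :
    ∃ a b c d, s(a,b) ∈ T1 ∧ s(c,d) ∈ T2 ∧ cr a b c d := by
  by_contra hcon
  push Not at hcon
  apply hne
  apply Finset.eq_of_subset_of_card_le
  · intro e he
    induction e using Sym2.ind with
    | _ a b =>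
      rw [h2]
      exact ⟨h1.memL he, h1.memR he, h1.ne he, fun c d hcd => hcon a b c d he hcd⟩
  · have := card_Tri hC h1
    have := card_Tri hC h2
    omega

lemma cr_left {a b c d : Pt} (h : cr a b c d) : (0 < o a b c ∧ o a b d < 0) ∨ (0 < o b a c ∧ o b a d < 0) := by
  rcases mul_neg_iff.1 h.1 with h | h
  · left; exact h
  · right; rw [o_swap a b c, o_swap a b d]; exact ⟨by linarith [h.1], by linarith [h.2]⟩

lemma conv_contra {T1 T2 : Finset (Sym2 Pt)} {h : Pt → ℝ} (hX : GP X) (h1 : Tri X T1) (h2 : Tri X T2)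
    {a b a1 b1 : Pt} {w r : ℝ} (he1 : s(a1,b1) ∈ T1) (he2 : s(a,b) ∈ T2) (hcr : cr a1 b1 a b)
    (hg : GE h X T2 s(a,b)) (hw0 : 0 < w) (hw1 : w < 1) (hr0 : 0 < r) (hr1 : r < 1)
    (he : lerp r a1 b1 = lerp w a b) (hM0 : 0 ≤ hl h w a b - hl h r a1 b1)
    (hM : ∀ f g u r', s(f,g) ∈ T2 → 0 < u → u < 1 → 0 < r' → r' < 1 → cr a1 b1 f g →
      lerp r' a1 b1 = lerp u f g → hl h u f g - hl h r' a1 b1 ≤ hl h w a b - hl h r a1 b1) : False := by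
  have main : ∀ a b w, s(a,b) ∈ T2 → GE h X T2 s(a,b) → 0 < w → w < 1 → 0 < o a b a1 → o a b b1 < 0 →
      lerp r a1 b1 = lerp w a b → 0 ≤ hl h w a b - hl h r a1 b1 →
      (∀ f g u r', s(f,g) ∈ T2 → 0 < u → u < 1 → 0 < r' → r' < 1 → cr a1 b1 f g →
      lerp r' a1 b1 = lerp u f g → hl h u f g - hl h r' a1 b1 ≤ hl h w a b - hl h r a1 b1) → False := by
    intro a b w he2 hg hw0 hw1 l1 l2 he hM0 hM
    obtain ⟨c, hc⟩ := exists_face hX h2 he2 (h1.memL he1) l1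
    obtain ⟨d, hd⟩ := exists_face hX h2 (swp he2) (h1.memR he1) (by rw [o_swap]; linarith)
    have := conv_step hX h2 hc hd (hg a b c d rfl hc hd) (h1.memL he1) (h1.memR he1) (h1.ne he1) he hw0 hw1 rfl hr0 hr1
      l1 l2 hM0 hM
    linarith
  rcases cr_left (cr_symm hcr) with ⟨l1, l2⟩ | ⟨l1, l2⟩
  · exact main a b w he2 hg hw0 hw1 l1 l2 he hM0 hM
  · refine main b a (1-w) (swp he2) (by rwa [Sym2.eq_swap]) (by linarith) (by linarith) l1 l2 (by rw [lerp_symm]; exact he) ?_ ?_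
    · rwa [hl_symm]
    · rwa [hl_symm]

lemma cr_param {a b c d : Pt} {r u : ℝ} (h : cr a b c d) (he : lerp r a b = lerp u c d) :
    r = o c d a/(o c d a - o c d b) := by
  have : (1-r) * o c d a + r * o c d b = 0 := by rw [← o_lerp, he, o_lerp]; simp
  rw [eq_div_iff (ratio_ne h.2)]; linarith

lemma unique_reg {T1 T2 G : Finset (Sym2 Pt)} {h : Pt → ℝ} (hC : Cfg X A B C) (h1 : Tri X T1) (h2 : Tri X T2)
    (hG1 : G ⊆ T1) (hG2 : G ⊆ T2) (hg1 : ∀ e ∈ T1, e ∉ G → GE h X T1 e) (hg2 : ∀ e ∈ T2, e ∉ G → GE h X T2 e) :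
    T1 = T2 := by
  by_contra hne
  obtain ⟨a,b,c,d,e1,e2,e3⟩ := cross_exists hC h1 h2 hne
  let gap : Pt × Pt × Pt × Pt → ℝ := fun t => 
    hl h (o t.1 t.2.1 t.2.2.1/(o t.1 t.2.1 t.2.2.1 - o t.1 t.2.1 t.2.2.2)) t.2.2.1 t.2.2.2 - 
    hl h (o t.2.2.1 t.2.2.2 t.1/(o t.2.2.1 t.2.2.2 t.1 - o t.2.2.1 t.2.2.2 t.2.1)) t.1 t.2.1
  let Q := (X ×ˢ X ×ˢ X ×ˢ X).filter (fun t => s(t.1,t.2.1) ∈ T1 ∧ s(t.2.2.1,t.2.2.2) ∈ T2 ∧ cr t.1 t.2.1 t.2.2.1 t.2.2.2)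
  have hQ : ∀ {a b c d}, s(a,b) ∈ T1 → s(c,d) ∈ T2 → cr a b c d → (a,b,c,d) ∈ Q := by
    intro a b c d x y z
    simp only [Q, Finset.mem_filter, Finset.mem_product]
    exact ⟨⟨h1.memL x, h1.memR x, h2.memL y, h2.memR y⟩, x, y, z⟩
  obtain ⟨⟨a,b,c,d⟩, ht, hmax⟩ := Q.exists_max_image (fun t => |gap t|) ⟨_, hQ e1 e2 e3⟩
  simp only [Q, Finset.mem_filter] at ht
  obtain ⟨-, e1, e2, e3⟩ := ht
  have hgap : ∀ {a b c d : Pt} {r u : ℝ}, cr a b c d → lerp r a b = lerp u c d →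
      gap (a,b,c,d) = hl h u c d - hl h r a b := by
    intro a b c d r u hc he
    have q1 := cr_param hc he
    have q2 := cr_param (cr_symm hc) he.symm
    rw [q1, q2]
  have n1 : s(a,b) ∉ G := fun hh => h2.ncr (hG2 hh) e2 e3
  have n2 : s(c,d) ∉ G := fun hh => h1.ncr e1 (hG1 hh) e3
  obtain ⟨r, u, hr0, hr1, hu0, hu1, he⟩ := exists_meet_of_cr e3
  have hge := hgap e3 he
  by_cases hs : 0 ≤ gap (a,b,c,d)
  · refine conv_contra hC.gp h1 h2 e1 e2 e3 (hg2 _ e2 n2) hu0 hu1 hr0 hr1 he (by rwa [← hge]) ?_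
    intro f g u' r' k1 k2 k3 k4 k5 k6 k7
    rw [← hge, ← hgap k6 k7]
    have := hmax _ (hQ e1 k1 k6)
    rw [abs_of_nonneg hs] at this
    exact le_trans (le_abs_self _) this
  · push Not at hs
    refine conv_contra hC.gp h2 h1 e2 e1 (cr_symm e3) (hg1 _ e1 n1) hr0 hr1 hu0 hu1 he.symm (by linarith) ?_
    intro f g u' r' k1 k2 k3 k4 k5 k6 k7
    have hh := hgap (cr_symm k6) k7.symm
    have := hmax _ (hQ k1 e2 (cr_symm k6))
    rw [abs_of_neg hs] at this
    have := neg_le_abs (gap (f,g,c,d))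
    linarith

end Heights
end SC
end

noncomputable section
namespace SC
section Vol
variable {X : Finset Pt} {T : Finset (Sym2 Pt)} {A B C : Pt}


lemma ne_of_o {a b c : Pt} (h : 0 < o a b c) : a ≠ b ∧ b ≠ c ∧ a ≠ c := by
  refine ⟨?_, ?_, ?_⟩ <;> rintro rfl
  · rw [o_aab] at h; exact lt_irrefl _ h
  · rw [o_abb] at h; exact lt_irrefl _ h
  · rw [o_aba] at h; exact lt_irrefl _ h

lemma flip_face (hX : GP X) (hT : Tri X T) {a b c d : Pt} (h1 : Face X T a b c) (h2 : Face X T b a d)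
    (hcr : cr a b c d) : Face X (insert s(c,d) (T.erase s(a,b))) c d b := by
  obtain ⟨q1, q2, q3⟩ := quad_pos h1.1 hcr
  have nab := ne_of_o h1.1
  have nbd := ne_of_o h2.1
  have p1 : 0 < o c d b := by rw [← o_rot b c d] at q1; exact q1
  refine ⟨p1, Finset.mem_insert_self _ _, ?_, ?_, ?_⟩
  · refine Finset.mem_insert_of_mem (Finset.mem_erase.2 ⟨?_, h2.2.2.2.1⟩)
    simp only [ne_eq, Sym2.eq_iff]; rintro (⟨h, h'⟩ | ⟨h, h'⟩)
    · exact nbd.2.1 (h.symm)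
    · exact nbd.2.2 h.symm
  · refine Finset.mem_insert_of_mem (Finset.mem_erase.2 ⟨?_, h1.2.2.1⟩)
    simp only [ne_eq, Sym2.eq_iff]; rintro (⟨h, h'⟩ | ⟨h, h'⟩)
    · exact nab.1 h.symm
    · exact nab.2.2 h'.symm
  · rintro q hq ⟨r1, r2, r3⟩
    have ha := hT.memL h1.2.1
    have hb := hT.memR h1.2.1
    rcases lt_trichotomy (o a b q) 0 with hs | hs | hs
    · apply h2.2.2.2.2 q hq
      refine ⟨by rw [o_swap]; linarith, ?_, r2⟩
      have := bary c d b a d q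
      rw [o_abb] at this
      have e1 : o a d c = o c a d := o_rot c a d
      have e2 : o a d b = o b a d := o_rot b a d
      rw [e1, e2] at this
      have := mul_pos r2 q2
      have := mul_pos r1 h2.1
      exact (pos_iff_pos_of_mul_pos (show 0 < o c d b * o a d q by linarith)).1 p1
    · rcases hX.mem_of_zero ha hb hq nab.1 hs with rfl | rfl
      · have : o c d q = - o c q d := o_swap' _ _ _
        linarith
      · rw [o_abb] at r2; linarith
    · apply h1.2.2.2.2 q hq
      refine ⟨hs, r3, ?_⟩
      have := bary c d b c a q
      rw [o_aba] at this
      have e2 : o c a b = o a b c := by rw [← o_rot, ← o_rot]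
      rw [e2] at this
      have := mul_pos r3 q2
      have := mul_pos r1 h1.1
      exact (pos_iff_pos_of_mul_pos (show 0 < o c d b * o c a q by linarith)).1 p1

def vol (h : Pt → ℝ) (t : Pt × Pt × Pt) : ℝ := o t.1 t.2.1 t.2.2 * (h t.1 + h t.2.1 + h t.2.2)

def six (a b c d : Pt) : Finset (Pt × Pt × Pt) := {(a,b,c),(b,c,a),(c,a,b),(b,a,d),(a,d,b),(d,b,a)}

lemma six_sub (hT : Tri X T) {a b c d : Pt} (h1 : Face X T a b c) (h2 : Face X T b a d) : six a b c d ⊆ OF X T := by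
  intro t ht
  simp only [six, Finset.mem_insert, Finset.mem_singleton] at ht
  rcases ht with rfl | rfl | rfl | rfl | rfl | rfl <;> rw [mem_OF hT]
  · exact h1
  · exact h1.rot
  · exact h1.rot.rot
  · exact h2
  · exact h2.rot
  · exact h2.rot.rot

lemma mem_six (hX : GP X) (hT : Tri X T) {a b c d x y z : Pt} (h1 : Face X T a b c) (h2 : Face X T b a d)
    (h : Face X T x y z) (he : s(x,y) = s(a,b) ∨ s(y,z) = s(a,b) ∨ s(z,x) = s(a,b)) : (x,y,z) ∈ six a b c d := by
  have key : ∀ {z}, Face X T a b z → z = c := fun hz => Face.unique hX hT hz h1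
  have key' : ∀ {z}, Face X T b a z → z = d := fun hz => Face.unique hX hT hz h2
  simp only [six, Finset.mem_insert, Finset.mem_singleton]
  rcases he with he | he | he <;> rw [Sym2.eq_iff] at he <;> rcases he with ⟨rfl, rfl⟩ | ⟨rfl, rfl⟩
  · rw [key h]; tauto
  · rw [key' h]; tauto
  · rw [key h.rot]; tauto
  · rw [key' h.rot]; tauto
  · rw [key h.rot.rot]; tauto
  · rw [key' h.rot.rot]; tauto

lemma sum_six (h : Pt → ℝ) {a b c d : Pt} (h1 : 0 < o a b c) (h2 : 0 < o b a d) :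
    ∑ t ∈ six a b c d, vol h t = 3 * (vol h (a,b,c) + vol h (b,a,d)) := by
  obtain ⟨n1, n2, n3⟩ := ne_of_o h1
  obtain ⟨n4, n5, n6⟩ := ne_of_o h2
  have hcd : c ≠ d := by rintro rfl; rw [o_swap] at h2; linarith
  unfold six
  rw [Finset.sum_insert, Finset.sum_insert, Finset.sum_insert, Finset.sum_insert, Finset.sum_insert, Finset.sum_singleton]
  · simp only [vol]
    unfold o; ring
  all_goals simp only [Finset.mem_insert, Finset.mem_singleton, Prod.mk.injEq]; grind

def Vv (h : Pt → ℝ) (X : Finset Pt) (T : Finset (Sym2 Pt)) : ℝ := ∑ t ∈ OF X T, vol h t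

lemma sdiff_flip_sub (hX : GP X) {T2 : Finset (Sym2 Pt)} (hT : Tri X T) (hT2 : Tri X T2) {a b c d : Pt} (h1 : Face X T a b c)
    (h2 : Face X T b a d) (hsub : ∀ e ∈ T, e ≠ s(a,b) → e ∈ T2) (hcd : s(c,d) ∉ T) {d' c' : Pt}:
    OF X T \ six a b c d ⊆ OF X T2 \ six c d d' c' := by
  rintro ⟨x,y,z⟩ ht
  rw [Finset.mem_sdiff, mem_OF hT] at ht
  obtain ⟨hf, hn⟩ := ht
  have hne : ∀ e, (e = s(x,y) ∨ e = s(y,z) ∨ e = s(z,x)) → e ≠ s(a,b) := by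
    rintro e he rfl
    exact hn (mem_six hX hT h1 h2 hf (by rcases he with h | h | h <;> simp [h]))
  rw [Finset.mem_sdiff, mem_OF hT2]
  refine ⟨⟨hf.1, hsub _ hf.2.1 (hne _ (by tauto)), hsub _ hf.2.2.1 (hne _ (by tauto)), hsub _ hf.2.2.2.1 (hne _ (by tauto)), hf.2.2.2.2⟩, ?_⟩
  intro hm
  have hdc : s(d,c) ∉ T := fun h => hcd (swp h)
  simp only [six, Finset.mem_insert, Finset.mem_singleton, Prod.mk.injEq] at hm
  obtain ⟨-, f1, f2, f3, -⟩ := hf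
  rcases hm with ⟨rfl, rfl, rfl⟩ | ⟨rfl, rfl, rfl⟩ | ⟨rfl, rfl, rfl⟩ | ⟨rfl, rfl, rfl⟩ | ⟨rfl, rfl, rfl⟩ | ⟨rfl, rfl, rfl⟩ <;> contradiction

lemma vol_flip (hC : Cfg X A B C) (hT : Tri X T) (h : Pt → ℝ) {a b c d : Pt} (h1 : Face X T a b c) (h2 : Face X T b a d)
    (hcr : cr a b c d) : Vv h X (insert s(c,d) (T.erase s(a,b))) = Vv h X T + 3 * D4 h a b c d := by
  obtain ⟨hT2, hcd⟩ := flip_tri hC hT h1 h2 hcr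
  have g1 := flip_face hC.gp hT h1 h2 hcr
  have g2 := flip_face hC.gp hT h2 h1 (cr_swapL (cr_swapR hcr))
  rw [Sym2.eq_swap (a := d), Sym2.eq_swap (a := b)] at g2
  obtain ⟨T2, hT2e⟩ : ∃ T2, T2 = insert s(c,d) (T.erase s(a,b)) := ⟨_, rfl⟩
  rw [← hT2e] at hT2 g1 g2 ⊢
  have hne : s(a,b) ≠ s(c,d) := fun hh => hcd (hh ▸ h1.2.1)
  have hab : s(a,b) ∉ T2 := by
    rw [hT2e]; simp [hne]
  have e : OF X T \ six a b c d = OF X T2 \ six c d b a := by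
    apply Finset.Subset.antisymm
    · apply sdiff_flip_sub hC.gp hT hT2 h1 h2 _ hcd
      intro e he hn
      rw [hT2e]; exact Finset.mem_insert_of_mem (Finset.mem_erase.2 ⟨hn, he⟩)
    · have e6 : six a b c d = six b a d c := by unfold six; grind
      have : s(b,a) ∉ T2 := fun h => hab (swp h)
      rw [e6]
      apply sdiff_flip_sub hC.gp hT2 hT g1 g2 _ this
      intro e he hn
      rw [hT2e, Finset.mem_insert, Finset.mem_erase] at he
      tauto
  unfold Vv
  rw [← Finset.sum_sdiff (six_sub hT h1 h2), ← Finset.sum_sdiff (six_sub hT2 g1 g2), e, sum_six h g1.1 g2.1, sum_six h h1.1 h2.1]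
  simp only [vol, D4]; unfold o; ring

lemma D4_cyc (h : Pt → ℝ) (a b c d : Pt) : D4 h b c d a = - D4 h a b c d := by
  unfold D4 o; ring

lemma D4_pos_of_not_cr (hX : GP X) {h : Pt → ℝ} (hh : Ht X h) {a b c d : Pt} (ha : a ∈ X) (hb : b ∈ X) (hc : c ∈ X) (hd : d ∈ X)
    (h1 : 0 < o a b c) (h2 : 0 < o b a d) (hn : ¬ cr a b c d) : 0 < D4 h a b c d := by
  obtain ⟨n1, n2, n3⟩ := ne_of_o h1
  obtain ⟨n4, n5, n6⟩ := ne_of_o h2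
  have hcd : c ≠ d := by rintro rfl; rw [o_swap] at h2; linarith
  have za : o c d a ≠ 0 := hX c hc d hd a ha hcd n3.symm n5.symm
  have zb : o c d b ≠ 0 := hX c hc d hd b hb hcd n2.symm n6.symm
  have hab : o a b d < 0 := by rw [o_swap] at h2; linarith
  have hp : ¬ (o c d a * o c d b < 0) := fun hx => hn ⟨mul_neg_of_pos_of_neg h1 hab, hx⟩
  rcases lt_or_gt_of_ne za with k1 | k1 <;> rcases lt_or_gt_of_ne zb with k2 | k2
  · have := hh.1 a ha d hd c hc b hb (by rw [o_rot b a d]; exact h2) (by rw [o_swap]; linarith) (by rw [o_rot b c a, o_rot a b c]; exact h1)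
    rw [D4_cyc, D4_swap] at this; linarith
  · exact absurd (mul_neg_of_neg_of_pos k1 k2) hp
  · exact absurd (mul_neg_of_pos_of_neg k1 k2) hp
  · have := hh.1 b hb c hc d hd a ha (by rw [o_rot a b c]; exact h1) k1 (by rw [o_rot a d b, o_rot b a d]; exact h2)
    rw [D4_cyc] at this; linarith

lemma exists_reg (hC : Cfg X A B C) {h : Pt → ℝ} (hh : Ht X h) {G : Finset (Sym2 Pt)} (hG : Plane X G) :
    ∃ T, Tri X T ∧ G ⊆ T ∧ ∀ e ∈ T, e ∉ G → GE h X T e := by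
  obtain ⟨T0, hT0, hG0⟩ := hG.extend
  let Q := X.sym2.powerset.filter (fun T => Tri X T ∧ G ⊆ T)
  have hQ : ∀ {T}, Tri X T → G ⊆ T → T ∈ Q := fun hT hs => 
    Finset.mem_filter.2 ⟨Finset.mem_powerset.2 hT.plane.sub, hT, hs⟩
  obtain ⟨T, hTQ, hmin⟩ := Q.exists_min_image (fun T => Vv h X T) ⟨T0, hQ hT0 hG0⟩
  obtain ⟨-, hT, hs⟩ := Finset.mem_filter.1 hTQ
  refine ⟨T, hT, hs, ?_⟩
  rintro e he hn a b c d rfl f1 f2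
  by_cases hcr : cr a b c d
  · obtain ⟨hT2, hcd⟩ := flip_tri hC hT f1 f2 hcr
    have := hmin _ (hQ hT2 (by
      intro e' he'
      refine Finset.mem_insert_of_mem (Finset.mem_erase.2 ⟨?_, hs he'⟩)
      rintro rfl; exact hn he'))
    simp only [vol_flip hC hT h f1 f2 hcr] at this
    obtain ⟨n1, n2, n3⟩ := ne_of_o f1.1
    obtain ⟨n4, n5, n6⟩ := ne_of_o f2.1
    have hcd' : c ≠ d := hT2.ne (Finset.mem_insert_self _ _)
    have := hh.2 a (hT.memL f1.2.1) b (hT.memR f1.2.1) c (hT.memR f1.2.2.1) d (hT.memR f2.2.2.1) n1 n3 n2 n5.symm n6.symm hcd'.symm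
    exact lt_of_le_of_ne (by linarith) this.symm
  · exact D4_pos_of_not_cr hC.gp hh (hT.memL f1.2.1) (hT.memR f1.2.1) (hT.memR f1.2.2.1) (hT.memR f2.2.2.1) f1.1 f2.1 hcr

lemma Cfg.erase (h : Cfg X A B C) {p : Pt} (h1 : p ≠ A) (h2 : p ≠ B) (h3 : p ≠ C) : Cfg (X.erase p) A B C where
  gp := fun a ha b hb c hc => h.gp a (Finset.mem_of_mem_erase ha) b (Finset.mem_of_mem_erase hb) c (Finset.mem_of_mem_erase hc)
  hA := Finset.mem_erase.2 ⟨h1.symm, h.hA⟩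
  hB := Finset.mem_erase.2 ⟨h2.symm, h.hB⟩
  hC := Finset.mem_erase.2 ⟨h3.symm, h.hC⟩
  ccw := h.ccw
  ins := fun q hq => h.ins q (Finset.mem_of_mem_erase hq)
  xinj := fun p hp q hq => h.xinj p (Finset.mem_of_mem_erase hp) q (Finset.mem_of_mem_erase hq)
  xA := fun q hq => h.xA q (Finset.mem_of_mem_erase hq)
  xB := fun q hq => h.xB q (Finset.mem_of_mem_erase hq)
  xC := fun q hq => h.xC q (Finset.mem_of_mem_erase hq)

end Vol
end SC
end

noncomputable section
namespace SC
section Nodes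
variable {X : Finset Pt} {U : Finset (Sym2 Pt)} {A B C p : Pt} {h : Pt → ℝ}

def nz (Y : Finset Pt) (U : Finset (Sym2 Pt)) (a b : Pt) : Pt :=
  if h : ∃ z, Face Y U a b z then h.choose else a

lemma nz_eq {Y : Finset Pt} (hY : GP Y) (hU : Tri Y U) {a b z : Pt} (hf : Face Y U a b z) : nz Y U a b = z := by
  unfold nz
  have hh : ∃ z, Face Y U a b z := ⟨z, hf⟩
  rw [dif_pos hh]
  exact Face.unique hY hU hh.choose_spec hf

def par (Y : Finset Pt) (U : Finset (Sym2 Pt)) (p : Pt) (e : Pt × Pt) : Option (Pt × Pt) :=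
  if 0 < o e.2 (nz Y U e.1 e.2) p ∧ 0 < o (nz Y U e.1 e.2) e.1 p then none
  else if 0 < o e.1 (nz Y U e.1 e.2) p ∧ 0 < o e.2 (nz Y U e.1 e.2) p then some (e.1, nz Y U e.1 e.2)
  else if 0 < o (nz Y U e.1 e.2) e.2 p ∧ 0 < o (nz Y U e.1 e.2) e.1 p then some (nz Y U e.1 e.2, e.2)
  else some (e.1, e.1)

def IsNd (Y : Finset Pt) (U : Finset (Sym2 Pt)) (h : Pt → ℝ) (p a b z v : Pt) : Prop :=
  Face Y U a b z ∧ Face Y U b a v ∧ 0 < o a b p ∧ 0 < o a v p ∧ 0 < o v b p ∧ 0 < D4 h a b z v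

def Nd (Y : Finset Pt) (U : Finset (Sym2 Pt)) (h : Pt → ℝ) (p : Pt) : Finset (Pt × Pt) :=
  (Y ×ˢ Y).filter (fun e => IsNd Y U h p e.1 e.2 (nz Y U e.1 e.2) (nz Y U e.2 e.1))

def Hn (Y : Finset Pt) (U : Finset (Sym2 Pt)) (h : Pt → ℝ) (p : Pt) (e : Pt × Pt) : ℝ :=
  PL h e.2 e.1 (nz Y U e.2 e.1) p

lemma mem_Nd {Y : Finset Pt} (hY : GP Y) (hU : Tri Y U) {a b : Pt} : (a,b) ∈ Nd Y U h p ↔ ∃ z v, IsNd Y U h p a b z v := by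
  unfold Nd
  rw [Finset.mem_filter]
  constructor
  · rintro ⟨-, h⟩; exact ⟨_, _, h⟩
  · rintro ⟨z, v, h⟩
    refine ⟨Finset.mem_product.2 ⟨hU.memL h.1.2.1, hU.memR h.1.2.1⟩, ?_⟩
    simp only
    rw [nz_eq hY hU h.1, nz_eq hY hU h.2.1]; exact h

/-- parent relation, unfolded at a known near face -/
lemma par_none {Y : Finset Pt} (hY : GP Y) (hU : Tri Y U) {a b z : Pt} (hf : Face Y U a b z) :
    par Y U p (a,b) = none ↔ 0 < o b z p ∧ 0 < o z a p := by
  unfold par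
  simp only [nz_eq hY hU hf]
  split_ifs <;> simp_all

lemma par_some {Y : Finset Pt} (hY : GP Y) (hU : Tri Y U) {a b z : Pt} (hf : Face Y U a b z) {u : Pt × Pt}
    (hu : par Y U p (a,b) = some u) :
    (u = (a,z) ∧ 0 < o a z p ∧ 0 < o b z p) ∨ (u = (z,b) ∧ 0 < o z b p ∧ 0 < o z a p) ∨ u = (a,a) := by
  unfold par at hu
  simp only [nz_eq hY hU hf] at hu
  split_ifs at hu with h1 h2 h3 <;> simp at hu <;> subst hu <;> tauto

lemma par_az {Y : Finset Pt} (hY : GP Y) (hU : Tri Y U) {a b z : Pt} (hf : Face Y U a b z) (h1 : 0 < o a z p) (h2 : 0 < o b z p) :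
    par Y U p (a,b) = some (a,z) := by
  unfold par
  simp only [nz_eq hY hU hf]
  have : ¬ 0 < o z a p := by rw [o_swap]; linarith
  simp [h1, h2, this]

lemma par_zb {Y : Finset Pt} (hY : GP Y) (hU : Tri Y U) {a b z : Pt} (hf : Face Y U a b z) (h1 : 0 < o z b p) (h2 : 0 < o z a p) :
    par Y U p (a,b) = some (z,b) := by
  unfold par
  simp only [nz_eq hY hU hf]
  have : ¬ 0 < o b z p := by rw [o_swap]; linarith
  simp [h1, h2, this]

lemma PL_diff {a b c d : Pt} (h1 : o a b c ≠ 0) (h2 : o b a d ≠ 0) (q : Pt) :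
    PL h b a d q = PL h a b c q - D4 h a b c d / (o a b c * o b a d) * o a b q := by
  unfold PL
  rw [div_sub' h1, div_eq_div_iff h2 h1]
  field_simp
  unfold D4 o; ring

lemma Nd_par {Y : Finset Pt} (hY : GP Y) (hU : Tri Y U) {e u : Pt × Pt} (he : e ∈ Nd Y U h p) (hu : u ∈ Nd Y U h p)
    (hp : par Y U p e = some u) : Hn Y U h p e < Hn Y U h p u := by
  obtain ⟨a, b⟩ := e
  obtain ⟨z, v, h1⟩ := (mem_Nd hY hU).1 he
  have hd := PL_diff (h := h) h1.1.1.ne' h1.2.1.1.ne' p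
  have hk := mul_pos (div_pos h1.2.2.2.2.2 (mul_pos h1.1.1 h1.2.1.1)) h1.2.2.1
  have e1 : Hn Y U h p (a,b) = PL h b a v p := by unfold Hn; simp only [nz_eq hY hU h1.2.1]
  rcases par_some hY hU h1.1 hp with ⟨rfl, -⟩ | ⟨rfl, -⟩ | rfl
  · have e2 : Hn Y U h p (a,z) = PL h a b z p := by
      unfold Hn; simp only [nz_eq hY hU h1.1.rot.rot]; exact (PL_rot h z a b p).symm
    rw [e1, e2]; linarith
  · have e2 : Hn Y U h p (z,b) = PL h a b z p := by
      unfold Hn; simp only [nz_eq hY hU h1.1.rot]; exact PL_rot h a b z p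
    rw [e1, e2]; linarith
  · obtain ⟨_, _, h2⟩ := (mem_Nd hY hU).1 hu
    have := h2.2.2.1; rw [o_aab] at this; exact absurd this (lt_irrefl _)

lemma Nd_child {Y : Finset Pt} (hY : GP Y) (hU : Tri Y U) {u : Pt × Pt} (hu : u ∈ Nd Y U h p) :
    ((Nd Y U h p).filter (fun e => par Y U p e = some u)).card ≤ 2 := by
  obtain ⟨a', b'⟩ := u
  obtain ⟨z', v', h0⟩ := (mem_Nd hY hU).1 hu
  have : (Nd Y U h p).filter (fun e => par Y U p e = some (a',b')) ⊆ {(a',v'), (v',b')} := by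
    rintro ⟨a, b⟩ he
    obtain ⟨he, hp⟩ := Finset.mem_filter.1 he
    obtain ⟨z, v, h1⟩ := (mem_Nd hY hU).1 he
    simp only [Finset.mem_insert, Finset.mem_singleton, Prod.mk.injEq]
    rcases par_some hY hU h1.1 hp with ⟨h2, -⟩ | ⟨h2, -⟩ | h2 <;> rw [Prod.mk.injEq] at h2 <;> obtain ⟨rfl, rfl⟩ := h2
    · left; exact ⟨rfl, Face.unique hY hU h1.1.rot.rot h0.2.1⟩
    · right; exact ⟨Face.unique hY hU h1.1.rot h0.2.1, rfl⟩
    · have := h0.2.2.1; rw [o_aab] at this; exact absurd this (lt_irrefl _)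
  exact (Finset.card_le_card this).trans Finset.card_le_two

/-- point setup -/
structure PS (X : Finset Pt) (U : Finset (Sym2 Pt)) (A B C p : Pt) : Prop where
  cf : Cfg X A B C
  hp : p ∈ X
  nA : p ≠ A
  nB : p ≠ B
  nC : p ≠ C
  tr : Tri (X.erase p) U

lemma PS.cfY (H : PS X U A B C p) : Cfg (X.erase p) A B C := H.cf.erase H.nA H.nB H.nC
lemma PS.gpY (H : PS X U A B C p) : GP (X.erase p) := H.cfY.gp

lemma PS.left (H : PS X U A B C p) {a b : Pt} (hl : 0 < o a b p) : ∃ q ∈ X.erase p, 0 < o a b q := by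
  obtain ⟨i1, i2, i3⟩ := H.cf.ins p H.hp H.nA H.nB H.nC
  by_contra hcon
  push Not at hcon
  have := bary A B C a b p
  have := mul_pos H.cf.ccw hl
  have := mul_nonneg i2.le (neg_nonneg.2 (hcon A H.cfY.hA))
  have := mul_nonneg i3.le (neg_nonneg.2 (hcon B H.cfY.hB))
  have := mul_nonneg i1.le (neg_nonneg.2 (hcon C H.cfY.hC))
  linarith

lemma PS.right (H : PS X U A B C p) {v : Pt} (hv : v ∈ X.erase p) : ∃ q ∈ X.erase p, o v p q < 0 := by
  obtain ⟨i1, i2, i3⟩ := H.cf.ins p H.hp H.nA H.nB H.nC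
  by_contra hcon
  push Not at hcon
  have hb := bary A B C v p p
  rw [o_abb] at hb
  have k1 := mul_nonneg i2.le (hcon A H.cfY.hA)
  have k2 := mul_nonneg i3.le (hcon B H.cfY.hB)
  have k3 := mul_nonneg i1.le (hcon C H.cfY.hC)
  have z1 : o v p A = 0 := by
    have : o B C p * o v p A = 0 := by linarith
    rcases mul_eq_zero.1 this with h | h
    · linarith
    · exact h
  have z2 : o v p B = 0 := by
    have : o C A p * o v p B = 0 := by linarith
    rcases mul_eq_zero.1 this with h | h
    · linarith
    · exact h
  have hvX := Finset.mem_of_mem_erase hv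
  have hvp := Finset.ne_of_mem_erase hv
  have a1 : A = v := (H.cf.gp.mem_of_zero hvX H.hp H.cf.hA hvp z1).resolve_right H.nA.symm
  have a2 : B = v := (H.cf.gp.mem_of_zero hvX H.hp H.cf.hB hvp z2).resolve_right H.nB.symm
  exact H.cf.AB.1 (a1.trans a2.symm)

lemma PS.ne0 (H : PS X U A B C p) {a b : Pt} (ha : a ∈ X.erase p) (hb : b ∈ X.erase p) (hab : a ≠ b) : o a b p ≠ 0 := by
  intro h0
  rcases H.cf.gp.mem_of_zero (Finset.mem_of_mem_erase ha) (Finset.mem_of_mem_erase hb) H.hp hab h0 with h | h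
  · exact Finset.ne_of_mem_erase ha h.symm
  · exact Finset.ne_of_mem_erase hb h.symm

lemma PS.tau (H : PS X U A B C p) {v : Pt} (hv : v ∈ X.erase p) : ∃ b a, Face (X.erase p) U v b a ∧ 0 < o v b p ∧ 0 < o a v p := by
  have hvp := Finset.ne_of_mem_erase hv
  have hrr : ∀ q, rr (p.1-v.1, p.2-v.2) v q = o v p q := by intro q; unfold rr o; ring
  obtain ⟨b, c, hf, k1, k2⟩ := dir_exists H.gpY H.tr hv (p.1-v.1, p.2-v.2) (by
      intro q hq hqv
      rw [hrr]
      rw [o_swap']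
      exact neg_ne_zero.2 (H.ne0 hv hq hqv.symm)) (by
      obtain ⟨q, hq, h⟩ := H.right hv
      exact ⟨q, hq, by rwa [hrr]⟩) (by
      intro b hb hr
      rw [hrr] at hr
      exact H.left (by rw [o_swap']; linarith))
  rw [hrr] at k1 k2
  exact ⟨b, c, hf, by rw [o_swap']; linarith, by rw [← o_rot, ] ; exact k2⟩

lemma Tri.sub_erase (H : PS X U A B C p) : Plane X U := by
  intro a b hab
  obtain ⟨h1, h2, h3, h4⟩ := H.tr.plane a b hab
  exact ⟨Finset.mem_of_mem_erase h1, Finset.mem_of_mem_erase h2, h3, h4⟩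

def nb (T : Finset (Sym2 Pt)) (X : Finset Pt) (p : Pt) : Finset Pt := X.filter (fun v => s(p,v) ∈ T)

lemma card_nb {T : Finset (Sym2 Pt)} (hT : Tri X T) (p : Pt) : (nb T X p).card = (T.filter (fun e => p ∈ e)).card := by
  apply Finset.card_bij (fun v _ => s(p,v))
  · intro v hv; exact Finset.mem_filter.2 ⟨(Finset.mem_filter.1 hv).2, Sym2.mem_mk_left _ _⟩
  · intro a _ b _ h; exact Sym2.congr_right.1 h
  · intro e he
    obtain ⟨he, hp⟩ := Finset.mem_filter.1 he
    obtain ⟨v, rfl⟩ := Sym2.mem_iff_exists.1 hp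
    exact ⟨v, Finset.mem_filter.2 ⟨hT.memR he, he⟩, rfl⟩

/-- T restricts inside U -/
def Res (T U : Finset (Sym2 Pt)) (p : Pt) : Prop := ∀ e ∈ T, p ∉ e → e ∈ U

lemma PS.card (H : PS X U A B C p) {T : Finset (Sym2 Pt)} (hT : Tri X T) (hR : Res T U p) :
    (U \ T).card + 3 = (nb T X p).card := by
  have h1 := card_Tri H.cf hT
  have h2 := card_Tri H.cfY H.tr
  have h3 := Finset.card_erase_add_one H.hp
  have h4 : U ∩ T = T.filter (fun e => ¬ p ∈ e) := by
    ext e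
    rw [Finset.mem_inter, Finset.mem_filter]
    constructor
    · rintro ⟨hu, ht⟩
      refine ⟨ht, fun hp => ?_⟩
      obtain ⟨v, rfl⟩ := Sym2.mem_iff_exists.1 hp
      exact Finset.ne_of_mem_erase (H.tr.memL hu) rfl
    · rintro ⟨ht, hp⟩; exact ⟨hR _ ht hp, ht⟩
  have h5 := Finset.card_sdiff_add_card_inter U T
  have h6 := Finset.card_filter_add_card_filter_not (s := T) (fun e => p ∈ e)
  rw [h4] at h5
  rw [card_nb hT]
  omega

lemma PS.exists3 (H : PS X U A B C p) : ∃ T, Tri X T ∧ U ⊆ T ∧ Res T U p := by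
  obtain ⟨T, hT, hs⟩ := (Tri.sub_erase H).extend
  refine ⟨T, hT, hs, ?_⟩
  intro e he hp
  induction e using Sym2.ind with
  | _ a b =>
    rw [Sym2.mem_iff] at hp
    push Not at hp
    rw [H.tr a b]
    exact ⟨Finset.mem_erase.2 ⟨hp.1.symm, hT.memL he⟩, Finset.mem_erase.2 ⟨hp.2.symm, hT.memR he⟩, hT.ne he, fun c d hcd => hT.ncr he (hs hcd)⟩

end Nodes
end SC
end

noncomputable section
namespace SC
section Ideals
variable {X : Finset Pt} {U T : Finset (Sym2 Pt)} {A B C p : Pt} {h : Pt → ℝ}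

/-- edges at p do not cross -/
lemma not_cr_same (p a b : Pt) : ¬ cr p a p b := by
  unfold cr; simp

lemma PS.W3 (H : PS X U A B C p) : ∃ W : Finset Pt, W.card = 3 ∧ ∀ a b c, Face (X.erase p) U a b c →
    0 < o a b p → 0 < o b c p → 0 < o c a p → a ∈ W := by
  obtain ⟨T, hT, hs, hR⟩ := H.exists3
  refine ⟨nb T X p, ?_, ?_⟩
  · rw [← H.card hT hR, Finset.sdiff_eq_empty_iff_subset.2 hs]; rfl
  · intro a b c hf h1 h2 h3
    have haY := H.tr.memL hf.2.1
    have haX := Finset.mem_of_mem_erase haY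
    refine Finset.mem_filter.2 ⟨haX, ?_⟩
    have hpa : p ≠ a := (Finset.ne_of_mem_erase haY).symm
    rw [hT p a]
    refine ⟨H.hp, haX, hpa, ?_⟩
    intro f g hfg hcr
    have key : p ∉ s(f,g) → False := by
      intro hp
      have hU := hR _ hfg hp
      obtain ⟨r, u, hr0, hr1, hu0, hu1, he⟩ := exists_meet_of_cr hcr
      refine Face.inside H.gpY H.tr hf hU hu0 hu1 he ?_ ?_ ?_
      · rw [o_lerp, o_aba]; have := mul_pos (sub_pos.2 hr1) h1; linarith
      · rw [o_lerp, o_rot a b c]; have := mul_pos (sub_pos.2 hr1) h2; have := mul_pos hr0 hf.1; linarith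
      · rw [o_lerp, o_abb]; have := mul_pos (sub_pos.2 hr1) h3; linarith
    by_cases hp : p ∈ s(f,g)
    · rcases Sym2.mem_iff.1 hp with rfl | rfl
      · exact not_cr_same _ _ _ hcr
      · exact not_cr_same _ _ _ (cr_swapR hcr)
    · exact key hp

lemma PS.roots (H : PS X U A B C p) :
    ((Nd (X.erase p) U h p).filter (fun e => par (X.erase p) U p e = none)).card ≤ 3 := by
  obtain ⟨W, hW, hf⟩ := H.W3
  rw [← hW]
  have get : ∀ e ∈ (Nd (X.erase p) U h p).filter (fun e => par (X.erase p) U p e = none), 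
      ∃ z, Face (X.erase p) U e.1 e.2 z ∧ e.1 ∈ W ∧ e.2 ∈ W ∧ z ∈ W := by
    rintro ⟨a,b⟩ he
    obtain ⟨he, hp⟩ := Finset.mem_filter.1 he
    obtain ⟨z, v, h1⟩ := (mem_Nd H.gpY H.tr).1 he
    obtain ⟨k1, k2⟩ := (par_none H.gpY H.tr h1.1).1 hp
    exact ⟨z, h1.1, hf _ _ _ h1.1 h1.2.2.1 k1 k2, hf _ _ _ h1.1.rot k1 k2 h1.2.2.1, hf _ _ _ h1.1.rot.rot k2 h1.2.2.1 k1⟩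
  apply Finset.card_le_card_of_injOn (fun e => e.1)
  · intro e he; exact (get e he).choose_spec.2.1
  · rintro ⟨a,b⟩ he ⟨a',b'⟩ he' (rfl : a = a')
    obtain ⟨z, f1, m1, m2, m3⟩ := get _ he
    obtain ⟨z', f2, m1', m2', m3'⟩ := get _ he'
    simp only at *
    by_contra hne
    have hbb : b ≠ b' := fun h => hne (by rw [h])
    obtain ⟨n1, n2, n3⟩ := ne_of_o f1.1
    obtain ⟨n4, n5, n6⟩ := ne_of_o f2.1
    have hWe : W = {a, b, z} := by
      symm; apply Finset.eq_of_subset_of_card_le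
      · intro x hx; simp at hx; rcases hx with rfl | rfl | rfl <;> assumption
      · rw [hW, Finset.card_eq_three.2 ⟨a,b,z,n1,n3,n2,rfl⟩]
    rw [hWe] at m2' m3'
    simp at m2' m3'
    have : b' = z := by tauto
    subst this
    have : z' = b := by tauto
    subst this
    have := f1.1; have := f2.1; rw [o_swap'] at this; linarith

/-- node data for removed edges, from T -/
lemma PS.nodes (H : PS X U A B C p) (hT : Tri X T) (hR : Res T U p) {a b : Pt} (he : s(a,b) ∈ U) (hn : s(a,b) ∉ T)
    (hl : 0 < o a b p) : ∃ v, Face (X.erase p) U b a v ∧ 0 < o a v p ∧ 0 < o v b p ∧ s(p,v) ∈ T := by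
  obtain ⟨W0, hW0, hf⟩ := H.W3
  let W := nb T X p \ W0
  have hWc : (U \ T).card ≤ W.card := by
    have := H.card hT hR
    have h5 : (nb T X p).card - W0.card ≤ W.card := Finset.le_card_sdiff W0 (nb T X p)
    omega
  have hτ : ∀ v : Pt, ∃ ba : Pt × Pt, v ∈ W → Face (X.erase p) U v ba.1 ba.2 ∧ 0 < o v ba.1 p ∧ 0 < o ba.2 v p ∧ 0 < o ba.2 ba.1 p := by
    intro v
    by_cases hv : v ∈ W
    · have hv1 := Finset.mem_sdiff.1 hv
      have hv2 := Finset.mem_filter.1 hv1.1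
      have hvY : v ∈ X.erase p := Finset.mem_erase.2 ⟨(hT.ne hv2.2).symm, hv2.1⟩
      obtain ⟨b, a, f, k1, k2⟩ := H.tau hvY
      refine ⟨(b,a), fun _ => ⟨f, k1, k2, ?_⟩⟩
      have := H.ne0 (H.tr.memR f.2.2.1) (H.tr.memL f.2.2.1) (H.tr.ne f.2.2.1).symm
      rcases lt_or_gt_of_ne this with hlt | hgt
      · exfalso
        exact hv1.2 (hf v b a f k1 (by rw [o_swap]; linarith) k2)
      · exact hgt
    · exact ⟨(v,v), fun h => absurd h hv⟩
  choose τ hτ using hτ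
  let φ : Pt → Sym2 Pt := fun v => s((τ v).2, (τ v).1)
  have hφ : ∀ v ∈ W, φ v ∈ U \ T := by
    intro v hv
    obtain ⟨f, k1, k2, k3⟩ := hτ v hv
    have hv2 := (Finset.mem_filter.1 (Finset.mem_sdiff.1 hv).1).2
    refine Finset.mem_sdiff.2 ⟨swp f.2.2.1, fun hin => ?_⟩
    refine hT.ncr hv2 hin ⟨?_, ?_⟩
    · have e1 : o p v (τ v).2 = - o (τ v).2 v p := by rw [← o_rot p v, o_swap']; rw [← o_rot v p, o_rot, o_rot]
      have e2 : o p v (τ v).1 = o v (τ v).1 p := (o_rot p v _).symm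
      rw [e1, e2]; have := mul_pos k2 k1; linarith
    · have e1 : o (τ v).2 (τ v).1 v = - o v (τ v).1 (τ v).2 := by rw [o_swap, o_rot v]
      rw [e1]; have := mul_pos k3 f.1; linarith
  have hinj : Set.InjOn φ W := by
    intro v hv w hw hvw
    obtain ⟨f, k1, k2, k3⟩ := hτ v hv
    obtain ⟨f', k1', k2', k3'⟩ := hτ w hw
    rcases Sym2.eq_iff.1 hvw with ⟨q1, q2⟩ | ⟨q1, q2⟩
    · rw [← q1, ← q2] at f'
      exact Face.unique H.gpY H.tr f.rot f'.rot
    · rw [← q1, ← q2, o_swap] at k3'; linarith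
  have himg : W.image φ = U \ T := by
    apply Finset.eq_of_subset_of_card_le
    · intro e he; obtain ⟨v, hv, rfl⟩ := Finset.mem_image.1 he; exact hφ v hv
    · rw [Finset.card_image_of_injOn hinj]; exact hWc
  have : s(a,b) ∈ W.image φ := by rw [himg]; exact Finset.mem_sdiff.2 ⟨he, hn⟩
  obtain ⟨v, hv, hve⟩ := Finset.mem_image.1 this
  obtain ⟨f, k1, k2, k3⟩ := hτ v hv
  have hv2 := (Finset.mem_filter.1 (Finset.mem_sdiff.1 hv).1).2
  rcases Sym2.eq_iff.1 hve with ⟨q1, q2⟩ | ⟨q1, q2⟩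
  · rw [q1, q2] at f; rw [q1] at k2; rw [q2] at k1; exact ⟨v, f.rot, k2, k1, hv2⟩
  · rw [q1, q2, o_swap] at k3; linarith

lemma PS.ex_near (H : PS X U A B C p) {a b : Pt} (he : s(a,b) ∈ U) (hl : 0 < o a b p) : ∃ z, Face (X.erase p) U a b z := by
  obtain ⟨q, hq, hq'⟩ := H.left hl
  exact exists_face H.gpY H.tr he hq hq'

def WT (X : Finset Pt) (U T : Finset (Sym2 Pt)) (p : Pt) : Finset (Pt × Pt) :=
  ((X.erase p) ×ˢ (X.erase p)).filter (fun e => s(e.1,e.2) ∈ U \ T ∧ 0 < o e.1 e.2 p)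

lemma mem_WT (H : PS X U A B C p) {a b : Pt} : (a,b) ∈ WT X U T p ↔ s(a,b) ∈ U ∧ s(a,b) ∉ T ∧ 0 < o a b p := by
  unfold WT
  rw [Finset.mem_filter, Finset.mem_sdiff]
  constructor
  · rintro ⟨-, h1, h2⟩; exact ⟨h1.1, h1.2, h2⟩
  · rintro ⟨h1, h2, h3⟩; exact ⟨Finset.mem_product.2 ⟨H.tr.memL h1, H.tr.memR h1⟩, ⟨h1, h2⟩, h3⟩

lemma card_WT (H : PS X U A B C p) : (WT X U T p).card = (U \ T).card := by
  apply Finset.card_bij (fun e _ => s(e.1,e.2))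
  · rintro ⟨a,b⟩ he
    rw [mem_WT H] at he
    exact Finset.mem_sdiff.2 ⟨he.1, he.2.1⟩
  · rintro ⟨a,b⟩ he ⟨c,d⟩ he' hh
    rw [mem_WT H] at he he'
    rcases Sym2.eq_iff.1 hh with ⟨q1, q2⟩ | ⟨q1, q2⟩
    · simp only at q1 q2; rw [q1, q2]
    · simp only at q1 q2; have := he.2.2; rw [q1, q2, o_swap] at this; linarith [he'.2.2]
  · intro e he
    induction e using Sym2.ind with
    | _ a b =>
      obtain ⟨h1, h2⟩ := Finset.mem_sdiff.1 he
      rcases lt_or_gt_of_ne (H.ne0 (H.tr.memL h1) (H.tr.memR h1) (H.tr.ne h1)) with hs | hs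
      · refine ⟨(b,a), (mem_WT H).2 ⟨swp h1, fun hh => h2 (swp hh), by rw [o_swap]; linarith⟩, Sym2.eq_swap⟩
      · exact ⟨(a,b), (mem_WT H).2 ⟨h1, h2, hs⟩, rfl⟩

lemma exit_cr {a b z v p : Pt} (hf : 0 < o a b z) (hl : 0 < o a b p) (hv : 0 < o b a v) (k1 : 0 < o a v p) (k2 : 0 < o v b p)
    (hn : ¬ (0 < o b z p ∧ 0 < o z a p)) (z1 : o b z p ≠ 0) (z2 : o z a p ≠ 0) (z3 : o p v z ≠ 0) : (cr p v a z ∧ 0 < o a z p) ∨ (cr p v z b ∧ 0 < o z b p) := by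
  have e1 : o p v a = - o a v p := by rw [← o_rot p v, o_swap']; rw [← o_rot v p, o_rot, o_rot]
  have e2 : o p v b = o v b p := (o_rot p v _).symm
  have hva : o a b v = - o b a v := o_swap _ _ _
  have hcr : cr p v a b := by
    refine ⟨?_, ?_⟩
    · rw [e1, e2]; have := mul_pos k1 k2; linarith
    · rw [hva]; have := mul_pos hl hv; linarith
  obtain ⟨r, u, hr0, hr1, hu0, hu1, he⟩ := exists_meet_of_cr hcr
  have hb := bary a b z p v p
  rw [o_aba, e1, e2] at hb
  rcases lt_or_gt_of_ne z3 with hz | hz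
  · right
    have hbz : o b z p < 0 := by
      by_contra hh
      have hbz : 0 < o b z p := lt_of_le_of_ne (not_lt.1 hh) z1.symm
      have hza : o z a p < 0 := lt_of_le_of_ne (not_lt.1 fun h => hn ⟨hbz, h⟩) z2
      have := mul_pos hbz k1; have := mul_pos_of_neg_of_neg hza (neg_neg_of_pos k2); have := mul_pos_of_neg_of_neg (neg_neg_of_pos hl) hz
      linarith
    have g1 : o z b p = - o b z p := o_swap _ _ _
    have hgv : o z b v < 0 := by
      have : (1-r) * o z b p + r * o z b v = (1-u) * o z b a + u * o z b b := by rw [← o_lerp, ← o_lerp, he]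
      rw [o_abb] at this
      have g2 : o z b a = - o a b z := by rw [o_swap, o_rot a b z]
      have h3 := mul_pos (sub_pos.2 hu1) hf
      have h4 := mul_pos (sub_pos.2 hr1) (neg_pos.2 hbz)
      rw [g1, g2] at this
      have : 0 < r * (- o z b v) := by linarith
      have := (pos_iff_pos_of_mul_pos this).1 hr0
      linarith
    refine ⟨⟨?_, ?_⟩, by linarith⟩
    · rw [e2]; exact mul_neg_of_neg_of_pos hz k2
    · rw [g1]; exact mul_neg_of_pos_of_neg (by linarith) hgv
  · left
    have hza : o z a p < 0 := by
      by_contra hh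
      have hza : 0 < o z a p := lt_of_le_of_ne (not_lt.1 hh) z2.symm
      have hbz : o b z p < 0 := lt_of_le_of_ne (not_lt.1 fun h => hn ⟨h, hza⟩) z1
      have := mul_pos hza k2; have := mul_pos_of_neg_of_neg hbz (neg_neg_of_pos k1); have := mul_pos hl hz
      linarith
    have g1 : o a z p = - o z a p := o_swap _ _ _
    have hgv : o a z v < 0 := by
      have : (1-r) * o a z p + r * o a z v = (1-u) * o a z a + u * o a z b := by rw [← o_lerp, ← o_lerp, he]
      rw [o_aba] at this
      have g2 : o a z b = - o a b z := by rw [o_swap']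
      have h3 := mul_pos hu0 hf
      have h4 := mul_pos (sub_pos.2 hr1) (neg_pos.2 hza)
      rw [g1, g2] at this
      have : 0 < r * (- o a z v) := by linarith
      have := (pos_iff_pos_of_mul_pos this).1 hr0
      linarith
    refine ⟨⟨?_, ?_⟩, by linarith⟩
    · rw [e1]; exact mul_neg_of_neg_of_pos (by linarith) hz
    · rw [g1]; exact mul_neg_of_pos_of_neg (by linarith) hgv

lemma PS.ideal (H : PS X U A B C p) (hT : Tri X T) (hR : Res T U p) (hg : ∀ e ∈ U, e ∉ T → GE h (X.erase p) U e) :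
    IsIdeal (par (X.erase p) U p) (Nd (X.erase p) U h p) (WT X U T p) := by
  constructor
  · rintro ⟨a,b⟩ he
    obtain ⟨h1, h2, h3⟩ := (mem_WT H).1 he
    obtain ⟨v, f, k1, k2, -⟩ := H.nodes hT hR h1 h2 h3
    obtain ⟨z, hz⟩ := H.ex_near h1 h3
    exact (mem_Nd H.gpY H.tr).2 ⟨z, v, hz, f, h3, k1, k2, hg _ h1 h2 a b z v rfl hz f⟩
  · rintro ⟨a,b⟩ he u hu
    obtain ⟨h1, h2, h3⟩ := (mem_WT H).1 he
    obtain ⟨v, f, k1, k2, hpv⟩ := H.nodes hT hR h1 h2 h3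
    obtain ⟨z, hz⟩ := H.ex_near h1 h3
    have hn : ¬ (0 < o b z p ∧ 0 < o z a p) := fun hh => by
      rw [(par_none H.gpY H.tr hz).2 hh] at hu; exact absurd hu (by simp)
    have hvY := H.tr.memR f.2.2.1
    have hzY := H.tr.memR hz.2.2.1
    have hzv : v ≠ z := by
      rintro rfl
      have := f.1; rw [o_swap] at this; linarith [hz.1]
    have z3 : o p v z ≠ 0 := by rw [← o_rot]; exact H.ne0 hvY hzY hzv
    rcases exit_cr hz.1 h3 f.1 k1 k2 hn (H.ne0 (H.tr.memL hz.2.2.1) hzY (H.tr.ne hz.2.2.1))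
      (H.ne0 hzY (H.tr.memL hz.2.1) (H.tr.ne hz.2.2.2.1)) z3 with ⟨hc, g3⟩ | ⟨hc, g3⟩
    · have g1 : s(a,z) ∈ U := swp hz.2.2.2.1
      have g2 : s(a,z) ∉ T := fun hh => hT.ncr hpv hh hc
      obtain ⟨v', f', -, k', -⟩ := H.nodes hT hR g1 g2 g3
      obtain rfl := Face.unique H.gpY H.tr f' hz.rot.rot
      rw [par_az H.gpY H.tr hz g3 k'] at hu
      obtain rfl := Option.some.inj hu
      exact (mem_WT H).2 ⟨g1, g2, g3⟩
    · have g1 : s(z,b) ∈ U := swp hz.2.2.1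
      have g2 : s(z,b) ∉ T := fun hh => hT.ncr hpv hh hc
      obtain ⟨v', f', k', -, -⟩ := H.nodes hT hR g1 g2 g3
      obtain rfl := Face.unique H.gpY H.tr f' hz.rot
      rw [par_zb H.gpY H.tr hz g3 k'] at hu
      obtain rfl := Option.some.inj hu
      exact (mem_WT H).2 ⟨g1, g2, g3⟩

lemma PS.inj (H : PS X U A B C p) {T1 T2 : Finset (Sym2 Pt)} (h1 : Tri X T1) (h2 : Tri X T2) (r1 : Res T1 U p) (r2 : Res T2 U p)
    (hW : WT X U T1 p = WT X U T2 p) : T1 = T2 := by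
  have key : ∀ {T1 T2 : Finset (Sym2 Pt)}, Tri X T1 → Tri X T2 → Res T1 U p → Res T2 U p → WT X U T1 p = WT X U T2 p → T1 ⊆ T2 := by
    intro T1 T2 h1 h2 r1 r2 hW
    have e0 : ∀ e ∈ U, e ∉ T1 ↔ e ∉ T2 := by
      intro e he
      induction e using Sym2.ind with
      | _ a b =>
        have base : ∀ {a b}, s(a,b) ∈ U → 0 < o a b p → (s(a,b) ∉ T1 ↔ s(a,b) ∉ T2) := by
          intro a b he hs
          have m1 := mem_WT H (T := T1) (a := a) (b := b)
          have m2 := mem_WT H (T := T2) (a := a) (b := b)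
          rw [hW] at m1; tauto
        rcases lt_or_gt_of_ne (H.ne0 (H.tr.memL he) (H.tr.memR he) (H.tr.ne he)) with hs | hs
        · rw [Sym2.eq_swap]; exact base (swp he) (by rw [o_swap]; linarith)
        · exact base he hs
    intro e he
    by_cases hp : p ∈ e
    · obtain ⟨v, rfl⟩ := Sym2.mem_iff_exists.1 hp
      rw [h2 p v]
      refine ⟨h1.memL he, h1.memR he, h1.ne he, ?_⟩
      intro c d hcd hcr
      by_cases hp' : p ∈ s(c,d)
      · rcases Sym2.mem_iff.1 hp' with rfl | rfl
        · exact not_cr_same _ _ _ hcr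
        · exact not_cr_same _ _ _ (cr_swapR hcr)
      · have hU := r2 _ hcd hp'
        have : s(c,d) ∈ T1 := by
          by_contra hh; exact (e0 _ hU).1 hh hcd
        exact h1.ncr he this hcr
    · have hU := r1 _ he hp
      by_contra hh
      exact (e0 _ hU).2 hh he
  exact Finset.Subset.antisymm (key h1 h2 r1 r2 hW) (key h2 h1 r2 r1 hW.symm)

lemma PS.surj (H : PS X U A B C p) : ∀ (n : ℕ) (W : Finset (Pt × Pt)), W.card = n →
    IsIdeal (par (X.erase p) U p) (Nd (X.erase p) U h p) W → ∃ T, Tri X T ∧ Res T U p ∧ WT X U T p = W := by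
  intro n
  induction n with
  | zero =>
    intro W hW _
    obtain ⟨T, hT, hs, hR⟩ := H.exists3
    refine ⟨T, hT, hR, ?_⟩
    rw [Finset.card_eq_zero.1 hW, Finset.eq_empty_iff_forall_notMem]
    rintro ⟨a,b⟩ he
    obtain ⟨h1, h2, -⟩ := (mem_WT H).1 he
    exact h2 (hs h1)
  | succ n ih =>
    intro W hW hI
    have hne : W.Nonempty := Finset.card_pos.1 (by omega)
    obtain ⟨⟨a,b⟩, heW, hmin⟩ := W.exists_min_image (Hn (X.erase p) U h p) hne
    obtain ⟨z, v, nd⟩ := (mem_Nd H.gpY H.tr).1 (hI.1 heW)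
    have noch : ∀ e ∈ W, par (X.erase p) U p e ≠ some (a,b) := by
      intro e he hp
      exact absurd (Nd_par H.gpY H.tr (hI.1 he) (hI.1 heW) hp) (not_lt.2 (hmin e he))
    obtain ⟨T1, hT1, hR1, hW1⟩ := ih (W.erase (a,b)) (by rw [Finset.card_erase_of_mem heW, hW]; rfl) (by
      refine ⟨fun e he => hI.1 (Finset.mem_of_mem_erase he), ?_⟩
      intro e he u hu
      refine Finset.mem_erase.2 ⟨?_, hI.2 e (Finset.mem_of_mem_erase he) u hu⟩
      rintro rfl
      exact noch e (Finset.mem_of_mem_erase he) hu)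
    obtain ⟨f1, f2, l1, l2, l3, hD⟩ := nd
    have inT : ∀ {c d}, s(c,d) ∈ U → 0 < o c d p → (c,d) ∉ W.erase (a,b) → s(c,d) ∈ T1 := by
      intro c d h1 h2 h3
      by_contra h4
      exact h3 (by rw [← hW1]; exact (mem_WT H).2 ⟨h1, h4, h2⟩)
    have notW : ∀ {c d}, par (X.erase p) U p (c,d) = some (a,b) → (c,d) ∉ W.erase (a,b) :=
      fun hp hh => noch _ (Finset.mem_of_mem_erase hh) hp
    have m1 : s(a,b) ∈ T1 := inT f1.2.1 l1 (by simp)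
    have m2 : s(a,v) ∈ T1 := inT f2.2.2.1 l2 (notW (par_az H.gpY H.tr f2.rot l1 l3))
    have m3 : s(v,b) ∈ T1 := inT f2.2.2.2.1 l3 (notW (par_zb H.gpY H.tr f2.rot.rot l1 l2))
    have F2 : Face X T1 b a v := by
      refine ⟨f2.1, swp m1, m2, m3, ?_⟩
      intro q hq hh
      by_cases hqp : q = p
      · subst hqp; have := hh.1; rw [o_swap] at this; linarith
      · exact f2.2.2.2.2 q (Finset.mem_erase.2 ⟨hqp, hq⟩) hh
    obtain ⟨c, F1⟩ := exists_face H.cf.gp hT1 m1 H.hp l1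
    have hcp : c = p := by
      by_contra hcp
      have hap := Finset.ne_of_mem_erase (H.tr.memL f1.2.1)
      have hbp := Finset.ne_of_mem_erase (H.tr.memR f1.2.1)
      have u1 : s(b,c) ∈ U := hR1 _ F1.2.2.1 (by rw [Sym2.mem_iff]; push Not; exact ⟨hbp.symm, Ne.symm hcp⟩)
      have u2 : s(c,a) ∈ U := hR1 _ F1.2.2.2.1 (by rw [Sym2.mem_iff]; push Not; exact ⟨Ne.symm hcp, hap.symm⟩)
      have fc : Face (X.erase p) U a b c := ⟨F1.1, f1.2.1, u1, u2, fun q hq => F1.2.2.2.2 q (Finset.mem_of_mem_erase hq)⟩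
      obtain rfl := Face.unique H.gpY H.tr fc f1
      obtain ⟨n1, n2, n3⟩ := ne_of_o fc.1
      have hout : ∀ {x y}, (x,y) ∈ W → (x,y) ≠ (a,b) → s(x,y) ∉ T1 := by
        intro x y hx hxy
        have : (x,y) ∈ WT X U T1 p := by rw [hW1]; exact Finset.mem_erase.2 ⟨hxy, hx⟩
        exact ((mem_WT H).1 this).2.1
      cases hpar : par (X.erase p) U p (a,b) with
      | none =>
        have := (par_none H.gpY H.tr fc).1 hpar
        exact F1.2.2.2.2 p H.hp ⟨l1, this⟩
      | some u =>
        have huW := hI.2 _ heW u hpar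
        rcases par_some H.gpY H.tr fc hpar with ⟨rfl, -⟩ | ⟨rfl, -⟩ | rfl
        · exact hout huW (by simp [n2.symm]) (swp F1.2.2.2.1)
        · exact hout huW (by simp [n3.symm]) (swp F1.2.2.1)
        · obtain ⟨_, _, h2⟩ := (mem_Nd H.gpY H.tr).1 (hI.1 huW)
          have := h2.2.2.1; rw [o_aab] at this; exact absurd this (lt_irrefl _)
    subst hcp
    have hcr : cr a b c v := by
      refine ⟨?_, ?_⟩
      · rw [o_swap b a v]; have := mul_pos l1 f2.1; linarith
      · have e1 : o c v a = - o a v c := by rw [← o_rot c v, o_swap']; rw [← o_rot v c, o_rot, o_rot]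
        have e2 : o c v b = o v b c := (o_rot c v _).symm
        rw [e1, e2]; have := mul_pos l2 l3; linarith
    obtain ⟨hT, hn⟩ := flip_tri H.cf hT1 F1 F2 hcr
    refine ⟨_, hT, ?_, ?_⟩
    · intro e he hp
      rcases Finset.mem_insert.1 he with rfl | he
      · simp at hp
      · exact hR1 e (Finset.mem_of_mem_erase he) hp
    · ext ⟨x,y⟩
      rw [mem_WT H, Finset.mem_insert, Finset.mem_erase]
      have hw := mem_WT H (T := T1) (a := x) (b := y)
      rw [hW1, Finset.mem_erase] at hw
      constructor
      · rintro ⟨q1, q2, q3⟩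
        by_cases hxy : (x,y) = (a,b)
        · rw [hxy]; exact heW
        · refine (hw.2 ⟨q1, ?_, q3⟩).2
          intro hin
          apply q2; right
          refine ⟨?_, hin⟩
          intro hs
          rcases Sym2.eq_iff.1 hs with ⟨rfl, rfl⟩ | ⟨rfl, rfl⟩
          · exact hxy rfl
          · rw [o_swap] at q3; linarith
      · intro hxy
        have hnd := (mem_Nd H.gpY H.tr).1 (hI.1 hxy)
        obtain ⟨_, _, nd⟩ := hnd
        refine ⟨nd.1.2.1, ?_, nd.2.2.1⟩
        rintro (hs | ⟨hs, hin⟩)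
        · have : c ∈ s(x,y) := by rw [hs]; simp
          rcases Sym2.mem_iff.1 this with rfl | rfl
          · exact Finset.ne_of_mem_erase (H.tr.memL nd.1.2.1) rfl
          · exact Finset.ne_of_mem_erase (H.tr.memR nd.1.2.1) rfl
        · have : (x,y) ≠ (a,b) := by rintro hh; rw [Prod.mk.injEq] at hh; exact hs (by rw [hh.1, hh.2])
          exact (hw.1 ⟨this, hxy⟩).2.1 hin

end Ideals
end SC
end

noncomputable section
namespace SC
section TrBound
variable {X : Finset Pt} {U T : Finset (Sym2 Pt)} {A B C p : Pt} {h : Pt → ℝ}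

def TS (X : Finset Pt) : Finset (Finset (Sym2 Pt)) := X.sym2.powerset.filter (Tri X)

lemma mem_TS : T ∈ TS X ↔ Tri X T := by
  unfold TS
  rw [Finset.mem_filter, Finset.mem_powerset]
  exact ⟨fun h => h.2, fun h => ⟨h.plane.sub, h⟩⟩

lemma fiber_bound (H : PS X U A B C p) :
    ∑ T ∈ (TS X).filter (fun T => Res T U p ∧ ∀ e ∈ U, e ∉ T → GE h (X.erase p) U e), (7 - ((nb T X p).card : ℤ)) ≤ 28 := by
  refine le_trans (le_of_eq ?_) (forest (par := par (X.erase p) U p) (Hn (X.erase p) U h p) (Nd (X.erase p) U h p) 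
    (fun v hv u hu => Nd_par H.gpY H.tr hv hu) (by convert H.roots) (fun u hu => by convert Nd_child H.gpY H.tr hu))
  apply Finset.sum_bij (fun T _ => WT X U T p)
  · intro T hT
    obtain ⟨h1, h2, h3⟩ := Finset.mem_filter.1 hT
    have := H.ideal (mem_TS.1 h1) h2 h3
    rw [Finset.mem_filter, Finset.mem_powerset]
    exact ⟨this.1, this⟩
  · intro T hT T2 hT2 he
    obtain ⟨h1, h2, h3⟩ := Finset.mem_filter.1 hT
    obtain ⟨h1', h2', h3'⟩ := Finset.mem_filter.1 hT2
    exact H.inj (mem_TS.1 h1) (mem_TS.1 h1') h2 h2' he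
  · intro W hW
    have hI := (Finset.mem_filter.1 hW).2
    obtain ⟨T, hT, hR, he⟩ := H.surj (h := h) _ W rfl hI
    refine ⟨T, Finset.mem_filter.2 ⟨mem_TS.2 hT, hR, ?_⟩, he⟩
    have base : ∀ {a b}, s(a,b) ∈ U → s(a,b) ∉ T → 0 < o a b p → ∀ c d, Face (X.erase p) U a b c → Face (X.erase p) U b a d → 0 < D4 h a b c d := by
      intro a b h1 h2 h3 c d f1 f2
      have : (a,b) ∈ W := by rw [← he]; exact (mem_WT H).2 ⟨h1, h2, h3⟩
      obtain ⟨z, v, nd⟩ := (mem_Nd H.gpY H.tr).1 (hI.1 this)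
      rw [Face.unique H.gpY H.tr f1 nd.1, Face.unique H.gpY H.tr f2 nd.2.1]
      exact nd.2.2.2.2.2
    rintro e h1 h2 a b c d rfl f1 f2
    rcases lt_or_gt_of_ne (H.ne0 (H.tr.memL h1) (H.tr.memR h1) (H.tr.ne h1)) with hs | hs
    · rw [← D4_swap]
      exact base (swp h1) (fun hh => h2 (swp hh)) (by rw [o_swap]; linarith) _ _ f2 f1
    · exact base h1 h2 hs _ _ f1 f2
  · intro T hT
    obtain ⟨h1, h2, h3⟩ := Finset.mem_filter.1 hT
    have := H.card (mem_TS.1 h1) h2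
    rw [card_WT H]
    push_cast [← this]; ring

lemma vint (hC : Cfg X A B C) (hp : p ∈ X) (h1 : p ≠ A) (h2 : p ≠ B) (h3 : p ≠ C) :
    ∑ T ∈ TS X, (7 - ((nb T X p).card : ℤ)) ≤ 28 * (TS (X.erase p)).card := by
  obtain ⟨h, hh⟩ := exists_Ht hC.gp
  have hCY := hC.erase h1 h2 h3
  have hhY : Ht (X.erase p) h := by
    refine ⟨fun a ha b hb c hc d hd => hh.1 a (Finset.mem_of_mem_erase ha) b (Finset.mem_of_mem_erase hb) c (Finset.mem_of_mem_erase hc) d (Finset.mem_of_mem_erase hd),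
      fun a ha b hb c hc d hd => hh.2 a (Finset.mem_of_mem_erase ha) b (Finset.mem_of_mem_erase hb) c (Finset.mem_of_mem_erase hc) d (Finset.mem_of_mem_erase hd)⟩
  have hreg : ∀ T : Finset (Sym2 Pt), ∃ U, T ∈ TS X → U ∈ TS (X.erase p) ∧ Res T U p ∧ ∀ e ∈ U, e ∉ T → GE h (X.erase p) U e := by
    intro T
    by_cases hT : T ∈ TS X
    · have hT' := mem_TS.1 hT
      have hG : Plane (X.erase p) (T.filter (fun e => p ∉ e)) := by
        intro a b hab
        obtain ⟨q1, q2⟩ := Finset.mem_filter.1 hab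
        rw [Sym2.mem_iff] at q2; push Not at q2
        exact ⟨Finset.mem_erase.2 ⟨q2.1.symm, hT'.memL q1⟩, Finset.mem_erase.2 ⟨q2.2.symm, hT'.memR q1⟩, hT'.ne q1,
          fun c d hcd => hT'.ncr q1 (Finset.mem_filter.1 hcd).1⟩
      obtain ⟨U, hU, hs, hg⟩ := exists_reg hCY hhY hG
      refine ⟨U, fun _ => ⟨mem_TS.2 hU, fun e he hpe => hs (Finset.mem_filter.2 ⟨he, hpe⟩), ?_⟩⟩
      intro e he hn
      exact hg e he (fun hx => hn (Finset.mem_filter.1 hx).1)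
    · exact ⟨∅, fun h => absurd h hT⟩
  choose reg hreg using hreg
  rw [← Finset.sum_fiberwise_of_maps_to (g := reg) (t := TS (X.erase p)) (fun T hT => (hreg T hT).1)]
  have : ∀ U ∈ TS (X.erase p), ∑ T ∈ (TS X).filter (fun T => reg T = U), (7 - ((nb T X p).card : ℤ)) ≤ 28 := by
    intro U hU
    have H : PS X U A B C p := ⟨hC, hp, h1, h2, h3, mem_TS.1 hU⟩
    refine le_trans (le_of_eq ?_) (fiber_bound (h := h) H)
    apply Finset.sum_congr _ (fun _ _ => rfl)
    apply Finset.filter_congr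
    intro T hT
    constructor
    · rintro rfl; exact (hreg T hT).2
    · rintro ⟨r1, g1⟩
      obtain ⟨hU', r2, g2⟩ := hreg T hT
      have nop : ∀ {V}, Tri (X.erase p) V → ∀ e ∈ V, p ∉ e := by
        intro V hV e he hpe
        obtain ⟨v, rfl⟩ := Sym2.mem_iff_exists.1 hpe
        exact Finset.ne_of_mem_erase (hV.memL he) rfl
      refine unique_reg (h := h) (G := T.filter (fun e => p ∉ e)) hCY (mem_TS.1 hU') H.tr ?_ ?_ ?_ ?_ 
      · intro e he; exact r2 e (Finset.mem_filter.1 he).1 (Finset.mem_filter.1 he).2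
      · intro e he; exact r1 e (Finset.mem_filter.1 he).1 (Finset.mem_filter.1 he).2
      · intro e he hn; exact g2 e he (fun hx => hn (Finset.mem_filter.2 ⟨hx, nop (mem_TS.1 hU') e he⟩))
      · intro e he hn; exact g1 e he (fun hx => hn (Finset.mem_filter.2 ⟨hx, nop H.tr e he⟩))
  refine (Finset.sum_le_sum this).trans ?_
  simp [mul_comm]

lemma sum_nb (hT : Tri X T) : ∑ p ∈ X, (nb T X p).card = 2 * T.card := by
  rw [← card_DE hT]
  unfold DE nb
  rw [Finset.card_filter, Finset.sum_product]
  apply Finset.sum_congr rfl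
  intro p _
  rw [Finset.card_filter]

lemma two_le_nb (hC : Cfg X A B C) (hT : Tri X T) : 2 ≤ (nb T X A).card ∧ 2 ≤ (nb T X B).card ∧ 2 ≤ (nb T X C).card := by
  obtain ⟨e1, e2, e3⟩ := hC.hull hT
  obtain ⟨n1, n2, n3⟩ := hC.AB
  have key : ∀ {a b c : Pt}, s(a,b) ∈ T → s(a,c) ∈ T → b ≠ c → 2 ≤ (nb T X a).card := by
    intro a b c h1 h2 h3
    rw [← Finset.card_pair h3]
    apply Finset.card_le_card
    intro x hx
    simp only [Finset.mem_insert, Finset.mem_singleton] at hx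
    rcases hx with rfl | rfl
    · exact Finset.mem_filter.2 ⟨hT.memR h1, h1⟩
    · exact Finset.mem_filter.2 ⟨hT.memR h2, h2⟩
  exact ⟨key e1 (swp e3) n2, key e2 (swp e1) n3, key e3 (swp e2) n1⟩

lemma sum_int (hC : Cfg X A B C) (hT : Tri X T) :
    ((X \ {A,B,C}).card : ℤ) ≤ ∑ p ∈ X \ {A,B,C}, (7 - ((nb T X p).card : ℤ)) := by
  have h1 := sum_nb hT
  have hs : ({A,B,C} : Finset Pt) ⊆ X := by
    intro x hx; simp at hx; rcases hx with rfl | rfl | rfl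
    · exact hC.hA
    · exact hC.hB
    · exact hC.hC
  rw [← Finset.sum_sdiff hs] at h1
  obtain ⟨n1, n2, n3⟩ := hC.AB
  rw [Finset.sum_insert (by simp [n1, n3.symm]), Finset.sum_insert (by simp [n2]), Finset.sum_singleton] at h1
  obtain ⟨k1, k2, k3⟩ := two_le_nb hC hT
  have := card_Tri hC hT
  have := hC.card3.1
  rw [Finset.sum_sub_distrib]
  simp only [Finset.sum_const, nsmul_eq_mul]
  have h2 : ((∑ p ∈ X \ {A,B,C}, (nb T X p).card : ℕ) : ℤ) = ∑ p ∈ X \ {A,B,C}, ((nb T X p).card : ℤ) := by push_cast; rfl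
  rw [← h2]
  omega

theorem tr_bound : ∀ (n : ℕ) (X : Finset Pt), Cfg X A B C → X.card = n + 3 → (TS X).card ≤ 28 ^ n := by
  intro n
  induction n with
  | zero =>
    intro X hC hX
    have : TS X ⊆ {{s(A,B), s(B,C), s(C,A)}} := by
      intro T hT
      rw [mem_TS] at hT
      obtain ⟨e1, e2, e3⟩ := hC.hull hT
      obtain ⟨n1, n2, n3⟩ := hC.AB
      rw [Finset.mem_singleton]
      symm
      apply Finset.eq_of_subset_of_card_le
      · intro x hx; simp only [Finset.mem_insert, Finset.mem_singleton] at hx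
        rcases hx with rfl | rfl | rfl <;> assumption
      · have := card_Tri hC hT
        rw [Finset.card_eq_three.2 ⟨_, _, _, ?_, ?_, ?_, rfl⟩]
        · omega
        all_goals simp only [ne_eq, Sym2.eq_iff]; grind
    simpa using Finset.card_le_card this
  | succ n ih =>
    intro X hC hX
    have hn := hC.card3.1
    have h1 : (((X \ {A,B,C}).card : ℤ)) * (TS X).card ≤ ∑ T ∈ TS X, ∑ p ∈ X \ {A,B,C}, (7 - ((nb T X p).card : ℤ)) := by
      rw [mul_comm, ← nsmul_eq_mul]
      exact Finset.card_nsmul_le_sum _ _ _ (fun T hT => sum_int hC (mem_TS.1 hT))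
    rw [Finset.sum_comm] at h1
    have h2 : ∑ p ∈ X \ {A,B,C}, ∑ T ∈ TS X, (7 - ((nb T X p).card : ℤ)) ≤ ∑ p ∈ X \ {A,B,C}, (28 : ℤ) * 28 ^ n := by
      apply Finset.sum_le_sum
      intro p hp
      rw [Finset.mem_sdiff] at hp
      simp only [Finset.mem_insert, Finset.mem_singleton] at hp
      push Not at hp
      obtain ⟨hp, a1, a2, a3⟩ := hp
      refine (vint hC hp a1 a2 a3).trans ?_
      have := ih (X.erase p) (hC.erase a1 a2 a3) (by rw [Finset.card_erase_of_mem hp]; omega)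
      have : ((TS (X.erase p)).card : ℤ) ≤ 28 ^ n := by exact_mod_cast this
      linarith
    rw [Finset.sum_const, nsmul_eq_mul] at h2
    have hpos : (0 : ℤ) < (X \ {A,B,C}).card := by omega
    have := le_of_mul_le_mul_left (h1.trans h2) hpos
    have h3 : ((TS X).card : ℤ) ≤ 28 ^ (n+1) := by rw [pow_succ]; linarith
    exact_mod_cast h3

end TrBound
end SC
end

noncomputable section
namespace SC
section Blocked
variable {X : Finset Pt} {D T : Finset (Sym2 Pt)} {A B C : Pt}

/-- every open half plane at a vertex that meets `X` contains a neighbour -/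
def Blk (X : Finset Pt) (D : Finset (Sym2 Pt)) : Prop :=
  ∀ v ∈ X, ∀ m : ℝ × ℝ, (∃ q ∈ X, 0 < lf m v q) → ∃ u, s(v,u) ∈ D ∧ 0 < lf m v u

lemma Blk.mono {D' : Finset (Sym2 Pt)} (h : Blk X D) (hs : D ⊆ D') : Blk X D' := fun v hv m hm => by
  obtain ⟨u, h1, h2⟩ := h v hv m hm
  exact ⟨u, hs h1, h2⟩

lemma Tri.blk (hX : GP X) (hT : Tri X T) : Blk X T := fun _ hv m ⟨_, hq, hm⟩ => exists_nbr hX hT hv hq m hm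

lemma lf_o (v d q : Pt) : lf (-(d.2-v.2), d.1-v.1) v q = o v d q := by unfold lf o; ring

lemma Blk.left (h : Blk X D) {v d q : Pt} (hv : v ∈ X) (hq : q ∈ X) (hp : 0 < o v d q) : ∃ u, s(v,u) ∈ D ∧ 0 < o v d u := by
  obtain ⟨u, h1, h2⟩ := h v hv (-(d.2-v.2), d.1-v.1) ⟨q, hq, by rw [lf_o]; exact hp⟩
  exact ⟨u, h1, by rwa [lf_o] at h2⟩

lemma blk_left_ne (hX : GP X) (hT : Tri X T) {a b : Pt} (hab : s(a,b) ∈ T) (hb : Blk X (T.erase s(a,b)))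
    {d : Pt} (hd : Face X T b a d) : ∃ q ∈ X, 0 < o a b q := by
  have h1 : 0 < o a d b := by have := hd.1; rwa [← o_rot] at this
  obtain ⟨u, hu, hp⟩ := hb.left (hT.memL hab) (hT.memR hab) h1
  obtain ⟨hne, hu⟩ := Finset.mem_erase.1 hu
  refine ⟨u, hT.memR hu, ?_⟩
  by_contra hn
  have hub : u ≠ b := by rintro rfl; exact hne rfl
  have h0 := hX a (hT.memL hab) b (hT.memR hab) u (hT.memR hu) (hT.ne hab) (hT.ne hu) hub.symm
  have : o a b u < 0 := lt_of_le_of_ne (not_lt.1 hn) h0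
  exact hd.rot.angle hX hT hu hp (by rw [o_swap']; linarith)

lemma blk_conv (hX : GP X) (hT : Tri X T) {a b c d : Pt} (hab : s(a,b) ∈ T) (hb : Blk X (T.erase s(a,b)))
    (hc : Face X T a b c) (hd : Face X T b a d) : 0 < o c a d := by
  have h1 : 0 < o a d b := by have := hd.1; rwa [← o_rot] at this
  have ha := hT.memL hab
  obtain ⟨u, hu, hp⟩ := hb.left ha (hT.memR hab) h1
  obtain ⟨hne, hu⟩ := Finset.mem_erase.1 hu
  by_contra hn
  have hub : u ≠ b := by rintro rfl; exact hne rfl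
  have hcd : c ≠ d := by
    rintro rfl
    have h2 := hc.1; rw [o_swap'] at h2; linarith
  have h0 := hX a ha b (hT.memR hab) u (hT.memR hu) (hT.ne hab) (hT.ne hu) hub.symm
  have hcX := hT.memR hc.2.1
  have hca : s(c,a) ∈ T := hc.2.2.2.1
  have had : s(a,d) ∈ T := hd.2.2.1
  have hcad := hX c (hT.memL hca) a ha d (hT.memR had) (hT.ne hca) hcd (hT.ne had)
  have h2 : o a c d > 0 := by
    have : o c a d < 0 := lt_of_le_of_ne (not_lt.1 hn) hcad
    rw [o_swap]; linarith
  have h3 : 0 < o a b u := by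
    rcases lt_or_gt_of_ne h0 with h | h
    · exact absurd (hd.rot.angle hX hT hu hp (by rw [o_swap']; linarith)) id
    · exact h
  have huc : u ≠ c := by
    rintro rfl
    rw [o_swap'] at hp; linarith
  have h4 := hX a ha u (hT.memR hu) c (hT.memL hca) (hT.ne hu) (hT.ne hca).symm huc
  have h5 : 0 < o a c u := by
    rcases lt_or_gt_of_ne h4 with h | h
    · rw [o_swap']; linarith
    · exact (hc.angle hX hT hu h3 h).elim
  have key : o a d b * o a c u + o a b c * o a d u + o a c d * o a b u = 0 := by unfold o; ring
  have := mul_pos h1 h5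
  have := mul_pos hc.1 hp
  have := mul_pos h2 h3
  linarith

lemma blk_flip (hX : GP X) (hT : Tri X T) {a b : Pt} (hab : s(a,b) ∈ T) (hb : Blk X (T.erase s(a,b)))
    (hq : ∃ q ∈ X, q ≠ a ∧ q ≠ b) :
    ∃ c d, Face X T a b c ∧ Face X T b a d ∧ cr a b c d := by
  have hb' : Blk X (T.erase s(b,a)) := by rw [Sym2.eq_swap]; exact hb
  have both : (∃ q ∈ X, 0 < o a b q) ∧ (∃ q ∈ X, 0 < o b a q) := by
    obtain ⟨q, hqX, hqa, hqb⟩ := hq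
    rcases lt_or_gt_of_ne (hX a (hT.memL hab) b (hT.memR hab) q hqX (hT.ne hab) hqa.symm hqb.symm) with h | h
    · have h' : 0 < o b a q := by rw [o_swap]; linarith
      obtain ⟨d, hd⟩ := exists_face hX hT (swp hab) hqX h'
      exact ⟨blk_left_ne hX hT hab hb hd, q, hqX, h'⟩
    · obtain ⟨d, hd⟩ := exists_face hX hT hab hqX h
      exact ⟨⟨q, hqX, h⟩, blk_left_ne hX hT (swp hab) hb' hd⟩
  obtain ⟨⟨q1, hq1, p1⟩, ⟨q2, hq2, p2⟩⟩ := both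
  obtain ⟨c, hc⟩ := exists_face hX hT hab hq1 p1
  obtain ⟨d, hd⟩ := exists_face hX hT (swp hab) hq2 p2
  refine ⟨c, d, hc, hd, ?_, ?_⟩
  · have := hd.1; rw [o_swap] at this
    exact mul_neg_of_pos_of_neg hc.1 (by linarith)
  · have e1 := blk_conv hX hT hab hb hc hd
    have e2 := blk_conv hX hT (swp hab) hb' hd hc
    have e3 : o c d a = - o c a d := o_swap' _ _ _
    have e4 : o c d b = o d b c := (o_rot c d b).symm
    rw [e3, e4]
    exact mul_neg_of_neg_of_pos (by linarith) e2

/-- the number of triangulations containing `T \ F` -/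
theorem supp_bound (hC : Cfg X A B C) : ∀ (k : ℕ) (T F : Finset (Sym2 Pt)), F.card = k → Tri X T → F ⊆ T → Blk X (T \ F) →
    2 ^ k ≤ ((TS X).filter (fun T2 => T \ F ⊆ T2)).card := by
  intro k
  induction k with
  | zero =>
    intro T F hF hT _ _
    rw [pow_zero, Nat.one_le_iff_ne_zero, ← Nat.pos_iff_ne_zero, Finset.card_pos]
    exact ⟨T, Finset.mem_filter.2 ⟨mem_TS.2 hT, Finset.sdiff_subset⟩⟩
  | succ k ih =>
    intro T F hF hT hFT hb
    obtain ⟨e, F', he, rfl, hF'⟩ := Finset.card_eq_succ.1 hF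
    induction e using Sym2.ind with | _ a b =>
    have hab : s(a,b) ∈ T := hFT (Finset.mem_insert_self _ _)
    have hsub : T \ insert s(a,b) F' ⊆ T.erase s(a,b) := by
      intro x hx
      rw [Finset.mem_sdiff, Finset.mem_insert] at hx
      exact Finset.mem_erase.2 ⟨fun h => hx.2 (Or.inl h), hx.1⟩
    have hq : ∃ q ∈ X, q ≠ a ∧ q ≠ b := by
      by_contra hn
      push Not at hn
      have : X ⊆ {a,b} := fun q hq => by
        simp only [Finset.mem_insert, Finset.mem_singleton]
        by_cases h : q = a
        · exact Or.inl h
        · exact Or.inr (hn q hq h)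
      have h1 := Finset.card_le_card this
      have h2 := hC.card3.1
      have h3 := Finset.card_le_two (a := a) (b := b)
      omega
    obtain ⟨c, d, hc, hd, hcr⟩ := blk_flip hC.gp hT hab (hb.mono hsub) hq
    obtain ⟨hT2, hcd⟩ := flip_tri hC hT hc hd hcr
    have hcF : s(c,d) ∉ F' := fun h => hcd (hFT (Finset.mem_insert_of_mem h))
    have i1 := ih T F' hF' hT ((Finset.subset_insert _ _).trans hFT) (hb.mono (Finset.sdiff_subset_sdiff le_rfl (Finset.subset_insert _ _)))
    have hs1 : T \ insert s(a,b) F' ⊆ insert s(c,d) (T.erase s(a,b)) \ F' := by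
      intro x hx
      have := Finset.mem_insert_of_mem (b := s(c,d)) (hsub hx)
      rw [Finset.mem_sdiff] at hx
      exact Finset.mem_sdiff.2 ⟨this, fun h => hx.2 (Finset.mem_insert_of_mem h)⟩
    have i2 := ih (insert s(c,d) (T.erase s(a,b))) F' hF' hT2 (fun x hx => Finset.mem_insert_of_mem (Finset.mem_erase.2 ⟨fun h => he (h ▸ hx), hFT (Finset.mem_insert_of_mem hx)⟩)) (hb.mono hs1)
    rw [pow_succ, mul_two]
    refine (add_le_add i1 i2).trans ?_
    rw [← Finset.card_union_of_disjoint]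
    · apply Finset.card_le_card
      intro T2 h
      rw [Finset.mem_union, Finset.mem_filter, Finset.mem_filter] at h
      rw [Finset.mem_filter]
      rcases h with h | h
      · exact ⟨h.1, (Finset.sdiff_subset_sdiff le_rfl (Finset.subset_insert _ _)).trans h.2⟩
      · exact ⟨h.1, hs1.trans h.2⟩
    · rw [Finset.disjoint_left]
      intro T2 h1 h2
      rw [Finset.mem_filter] at h1 h2
      have m1 : s(a,b) ∈ T2 := h1.2 (Finset.mem_sdiff.2 ⟨hab, he⟩)
      have m2 : s(c,d) ∈ T2 := h2.2 (Finset.mem_sdiff.2 ⟨Finset.mem_insert_self _ _, hcF⟩)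
      exact (mem_TS.1 h1.1).ncr m1 m2 hcr

end Blocked
end SC
end

noncomputable section
namespace SC
section Sparse
variable {X : Finset Pt} {D T : Finset (Sym2 Pt)} {A B C : Pt}

def Ess (D : Finset (Sym2 Pt)) (v u : Pt) : Prop :=
  s(v,u) ∈ D ∧ ∃ m : ℝ × ℝ, 0 < lf m v u ∧ ∀ w, s(v,w) ∈ D → w ≠ u → lf m v w ≤ 0

lemma ess_cone {v b w z : Pt} (hb : Ess D v b) (hw : s(v,w) ∈ D) (hz : s(v,z) ∈ D) (h1 : 0 < o v w b) (h2 : 0 < o v b z)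
    (h3 : 0 < o v w z) : False := by
  obtain ⟨-, m, hm, ha⟩ := hb
  have e1 := ha w hw (by rintro rfl; simp at h1)
  have e2 := ha z hz (by rintro rfl; simp at h2)
  have key : o v w z * lf m v b = o v b z * lf m v w + o v w b * lf m v z := by unfold o lf; ring
  have := mul_pos h3 hm
  have := mul_nonneg h2.le (neg_nonneg.2 e1)
  have := mul_nonneg h1.le (neg_nonneg.2 e2)
  linarith

lemma Blk.right (h : Blk X D) {v d q : Pt} (hv : v ∈ X) (hq : q ∈ X) (hp : o v d q < 0) : ∃ u, s(v,u) ∈ D ∧ o v d u < 0 := by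
  have e : ∀ q, lf (d.2-v.2, -(d.1-v.1)) v q = - o v d q := fun q => by unfold lf o; ring
  obtain ⟨u, h1, h2⟩ := h v hv (d.2-v.2, -(d.1-v.1)) ⟨q, hq, by rw [e]; linarith⟩
  exact ⟨u, h1, by rw [e] at h2; linarith⟩

lemma ess_sector (hC : Cfg X A B C) (hT : Tri X T) (hD : D ⊆ T) (hB : Blk X D) {v b c z : Pt} (h1 : v ≠ A) (h2 : v ≠ B) (h3 : v ≠ C)
    (hb : Ess D v b) (hc : Ess D v c) (hz : s(v,z) ∈ D) (p1 : 0 < o v b c) (p2 : 0 < o v b z) (p3 : 0 < o v z c) : False := by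
  have hv := hT.memL (hD hz)
  have hbT := hD hb.1
  obtain ⟨q, hq, hq2⟩ := hC.left_of_int (hT.memR hbT) hv (hT.ne hbT).symm (Or.inr rfl) h1 h2 h3
  obtain ⟨w, hw, hw2⟩ := hB.right (d := b) hv hq (by rw [o_swap]; linarith)
  have n1 : ¬ 0 < o v w z := fun h => ess_cone hb hw hz (by rw [o_swap']; linarith) p2 h
  have hwz : w ≠ z := by rintro rfl; linarith
  have n0 := hC.gp v hv w (hT.memR (hD hw)) z (hT.memR (hD hz)) (hT.ne (hD hw)) (hT.ne (hD hz)) hwz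
  have n2 : 0 < o v z w := by
    have := lt_of_le_of_ne (not_lt.1 n1) n0
    rw [o_swap']; linarith
  have n3 : ¬ 0 < o v c w := fun h => ess_cone hc hz hw p3 h n2
  have key : o v b c * o v z w = o v z c * o v b w + o v b z * o v c w := by unfold o; ring
  have := mul_pos p1 n2
  have := mul_pos p3 (neg_pos.2 hw2)
  have := mul_nonneg p2.le (neg_nonneg.2 (not_lt.1 n3))
  linarith

lemma ess_three (hC : Cfg X A B C) (hT : Tri X T) (hD : D ⊆ T) (hB : Blk X D) {v b c d f : Pt} (h1 : v ≠ A) (h2 : v ≠ B) (h3 : v ≠ C)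
    (hb : Ess D v b) (hc : Ess D v c) (hd : Ess D v d) (hf : s(v,f) ∈ D) (n1 : b ≠ c) (n2 : c ≠ d) (n3 : d ≠ b)
    (m1 : f ≠ b) (m2 : f ≠ c) (m3 : f ≠ d) : False := by
  have sec : ∀ {b c z : Pt}, Ess D v b → Ess D v c → s(v,z) ∈ D → 0 < o v b c → 0 < o v b z → 0 < o v z c → False :=
    fun q1 q2 q3 p1 p2 p3 => ess_sector hC hT hD hB h1 h2 h3 q1 q2 q3 p1 p2 p3
  have sg : ∀ {x y : Pt}, s(v,x) ∈ D → s(v,y) ∈ D → x ≠ y → 0 < o v x y ∨ 0 < o v y x := by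
    intro x y hx hy hxy
    rcases lt_or_gt_of_ne (hC.gp v (hT.memL (hD hx)) x (hT.memR (hD hx)) y (hT.memR (hD hy)) (hT.ne (hD hx)) (hT.ne (hD hy)) hxy) with h | h
    · right; rw [o_swap']; linarith
    · left; exact h
  -- the cyclic case
  have cyc : ∀ {b c d : Pt}, Ess D v b → Ess D v c → Ess D v d → f ≠ b → f ≠ c → f ≠ d → 0 < o v b c → 0 < o v c d → 0 < o v d b → False := by
    intro b c d hb hc hd m1 m2 m3 p1 p2 p3
    have key : o v b c * o v d f + o v c d * o v b f + o v d b * o v c f = 0 := by unfold o; ring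
    rcases sg hb.1 hf m1.symm with q1 | q1 <;> rcases sg hc.1 hf m2.symm with q2 | q2 <;> rcases sg hd.1 hf m3.symm with q3 | q3
    · have := mul_pos p1 q3
      have := mul_pos p2 q1
      have := mul_pos p3 q2
      linarith
    · exact sec hc hd hf p2 q2 q3
    · exact sec hb hc hf p1 q1 q2
    · exact sec hb hc hf p1 q1 q2
    · exact sec hd hb hf p3 q3 q1
    · exact sec hc hd hf p2 q2 q3
    · exact sec hd hb hf p3 q3 q1
    · rw [o_swap'] at q1 q2 q3
      have := mul_pos p1 q3
      have := mul_pos p2 q1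
      have := mul_pos p3 q2
      linarith
  rcases sg hb.1 hc.1 n1 with q1 | q1 <;> rcases sg hc.1 hd.1 n2 with q2 | q2 <;> rcases sg hd.1 hb.1 n3 with q3 | q3
  · exact cyc hb hc hd m1 m2 m3 q1 q2 q3
  · exact sec hb hd hc.1 q3 q1 q2
  · exact sec hd hc hb.1 q2 q3 q1
  · exact sec hb hc hd.1 q1 q3 q2
  · exact sec hc hb hd.1 q1 q2 q3
  · exact sec hc hd hb.1 q2 q1 q3
  · exact sec hd hb hc.1 q3 q2 q1
  · exact cyc hc hb hd m2 m1 m3 q1 q3 q2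

lemma ess_hull (hX : GP X) (hB : Blk X D) (hDX : ∀ a b, s(a,b) ∈ D → b ∈ X) {a b u c : Pt} (ha : a ∈ X) (hb : b ∈ X) (hc : c ∈ X) (h : ∀ q ∈ X, 0 ≤ o a b q)
    (hu : 0 < o a b u) (huc : 0 < o a u c) (hE : Ess D a u) : False := by
  obtain ⟨w1, hw1, p1⟩ := hB.left ha hc huc
  obtain ⟨w2, hw2, p2⟩ := hB.right (d := u) ha hb (by rw [o_swap']; linarith)
  have k1 := h w1 (hDX _ _ hw1)
  have k2 := h w2 (hDX _ _ hw2)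
  have key : o a b u * o a w2 w1 = o a b w2 * o a u w1 + o a b w1 * o a w2 u := by unfold o; ring
  have p3 : 0 < o a w2 u := by rw [o_swap']; linarith
  have key2 : o a b u * o a w2 w1 ≥ 0 := by
    rw [key]; exact add_nonneg (mul_nonneg k2 p1.le) (mul_nonneg k1 p3.le)
  obtain ⟨-, m, hm, hall⟩ := hE
  have e1 := hall w1 hw1 (by rintro rfl; simp at p1)
  have e2 := hall w2 hw2 (by rintro rfl; simp at p2)
  have key3 : o a w2 w1 * lf m a u = o a u w1 * lf m a w2 + o a w2 u * lf m a w1 := by unfold o lf; ring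
  have k3 : 0 ≤ o a w2 w1 := nonneg_of_mul_nonneg_right (by linarith) hu
  have := mul_nonneg p1.le (neg_nonneg.2 e2)
  have := mul_nonneg p3.le (neg_nonneg.2 e1)
  rcases k3.lt_or_eq with k | k
  · have := mul_pos k hm; linarith
  · rw [← k, mul_zero] at key
    have a1 := mul_nonneg k2 p1.le
    have a2 := mul_nonneg k1 p3.le
    have a3 : o a b w1 * o a w2 u = 0 := by linarith
    have b1 : o a b w1 = 0 := by rcases mul_eq_zero.1 a3 with h | h; exact h; linarith
    refine hX a ha b hb w1 (hDX _ _ hw1) ?_ ?_ ?_ b1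
    · rintro rfl; simp at hu
    · rintro rfl; simp at p1
    · rintro rfl; rw [o_swap'] at p1; linarith

lemma exists_min_blk (hX : GP X) (hT : Tri X T) : ∃ D ⊆ T, Blk X D ∧ ∀ e ∈ D, ∃ p : Pt × Pt, e = s(p.1,p.2) ∧ Ess D p.1 p.2 := by
  obtain ⟨D, hD, hm⟩ := Finset.exists_min_image (T.powerset.filter (Blk X)) Finset.card ⟨T, by
    rw [Finset.mem_filter, Finset.mem_powerset]; exact ⟨le_rfl, hT.blk hX⟩⟩
  rw [Finset.mem_filter, Finset.mem_powerset] at hD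
  refine ⟨D, hD.1, hD.2, fun e he => ?_⟩
  have hn : ¬ Blk X (D.erase e) := by
    intro hb
    have := hm (D.erase e) (by rw [Finset.mem_filter, Finset.mem_powerset]; exact ⟨(Finset.erase_subset _ _).trans hD.1, hb⟩)
    rw [Finset.card_erase_of_mem he] at this
    have := Finset.card_pos.2 ⟨e, he⟩
    omega
  unfold Blk at hn
  push Not at hn
  obtain ⟨v, hv, m, hq, hall⟩ := hn
  obtain ⟨u, hu, hp⟩ := hD.2 v hv m hq
  have heq : s(v,u) = e := by
    by_contra h
    exact absurd hp (not_lt.2 (hall u (Finset.mem_erase.2 ⟨h, hu⟩)))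
  refine ⟨(v,u), heq.symm, hu, m, hp, fun w hw hne => hall w (Finset.mem_erase.2 ⟨?_, hw⟩)⟩
  rw [← heq]
  exact fun h => hne (Sym2.congr_right.1 h)

end Sparse
end SC
end

noncomputable section
namespace SC
section Sparse2
variable {X : Finset Pt} {D T : Finset (Sym2 Pt)} {A B C : Pt}

lemma card_dir (hT : Tri X T) {G : Finset (Sym2 Pt)} (hG : G ⊆ T) :
    ((X ×ˢ X).filter (fun x : Pt × Pt => s(x.1,x.2) ∈ G)).card = 2 * G.card := by
  have hmaps : ∀ x ∈ (X ×ˢ X).filter (fun x : Pt × Pt => s(x.1,x.2) ∈ G), s(x.1,x.2) ∈ G := by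
    intro x h; exact (Finset.mem_filter.1 h).2
  rw [Finset.card_eq_sum_card_fiberwise (f := fun x : Pt × Pt => s(x.1,x.2)) hmaps]
  rw [Finset.sum_const_nat (m := 2), mul_comm]
  intro e he
  induction e using Sym2.ind with
  | _ a b =>
    have ha := hT.memL (hG he)
    have hb := hT.memR (hG he)
    have : ((X ×ˢ X).filter (fun x : Pt × Pt => s(x.1,x.2) ∈ G)).filter (fun x : Pt × Pt => s(x.1,x.2) = s(a,b)) = {(a,b),(b,a)} := by
      ext ⟨x,y⟩
      simp only [Finset.mem_filter, Finset.mem_product, Finset.mem_insert, Finset.mem_singleton, Sym2.eq_iff, Prod.mk.injEq]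
      constructor
      · rintro ⟨-, h⟩; exact h
      · rintro (⟨rfl,rfl⟩ | ⟨rfl,rfl⟩)
        · exact ⟨⟨⟨ha, hb⟩, he⟩, by simp⟩
        · exact ⟨⟨⟨hb, ha⟩, swp he⟩, by simp⟩
    rw [this, Finset.card_pair]
    have := hT.ne (hG he)
    intro h; simp at h; exact this h.1

lemma sum_rot (hT : Tri X T) (f : Pt × Pt × Pt → ℕ) : ∑ t ∈ OF X T, f (t.2.1, t.2.2, t.1) = ∑ t ∈ OF X T, f t := by
  apply Finset.sum_equiv rotE
  · rintro ⟨a,b,c⟩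
    show _ ↔ (b,c,a) ∈ _
    rw [mem_OF hT, mem_OF hT]
    exact ⟨fun h => h.rot, fun h => h.rot.rot⟩
  · rintro ⟨a,b,c⟩ _; rfl

lemma face_aux {a b c p q r : Prop} [Decidable a] [Decidable b] [Decidable c] [Decidable p] [Decidable q] [Decidable r] (h1 : p → ¬ q) (h2 : q → ¬ r) (h3 : r → ¬ p) (j1 : p → ¬ a ∧ ¬ b ∧ ¬ c)
    (j2 : q → ¬ b ∧ ¬ c ∧ ¬ a) (j3 : r → ¬ c ∧ ¬ a ∧ ¬ b) :
    ((if a then 1 else 0) + (if p then 1 else 0)) + ((if b then 1 else 0) + (if q then 1 else 0)) + ((if c then 1 else 0) + (if r then 1 else 0))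
     ≤ 1 + ((if a ∧ b then 1 else 0) + (if b ∧ c then 1 else 0) + (if c ∧ a then 1 else 0)) := by
  by_cases hp : p
  · obtain ⟨n1, n2, n3⟩ := j1 hp
    have : ¬ q := h1 hp
    have : ¬ r := fun h => h3 h hp
    simp [*]
  by_cases hq : q
  · obtain ⟨n1, n2, n3⟩ := j2 hq
    have : ¬ r := h2 hq
    simp [*]
  by_cases hr : r
  · obtain ⟨n1, n2, n3⟩ := j3 hr
    simp [*]
  by_cases ha : a <;> by_cases hb : b <;> by_cases hc : c <;> simp [*]

/-- face counting -/
lemma face_count (hC : Cfg X A B C) (hT : Tri X T) (J : Finset Pt) (P : Pt × Pt × Pt → Prop)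
    (hP : ∀ a b c, P (a,b,c) → ¬ P (b,c,a)) (hPJ : ∀ a b c, P (a,b,c) → a ∉ J ∧ b ∉ J ∧ c ∉ J) :
    3 * (((OF X T).filter (fun t => t.1 ∈ J)).card + ((OF X T).filter P).card) ≤
      (OF X T).card + 3 * ((OF X T).filter (fun t => t.1 ∈ J ∧ t.2.1 ∈ J)).card := by
  simp only [Finset.card_filter]
  rw [Finset.card_eq_sum_ones]
  obtain ⟨f, hf⟩ : ∃ f : Pt × Pt × Pt → ℕ, f = fun t => (if t.1 ∈ J then 1 else 0) + (if P t then 1 else 0) := ⟨_, rfl⟩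
  obtain ⟨g, hg⟩ : ∃ g : Pt × Pt × Pt → ℕ, g = fun t => (if t.1 ∈ J ∧ t.2.1 ∈ J then 1 else 0) := ⟨_, rfl⟩
  have e1 := sum_rot hT f
  have e2 := sum_rot hT (fun t => f (t.2.1, t.2.2, t.1))
  have e3 := sum_rot hT g
  have e4 := sum_rot hT (fun t => g (t.2.1, t.2.2, t.1))
  have key : ∑ t ∈ OF X T, (f t + f (t.2.1, t.2.2, t.1) + f (t.2.2, t.1, t.2.1)) ≤
      ∑ t ∈ OF X T, (1 + (g t + g (t.2.1, t.2.2, t.1) + g (t.2.2, t.1, t.2.1))) := by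
    apply Finset.sum_le_sum
    rintro ⟨a,b,c⟩ _
    have h1 := hP a b c
    have h2 := hP b c a
    have h3 := hP c a b
    have j1 := hPJ a b c
    have j2 := hPJ b c a
    have j3 := hPJ c a b
    subst hf hg
    simp only
    exact face_aux h1 h2 h3 j1 j2 j3
  simp only [Finset.sum_add_distrib] at key
  simp only at e2 e4
  have e5 : ∑ t ∈ OF X T, f t = ∑ t ∈ OF X T, (if t.1 ∈ J then 1 else 0) + ∑ t ∈ OF X T, (if P t then 1 else 0) := by
    rw [← Finset.sum_add_distrib, hf]
  have e6 : ∑ t ∈ OF X T, g t = ∑ t ∈ OF X T, (if t.1 ∈ J ∧ t.2.1 ∈ J then 1 else 0) := by rw [hg]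
  rw [← e5, ← e6]
  omega


lemma ess_hull' (hC : Cfg X A B C) (hT : Tri X T) (hD : D ⊆ T) (hB : Blk X D) {a u : Pt} (hE : Ess D a u)
    (ha : a = A ∨ a = B ∨ a = C) : u = A ∨ u = B ∨ u = C := by
  by_contra hn
  push Not at hn
  have hu := hT.memR (hD hE.1)
  obtain ⟨i1, i2, i3⟩ := hC.ins u hu hn.1 hn.2.1 hn.2.2
  have hDX : ∀ a b, s(a,b) ∈ D → b ∈ X := fun a b h => hT.memR (hD h)
  rcases ha with rfl | rfl | rfl
  · exact ess_hull hC.gp hB hDX hC.hA hC.hB hC.hC (fun q hq => (hC.nonneg hq).1) i1 (by rw [o_rot]; exact i3) hE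
  · exact ess_hull hC.gp hB hDX hC.hB hC.hC hC.hA (fun q hq => (hC.nonneg hq).2.1) i2 (by rw [o_rot]; exact i1) hE
  · exact ess_hull hC.gp hB hDX hC.hC hC.hA hC.hB (fun q hq => (hC.nonneg hq).2.2) i3 (by rw [o_rot]; exact i2) hE

theorem exists_sparse (hC : Cfg X A B C) (hT : Tri X T) : ∃ F ⊆ T, Blk X (T \ F) ∧ X.card ≤ 2 * F.card + 4 := by
  obtain ⟨D, hD, hB, hess⟩ := exists_min_blk hC.gp hT
  have hess' : ∀ e, ∃ p : Pt × Pt, e ∈ D → e = s(p.1,p.2) ∧ Ess D p.1 p.2 := by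
    intro e
    by_cases he : e ∈ D
    · obtain ⟨p, hp⟩ := hess e he; exact ⟨p, fun _ => hp⟩
    · exact ⟨(0,0), fun h => absurd h he⟩
  choose g hg using hess'
  obtain ⟨As, hAs⟩ : ∃ As : Pt → Pt → Prop, As = fun a b => s(a,b) ∈ D ∧ g s(a,b) = (a,b) := ⟨_, rfl⟩
  have asD : ∀ {a b}, As a b → s(a,b) ∈ D := by intro a b h; rw [hAs] at h; exact h.1
  have asE : ∀ {a b}, As a b → Ess D a b := by
    intro a b h; rw [hAs] at h
    have := (hg _ h.1).2
    rw [h.2] at this; exact this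
  have asN : ∀ {a b}, As a b → ¬ As b a := by
    intro a b h h'; rw [hAs] at h h'
    have h2 := h'.2
    rw [Sym2.eq_swap, h.2] at h2
    exact hT.ne (hD h.1) (Prod.ext_iff.1 h2).1
  obtain ⟨I, hI⟩ : ∃ I : Finset Pt, I = X \ {A,B,C} := ⟨_, rfl⟩
  have memI : ∀ {v}, v ∈ I ↔ v ∈ X ∧ v ≠ A ∧ v ≠ B ∧ v ≠ C := by
    intro v; rw [hI]; simp
  obtain ⟨J, hJ⟩ : ∃ J, J = I.filter (fun v => (nb D X v).card = 3) := ⟨_, rfl⟩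
  obtain ⟨R, hR⟩ : ∃ R, R = I.filter (fun v => ¬ (nb D X v).card = 3) := ⟨_, rfl⟩
  have cJR : J.card + R.card = I.card := by rw [hJ, hR]; exact Finset.card_filter_add_card_filter_not _
  have JI : ∀ {v}, v ∈ J → v ∈ I := fun h => by rw [hJ] at h; exact (Finset.mem_filter.1 h).1
  have RI : ∀ {v}, v ∈ R → v ∈ I := fun h => by rw [hR] at h; exact (Finset.mem_filter.1 h).1
  have RJ : ∀ {v}, v ∈ R → v ∉ J := fun h h' => by
    rw [hR] at h; rw [hJ] at h'; exact (Finset.mem_filter.1 h).2 (Finset.mem_filter.1 h').2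
  obtain ⟨Q, hQ⟩ : ∃ Q, Q = R.filter (fun a => ∃ b c, b ∉ J ∧ c ∉ J ∧ As a b ∧ As a c ∧ 0 < o a b c) := ⟨_, rfl⟩
  obtain ⟨P, hP⟩ : ∃ P : Pt × Pt × Pt → Prop, P = fun t => As t.1 t.2.1 ∧ (s(t.1,t.2.2) ∈ D → As t.1 t.2.2) ∧ t.1 ∉ J ∧ t.2.1 ∉ J ∧ t.2.2 ∉ J := ⟨_, rfl⟩
  -- counting pairs
  obtain ⟨pr, hpr⟩ : ∃ pr : (Pt → Prop) → (Pt → Prop) → Finset (Sym2 Pt) → ℕ,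
    pr = fun p q G => ((X ×ˢ X).filter (fun x : Pt × Pt => p x.1 ∧ q x.2 ∧ s(x.1,x.2) ∈ G)).card := ⟨_, rfl⟩
  have prsplitG : ∀ p q, pr p q T = pr p q D + pr p q (T \ D) := by
    intro p q
    rw [hpr]
    simp only
    rw [← Finset.card_union_of_disjoint]
    · congr 1
      ext x
      simp only [Finset.mem_union, Finset.mem_filter, Finset.mem_sdiff]
      have := @hD s(x.1,x.2)
      tauto
    · rw [Finset.disjoint_left]
      intro x h1 h2
      simp only [Finset.mem_filter, Finset.mem_sdiff] at h1 h2
      tauto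
  have prsplit : ∀ p q G, pr p (fun _ => True) G = pr p q G + pr p (fun x => ¬ q x) G := by
    intro p q G
    rw [hpr]
    simp only
    rw [← Finset.card_union_of_disjoint]
    · congr 1
      ext x
      simp only [Finset.mem_union, Finset.mem_filter]
      tauto
    · rw [Finset.disjoint_left]
      intro x h1 h2
      simp only [Finset.mem_filter] at h1 h2
      tauto
  have degJ : pr (· ∈ J) (fun _ => True) D = 3 * J.card := by
    rw [hpr]
    simp only
    rw [Finset.card_filter, Finset.sum_product]
    have JX : J ⊆ X := fun v hv => (memI.1 (JI hv)).1
    rw [← Finset.sum_subset JX, mul_comm, ← smul_eq_mul, ← Finset.sum_const]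
    · apply Finset.sum_congr rfl
      intro v hv
      have : (nb D X v).card = 3 := by rw [hJ] at hv; exact (Finset.mem_filter.1 hv).2
      rw [← this, nb, Finset.card_filter]
      apply Finset.sum_congr rfl
      intro w _
      simp [hv]
    · intro v _ hv
      simp [hv]
  -- faces
  have S1 : pr (· ∈ J) (fun _ => True) T ≤ ((OF X T).filter (fun t => t.1 ∈ J)).card := by
    rw [hpr]
    refine (Finset.card_le_card (t := ((OF X T).filter (fun t => t.1 ∈ J)).image (fun t => (t.1, t.2.1))) ?_).trans Finset.card_image_le
    rintro ⟨a,b⟩ h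
    simp only [Finset.mem_filter] at h
    obtain ⟨-, haJ, -, hab⟩ := h
    have hi := memI.1 (JI haJ)
    obtain ⟨q, hq, hp⟩ := hC.left_of_int (hT.memL hab) (hT.memR hab) (hT.ne hab) (Or.inl rfl) hi.2.1 hi.2.2.1 hi.2.2.2
    obtain ⟨c, hc⟩ := exists_face hC.gp hT hab hq hp
    exact Finset.mem_image.2 ⟨(a,b,c), Finset.mem_filter.2 ⟨(mem_OF hT).2 hc, haJ⟩, rfl⟩
  have S2 : ((OF X T).filter (fun t => t.1 ∈ J ∧ t.2.1 ∈ J)).card ≤ pr (· ∈ J) (· ∈ J) T := by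
    rw [hpr]
    apply Finset.card_le_card_of_injOn (fun t : Pt × Pt × Pt => (t.1, t.2.1))
    · rintro ⟨a,b,c⟩ h
      simp only [Finset.coe_filter, Set.mem_setOf_eq] at h
      obtain ⟨h1, h2, h3⟩ := h
      rw [mem_OF hT] at h1
      simp only [Finset.coe_filter, Set.mem_setOf_eq, Finset.mem_product]
      exact ⟨⟨hT.memL h1.2.1, hT.memR h1.2.1⟩, h2, h3, h1.2.1⟩
    · rintro ⟨a,b,c⟩ h ⟨a',b',c'⟩ h' he
      simp only [Finset.coe_filter, Set.mem_setOf_eq] at h h'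
      simp only [Prod.mk.injEq] at he
      obtain ⟨rfl, rfl⟩ := he
      rw [((mem_OF hT).1 h.1).unique hC.gp hT ((mem_OF hT).1 h'.1)]
  have SQ : Q.card ≤ ((OF X T).filter P).card + pr (· ∈ J) (fun x => ¬ x ∈ J) (T \ D) := by
    have hsub : Q ⊆ ((OF X T).filter P).image (fun t : Pt × Pt × Pt => t.1) ∪
      (((X ×ˢ X).filter (fun x : Pt × Pt => x.1 ∈ J ∧ ¬ x.2 ∈ J ∧ s(x.1,x.2) ∈ T \ D)).image (fun x : Pt × Pt => x.2)) := by
      intro a ha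
      rw [hQ, Finset.mem_filter] at ha
      obtain ⟨haR, b, c, hb, hc, ab, ac, hbc⟩ := ha
      have abT := hD (asD ab)
      have hi := memI.1 (RI haR)
      obtain ⟨z, hz⟩ := exists_face hC.gp hT abT (hT.memR (hD (asD ac))) hbc
      have azT : s(a,z) ∈ T := swp hz.2.2.2.1
      have hzc : z = c ∨ 0 < o a z c := by
        by_cases h : z = c
        · exact Or.inl h
        right
        rcases lt_or_gt_of_ne (hC.gp a hi.1 z (hT.memR azT) c (hT.memR (hD (asD ac))) (hT.ne azT) (hT.ne (hD (asD ac))) h) with k | k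
        · exact (hz.angle hC.gp hT (hD (asD ac)) hbc (by rw [o_swap']; linarith)).elim
        · exact k
      have hzD : s(a,z) ∈ D → z = c := by
        intro h
        rcases hzc with k | k
        · exact k
        · exact (ess_sector hC hT hD hB hi.2.1 hi.2.2.1 hi.2.2.2 (asE ab) (asE ac) h hbc hz.1 k).elim
      rw [Finset.mem_union]
      by_cases zJ : z ∈ J
      · right
        refine Finset.mem_image.2 ⟨(z,a), Finset.mem_filter.2 ⟨Finset.mem_product.2 ⟨hT.memR azT, hi.1⟩, zJ, RJ haR, Finset.mem_sdiff.2 ⟨swp azT, ?_⟩⟩, rfl⟩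
        intro h
        rw [Sym2.eq_swap] at h
        exact hc (hzD h ▸ zJ)
      · left
        refine Finset.mem_image.2 ⟨(a,b,z), Finset.mem_filter.2 ⟨(mem_OF hT).2 hz, ?_⟩, rfl⟩
        rw [hP]
        exact ⟨ab, fun h => by rw [hzD h]; exact ac, RJ haR, hb, zJ⟩
    refine (Finset.card_le_card hsub).trans ((Finset.card_union_le _ _).trans (add_le_add Finset.card_image_le ?_))
    rw [hpr]; simp only; exact Finset.card_image_le
  have FC := face_count hC hT J P (by
      intro a b c h1 h2
      rw [hP] at h1 h2
      exact asN h1.1 (h2.2.1 (swp (asD h1.1)))) (by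
      intro a b c h; rw [hP] at h; exact h.2.2)
  -- edges of D
  obtain ⟨DJ, hDJ⟩ : ∃ DJ, DJ = D.filter (fun e => ∃ v ∈ e, v ∈ J) := ⟨_, rfl⟩
  have cDJ : 2 * DJ.card + pr (· ∈ J) (· ∈ J) D ≤ 6 * J.card := by
    rw [← card_dir hT (show DJ ⊆ T by rw [hDJ]; exact (Finset.filter_subset _ _).trans hD)]
    have symm : pr (fun _ => True) (· ∈ J) D = pr (· ∈ J) (fun _ => True) D := by
      rw [hpr]
      apply Finset.card_bij (fun x _ => (x.2, x.1))
      · rintro ⟨a,b⟩ h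
        simp only [Finset.mem_filter, Finset.mem_product] at h ⊢
        exact ⟨⟨h.1.2, h.1.1⟩, h.2.2.1, trivial, swp h.2.2.2⟩
      · rintro ⟨a,b⟩ _ ⟨c,d⟩ _ h; simp only [Prod.mk.injEq] at h ⊢; exact ⟨h.2, h.1⟩
      · rintro ⟨a,b⟩ h
        simp only [Finset.mem_filter, Finset.mem_product] at h
        refine ⟨(b,a), ?_, rfl⟩
        simp only [Finset.mem_filter, Finset.mem_product]
        exact ⟨⟨h.1.2, h.1.1⟩, trivial, h.2.1, swp h.2.2.2⟩
    have : ((X ×ˢ X).filter (fun x : Pt × Pt => s(x.1,x.2) ∈ DJ)).card + pr (· ∈ J) (· ∈ J) D = pr (· ∈ J) (fun _ => True) D + pr (fun _ => True) (· ∈ J) D := by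
      rw [hpr]
      simp only
      rw [← Finset.card_union_add_card_inter ((X ×ˢ X).filter (fun x : Pt × Pt => x.1 ∈ J ∧ True ∧ s(x.1,x.2) ∈ D))]
      congr 2
      · ext ⟨a,b⟩
        simp only [hDJ, Finset.mem_union, Finset.mem_filter, Sym2.mem_iff, exists_eq_or_imp, exists_eq_left]
        tauto
      · ext ⟨a,b⟩
        simp only [Finset.mem_inter, Finset.mem_filter]
        tauto
    omega
  obtain ⟨PP, hPP⟩ : ∃ PP, PP = (R ×ˢ X).filter (fun x : Pt × Pt => As x.1 x.2 ∧ x.2 ∉ J) := ⟨_, rfl⟩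
  have cD : D.card ≤ DJ.card + 3 + PP.card := by
    have hsub : D ⊆ DJ ∪ ({s(A,B), s(B,C), s(C,A)} : Finset (Sym2 Pt)) ∪ PP.image (fun x : Pt × Pt => s(x.1,x.2)) := by
      intro e he
      obtain ⟨e1, e2⟩ := hg e he
      obtain ⟨⟨a,b⟩, hab⟩ : ∃ p, p = g e := ⟨_, rfl⟩
      rw [← hab] at e1 e2
      simp only at e1 e2
      subst e1
      have aT := hD he
      rw [Finset.mem_union, Finset.mem_union]
      by_cases haJ : a ∈ J
      · left; left; rw [hDJ]; exact Finset.mem_filter.2 ⟨he, a, by simp, haJ⟩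
      by_cases hbJ : b ∈ J
      · left; left; rw [hDJ]; exact Finset.mem_filter.2 ⟨he, b, by simp, hbJ⟩
      by_cases hh : a = A ∨ a = B ∨ a = C
      · left; right
        have hb := ess_hull' hC hT hD hB e2 hh
        have := hT.ne aT
        simp only [Finset.mem_insert, Finset.mem_singleton, Sym2.eq_iff]
        rcases hh with rfl | rfl | rfl <;> rcases hb with rfl | rfl | rfl <;> first | exact absurd rfl this | simp
      · right
        push Not at hh
        have haR : a ∈ R := by
          have : a ∈ I := memI.2 ⟨hT.memL aT, hh⟩
          rw [hR]; refine Finset.mem_filter.2 ⟨this, fun h => haJ ?_⟩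
          rw [hJ]; exact Finset.mem_filter.2 ⟨this, h⟩
        refine Finset.mem_image.2 ⟨(a,b), ?_, rfl⟩
        rw [hPP, Finset.mem_filter, Finset.mem_product]
        refine ⟨⟨haR, hT.memR aT⟩, ?_, hbJ⟩
        rw [hAs]; exact ⟨he, hab.symm⟩
    refine (Finset.card_le_card hsub).trans ((Finset.card_union_le _ _).trans (add_le_add ((Finset.card_union_le _ _).trans (add_le_add le_rfl Finset.card_le_three)) Finset.card_image_le))
  have cPP : PP.card ≤ R.card + Q.card := by
    rw [hPP, Finset.card_filter, Finset.sum_product]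
    have : Q.card = ∑ a ∈ R, if a ∈ Q then 1 else 0 := by
      rw [← Finset.card_filter]
      congr 1
      ext a
      rw [Finset.mem_filter]
      constructor
      · intro h; refine ⟨?_, h⟩; rw [hQ] at h; exact (Finset.mem_filter.1 h).1
      · exact fun h => h.2
    rw [this, Finset.card_eq_sum_ones, ← Finset.sum_add_distrib]
    apply Finset.sum_le_sum
    intro a ha
    rw [← Finset.card_filter]
    simp only
    have hi := memI.1 (RI ha)
    by_cases haQ : a ∈ Q
    · rw [if_pos haQ]
      by_contra hn
      push Not at hn
      obtain ⟨b, hb, c, hc, d, hd, n1, n2, n3⟩ := Finset.two_lt_card.1 hn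
      rw [Finset.mem_filter] at hb hc hd
      have h3 : (nb D X a).card = 3 := by
        rw [Finset.card_eq_three]
        refine ⟨b, c, d, n1, n2, n3, ?_⟩
        ext f
        simp only [nb, Finset.mem_filter, Finset.mem_insert, Finset.mem_singleton]
        constructor
        · rintro ⟨-, hf⟩
          by_contra hne
          push Not at hne
          exact ess_three hC hT hD hB hi.2.1 hi.2.2.1 hi.2.2.2 (asE hb.2.1) (asE hc.2.1) (asE hd.2.1) hf n1 n3 n2.symm hne.1 hne.2.1 hne.2.2
        · rintro (rfl | rfl | rfl)
          · exact ⟨hb.1, asD hb.2.1⟩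
          · exact ⟨hc.1, asD hc.2.1⟩
          · exact ⟨hd.1, asD hd.2.1⟩
      rw [hR] at ha
      exact (Finset.mem_filter.1 ha).2 h3
    · rw [if_neg haQ, add_zero, Finset.card_le_one]
      intro b hb c hc
      by_contra hbc
      rw [Finset.mem_filter] at hb hc
      apply haQ
      rw [hQ, Finset.mem_filter]
      refine ⟨ha, ?_⟩
      rcases lt_or_gt_of_ne (hC.gp a hi.1 b hb.1 c hc.1 (hT.ne (hD (asD hb.2.1))) (hT.ne (hD (asD hc.2.1))) hbc) with k | k
      · exact ⟨c, b, hc.2.2, hb.2.2, hc.2.1, hb.2.1, by rw [o_swap']; linarith⟩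
      · exact ⟨b, c, hb.2.2, hc.2.2, hb.2.1, hc.2.1, k⟩
  have cQ : Q.card ≤ R.card := by rw [hQ]; exact Finset.card_filter_le _ _
  refine ⟨T \ D, Finset.sdiff_subset, by rw [Finset.sdiff_sdiff_eq_self hD]; exact hB, ?_⟩
  have t1 := Finset.card_sdiff_add_card_eq_card hD
  have t2 := card_Tri hC hT
  have t3 := card_OF hC hT
  have t4 := hC.card3.1
  rw [← hI] at t4
  have u1 := prsplitG (· ∈ J) (fun _ => True)
  have u2 := prsplitG (· ∈ J) (· ∈ J)
  have u3 := prsplit (· ∈ J) (· ∈ J) (T \ D)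
  omega

end Sparse2
end SC
end

noncomputable section
namespace SC
section
open Module

/-- normal form matrix entries -/
def J2 {n : ℕ} (d : Fin n → ℝ) (a b : Fin n × Fin 2) : ℝ :=
  if a.1 = b.1 then (if a.2 = 0 ∧ b.2 = 1 then d a.1 else if a.2 = 1 ∧ b.2 = 0 then - d a.1 else 0)
  else 0

lemma symp_normal : ∀ (n : ℕ) (V : Type) [AddCommGroup V] [Module ℝ V] [FiniteDimensional ℝ V]
    (B : LinearMap.BilinForm ℝ V), B.IsAlt → finrank ℝ V = 2 * n →
    ∃ (e : Basis (Fin n × Fin 2) ℝ V) (d : Fin n → ℝ), ∀ a b, B (e a) (e b) = J2 d a b := by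
  intro n
  induction n with
  | zero =>
    intro V _ _ _ B _ hf
    refine ⟨(finBasisOfFinrankEq ℝ V (n := 0) (by simpa using hf)).reindex (Equiv.equivOfIsEmpty _ _), fun _ => 0, ?_⟩
    rintro ⟨a, _⟩
    exact a.elim0
  | succ n ih =>
    intro V _ _ _ B hB hf
    by_cases h0 : B = 0
    · refine ⟨(finBasisOfFinrankEq ℝ V hf).reindex
        ((finCongr (by ring)).trans finProdFinEquiv.symm), fun _ => 0, ?_⟩
      intro a b
      subst h0
      simp [J2]
    · have : ∃ u v, B u v ≠ 0 := by
        by_contra hcon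
        push Not at hcon
        exact h0 (LinearMap.ext₂ hcon)
      obtain ⟨u, v, huv⟩ := this
      have hli : LinearIndependent ℝ ![u, v] := by
        rw [LinearIndependent.pair_iff]
        intro s t hst
        have h1 : B u (s • u + t • v) = 0 := by rw [hst]; simp
        have h2 : B (s • u + t • v) v = 0 := by rw [hst]; simp
        simp [hB.self_eq_zero] at h1 h2
        exact ⟨h2.resolve_right huv, h1.resolve_right huv⟩
      obtain ⟨W, hW⟩ : ∃ W, W = Submodule.span ℝ (Set.range ![u, v]) := ⟨_, rfl⟩
      have huW : u ∈ W := by rw [hW]; exact Submodule.subset_span ⟨0, rfl⟩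
      have hvW : v ∈ W := by rw [hW]; exact Submodule.subset_span ⟨1, rfl⟩
      have hdis : Disjoint W (B.orthogonal W) := by
        rw [Submodule.disjoint_def]
        intro x hx hxo
        rw [hW] at hx
        simp [Submodule.mem_span_pair] at hx
        obtain ⟨s, t, rfl⟩ := hx
        have h1 := hxo u huW
        have h2 := hxo v hvW
        simp [LinearMap.BilinForm.IsOrtho, hB.self_eq_zero] at h1 h2
        have h3 : B v u ≠ 0 := by
          have := hB.neg_eq u v
          rw [← this]; simpa using huv
        rw [h1.resolve_right huv, h2.resolve_right h3]; simp
      have hc : IsCompl W (B.orthogonal W) :=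
        (LinearMap.BilinForm.isCompl_orthogonal_iff_disjoint hB.isRefl).2 hdis
      have hfW : finrank ℝ W = 2 := by
        rw [hW, finrank_span_eq_card hli]; simp
      have hfO : finrank ℝ (B.orthogonal W) = 2 * n := by
        have := Submodule.finrank_add_eq_of_isCompl hc
        omega
      obtain ⟨e, d, he⟩ := ih (B.orthogonal W) (B.restrict _) (fun x => hB x) hfO
      subst hW
      let eW : Basis (Fin 2) ℝ (Submodule.span ℝ (Set.range ![u, v])) := Basis.span hli
      have heW : ∀ i, ((eW i : _) : V) = ![u, v] i := fun i => by
        rw [Basis.span_apply hli i]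
      let E := (eW.prod e).map (Submodule.prodEquivOfIsCompl _ _ hc)
      let g : Fin 2 ⊕ (Fin n × Fin 2) ≃ Fin (n+1) × Fin 2 :=
        { toFun := fun x => Sum.elim (fun k => (0, k)) (fun p => (p.1.succ, p.2)) x
          invFun := fun p => Fin.cases (Sum.inl p.2) (fun i => Sum.inr (i, p.2)) p.1
          left_inv := by rintro (k | ⟨i, k⟩) <;> simp
          right_inv := by
            rintro ⟨i, k⟩
            induction i using Fin.cases <;> simp }
      have hE0 : ∀ k, (E.reindex g) (0, k) = ![u, v] k := by
        intro k
        have : g.symm (0, k) = Sum.inl k := rfl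
        simp [Basis.reindex_apply, this, E, heW]
      have hES : ∀ (i : Fin n) k, (E.reindex g) (i.succ, k) = (e (i, k) : V) := by
        intro i k
        have : g.symm (i.succ, k) = Sum.inr (i, k) := rfl
        simp [Basis.reindex_apply, this, E]
      have hmem : ∀ k : Fin 2, (![u, v] k) ∈ Submodule.span ℝ (Set.range ![u, v]) :=
        fun k => Submodule.subset_span ⟨k, rfl⟩
      have hO1 : ∀ (k : Fin 2) p, B (![u, v] k) (e p) = 0 := fun k p => (e p).2 _ (hmem k)
      have hO2 : ∀ (k : Fin 2) p, B (e p) (![u, v] k) = 0 := fun k p =>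
        hB.isRefl _ _ (hO1 k p)
      refine ⟨E.reindex g, Fin.cases (B u v) d, ?_⟩
      rintro ⟨i, k⟩ ⟨j, l⟩
      induction i using Fin.cases with
      | zero =>
        induction j using Fin.cases with
        | zero =>
          rw [hE0, hE0]
          have := hB.neg_eq u v
          fin_cases k <;> fin_cases l <;> simp [J2, hB.self_eq_zero] <;> linarith
        | succ j =>
          rw [hE0, hES, hO1]
          simp [J2, (Fin.succ_ne_zero j).symm]
      | succ i =>
        induction j using Fin.cases with
        | zero =>
          rw [hE0, hES, hO2]
          simp [J2]
        | succ j =>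
          rw [hES, hES]
          have := he (i, k) (j, l)
          simp [J2] at this ⊢
          exact this
end
end SC
end

noncomputable section
namespace SC
section
open Module Equiv

def Hs (n : ℕ) : Finset (Perm (Fin n × Fin 2)) :=
  Finset.univ.filter (fun σ => ∀ i, (σ (i,0)).1 = (σ (i,1)).1)

def PF {n : ℕ} (A : Matrix (Fin n × Fin 2) (Fin n × Fin 2) ℝ) : ℝ :=
  ∑ σ : Perm (Fin n × Fin 2), ((Perm.sign σ : ℤ) : ℝ) * ∏ i : Fin n, A (σ (i,0)) (σ (i,1))

def mm {n : ℕ} {V : Type} [AddCommGroup V] [Module ℝ V] (B : LinearMap.BilinForm ℝ V) :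
    MultilinearMap ℝ (fun _ : Fin n × Fin 2 => V) ℝ where
  toFun v := ∏ i, B (v (i,0)) (v (i,1))
  map_update_add' := by
    intro dec v a x y
    obtain ⟨i, k⟩ := a
    rw [← Finset.mul_prod_erase _ _ (Finset.mem_univ i), ← Finset.mul_prod_erase _ _ (Finset.mem_univ i),
      ← Finset.mul_prod_erase _ _ (Finset.mem_univ i)]
    have key : ∀ z, ∏ j ∈ Finset.univ.erase i, B (Function.update v (i,k) z (j,0)) (Function.update v (i,k) z (j,1))
        = ∏ j ∈ Finset.univ.erase i, B (v (j,0)) (v (j,1)) := by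
      intro z
      apply Finset.prod_congr rfl
      intro j hj
      have : j ≠ i := (Finset.mem_erase.1 hj).1
      rw [Function.update_of_ne (by simp [this]), Function.update_of_ne (by simp [this])]
    rw [key, key, key, ← add_mul]
    congr 1
    fin_cases k <;> simp
  map_update_smul' := by
    intro dec v a c x
    obtain ⟨i, k⟩ := a
    rw [← Finset.mul_prod_erase _ _ (Finset.mem_univ i), ← Finset.mul_prod_erase _ _ (Finset.mem_univ i)]
    have key : ∀ z, ∏ j ∈ Finset.univ.erase i, B (Function.update v (i,k) z (j,0)) (Function.update v (i,k) z (j,1))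
        = ∏ j ∈ Finset.univ.erase i, B (v (j,0)) (v (j,1)) := by
      intro z
      apply Finset.prod_congr rfl
      intro j hj
      have : j ≠ i := (Finset.mem_erase.1 hj).1
      rw [Function.update_of_ne (by simp [this]), Function.update_of_ne (by simp [this])]
    rw [key, key, smul_eq_mul, ← mul_assoc]
    congr 1
    fin_cases k <;> simp

lemma alt_mm {n : ℕ} {V : Type} [AddCommGroup V] [Module ℝ V] (B : LinearMap.BilinForm ℝ V)
    (v : Fin n × Fin 2 → V) :
    MultilinearMap.alternatization (mm B) v = PF (fun a b => B (v a) (v b)) := by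
  rw [MultilinearMap.alternatization_apply]
  unfold PF
  apply Finset.sum_congr rfl
  intro σ _
  rw [Units.smul_def, zsmul_eq_mul]
  rfl

lemma abs_J2 {n : ℕ} (d : Fin n → ℝ) (a b : Fin n × Fin 2) : |J2 d a b| ≤ |d a.1| := by
  unfold J2
  split_ifs <;> simp

lemma PF_J2 {n : ℕ} (d : Fin n → ℝ) : |PF (J2 d)| ≤ (Hs n).card * ∏ i, |d i| := by
  unfold PF
  have h1 : ∀ σ : Perm (Fin n × Fin 2), |((Perm.sign σ : ℤ) : ℝ) * ∏ i : Fin n, J2 d (σ (i,0)) (σ (i,1))|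
      ≤ if σ ∈ Hs n then ∏ i, |d i| else 0 := by
    intro σ
    have hs : |((Perm.sign σ : ℤ) : ℝ)| = 1 := by
      rcases Int.units_eq_one_or (Perm.sign σ) with h | h <;> simp [h]
    rw [abs_mul, hs, one_mul, Finset.abs_prod]
    split_ifs with hσ
    · simp only [Hs, Finset.mem_filter, Finset.mem_univ, true_and] at hσ
      have hinj : Function.Injective (fun i => (σ (i,0)).1) := by
        intro i j hij
        by_contra hne
        simp only at hij
        -- three elements with the same first coordinate
        have e2 : ∀ a b : Fin n × Fin 2, a ≠ b → a.1 = b.1 → a.2 ≠ b.2 := by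
          intro a b h1 h2 h3; exact h1 (Prod.ext h2 h3)
        have a1 := e2 (σ (i,0)) (σ (i,1)) (by simp) (hσ i)
        have a2 := e2 (σ (j,0)) (σ (i,1)) (by simp) (by rw [← hij]; exact hσ i)
        have a3 := e2 (σ (i,0)) (σ (j,0)) (by simpa using hne) hij
        omega
      have hb : Function.Bijective (fun i => (σ (i,0)).1) := Finite.injective_iff_bijective.1 hinj
      calc _ ≤ ∏ i, |d (σ (i,0)).1| := Finset.prod_le_prod (fun _ _ => abs_nonneg _) (fun i _ => abs_J2 _ _ _)
        _ = _ := le_of_eq (Function.Bijective.prod_comp hb (fun i => |d i|)) |>.antisymm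
              (le_of_eq (Function.Bijective.prod_comp hb (fun i => |d i|)).symm)
    · simp only [Hs, Finset.mem_filter, Finset.mem_univ, true_and, not_forall] at hσ
      obtain ⟨i, hi⟩ := hσ
      rw [Finset.prod_eq_zero (Finset.mem_univ i)]
      simp [J2, hi]
  calc _ ≤ ∑ σ : Perm (Fin n × Fin 2), |((Perm.sign σ : ℤ) : ℝ) * ∏ i : Fin n, J2 d (σ (i,0)) (σ (i,1))| :=
        Finset.abs_sum_le_sum_abs _ _
    _ ≤ ∑ σ : Perm (Fin n × Fin 2), if σ ∈ Hs n then ∏ i, |d i| else 0 :=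
        Finset.sum_le_sum (fun σ _ => h1 σ)
    _ = _ := by simp

lemma det_J2 {n : ℕ} (d : Fin n → ℝ) : Matrix.det (Matrix.of (J2 d)) = (∏ i, |d i|)^2 := by
  have h : Matrix.of (J2 d) = (Matrix.blockDiagonal (fun i => !![0, d i; -d i, 0])).submatrix
      (Equiv.prodComm _ _) (Equiv.prodComm _ _) := by
    ext ⟨i, k⟩ ⟨j, l⟩
    simp only [Matrix.of_apply, J2, Matrix.submatrix_apply, Matrix.blockDiagonal_apply, Equiv.prodComm_apply,
      Prod.swap]
    split_ifs with h1 h2 h3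
    · obtain ⟨rfl, rfl⟩ := h2; simp
    · obtain ⟨rfl, rfl⟩ := h3; simp
    · fin_cases k <;> fin_cases l <;> simp_all
    · rfl
  rw [h, Matrix.det_submatrix_equiv_self, Matrix.det_blockDiagonal, ← Finset.prod_pow]
  apply Finset.prod_congr rfl
  intro i _
  rw [Matrix.det_fin_two_of, sq_abs]; ring

theorem PF_sq_le {n : ℕ} (A : Matrix (Fin n × Fin 2) (Fin n × Fin 2) ℝ)
    (hA : ∀ a b, A a b = - A b a) : (PF A)^2 ≤ (Hs n).card^2 * |A.det| := by
  obtain ⟨B, hB⟩ : ∃ B : LinearMap.BilinForm ℝ (Fin n × Fin 2 → ℝ), B = Matrix.toBilin' A := ⟨_, rfl⟩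
  have hst : ∀ a b, B (Pi.basisFun ℝ _ a) (Pi.basisFun ℝ _ b) = A a b := by
    intro a b
    rw [hB]; simp
  have halt : B.IsAlt := by
    intro x
    rw [hB, Matrix.toBilin'_apply]
    have : ∑ i, ∑ j, x i * A i j * x j = - ∑ i, ∑ j, x i * A i j * x j := by
      conv_lhs => rw [Finset.sum_comm]
      rw [← Finset.sum_neg_distrib]
      apply Finset.sum_congr rfl; intro i _
      rw [← Finset.sum_neg_distrib]
      apply Finset.sum_congr rfl; intro j _
      rw [hA j i]; ring
    linarith
  obtain ⟨e, d, he⟩ := symp_normal n _ B halt (by simp [mul_comm])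
  have h1 : PF A = MultilinearMap.alternatization (mm B) (Pi.basisFun ℝ (Fin n × Fin 2)) := by
    rw [alt_mm]; congr 1; funext a b; exact (hst a b).symm
  have h2 : MultilinearMap.alternatization (mm B) e = PF (J2 d) := by
    rw [alt_mm]; congr 1; funext a b; exact he a b
  have h3 : PF A = PF (J2 d) * e.det (Pi.basisFun ℝ (Fin n × Fin 2)) := by
    rw [h1, AlternatingMap.eq_smul_basis_det e (MultilinearMap.alternatization (mm B)), ← h2]
    simp
  have h4 : A.det = (e.det (Pi.basisFun ℝ (Fin n × Fin 2)))^2 * (∏ i, |d i|)^2 := by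
    have := LinearMap.BilinForm.toMatrix_mul_basis_toMatrix e (Pi.basisFun ℝ (Fin n × Fin 2)) B
    have hE : LinearMap.BilinForm.toMatrix e B = Matrix.of (J2 d) := by
      ext a b; rw [LinearMap.BilinForm.toMatrix_apply]; exact he a b
    have hS : LinearMap.BilinForm.toMatrix (Pi.basisFun ℝ (Fin n × Fin 2)) B = A := by
      ext a b; rw [LinearMap.BilinForm.toMatrix_apply]; exact hst a b
    rw [hE, hS] at this
    rw [← this, Matrix.det_mul, Matrix.det_mul, Matrix.det_transpose, det_J2, Basis.det_apply]
    ring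
  rw [h3, h4, abs_of_nonneg (by positivity)]
  have h5 := PF_J2 d
  have h6 : (PF (J2 d))^2 ≤ ((Hs n).card * ∏ i, |d i|)^2 := by
    rw [← sq_abs]; exact pow_le_pow_left₀ (abs_nonneg _) h5 2
  calc _ = (PF (J2 d))^2 * (e.det (Pi.basisFun ℝ (Fin n × Fin 2)))^2 := by ring
    _ ≤ ((Hs n).card * ∏ i, |d i|)^2 * (e.det (Pi.basisFun ℝ (Fin n × Fin 2)))^2 :=
        mul_le_mul_of_nonneg_right h6 (sq_nonneg _)
    _ = _ := by ring

/-- Hadamard -/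
lemma hadamard_fin {n : ℕ} (A : Matrix (Fin n) (Fin n) ℝ) : A.det^2 ≤ ∏ i, ∑ j, (A i j)^2 := by
  rcases Nat.eq_zero_or_pos n with rfl | hn
  · simp
  haveI : Nonempty (Fin n) := ⟨⟨0, hn⟩⟩
  let v : Fin n → EuclideanSpace ℝ (Fin n) := fun i => WithLp.toLp 2 (A i)
  have hf : finrank ℝ (EuclideanSpace ℝ (Fin n)) = n := by simp
  haveI : Fact (finrank ℝ (EuclideanSpace ℝ (Fin n)) = n) := ⟨hf⟩
  let b := EuclideanSpace.basisFun (Fin n) ℝ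
  let or := b.toBasis.orientation
  have h1 := or.abs_volumeForm_apply_le v
  rw [or.volumeForm_robust b rfl] at h1
  have h2 : b.toBasis.det v = A.det := by
    rw [Basis.det_apply, ← Matrix.det_transpose A]
    congr 1
  rw [h2] at h1
  have h3 : A.det^2 ≤ (∏ i, ‖v i‖)^2 := by
    rw [← sq_abs]; exact pow_le_pow_left₀ (abs_nonneg _) h1 2
  refine h3.trans (le_of_eq ?_)
  rw [← Finset.prod_pow]
  apply Finset.prod_congr rfl
  intro i _
  rw [EuclideanSpace.norm_sq_eq]
  simp [v]

lemma hadamard {ι : Type} [Fintype ι] [DecidableEq ι] (A : Matrix ι ι ℝ) : A.det^2 ≤ ∏ i, ∑ j, (A i j)^2 := by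
  have e := Fintype.equivFin ι
  have := hadamard_fin (A.submatrix e.symm e.symm)
  rw [Matrix.det_submatrix_equiv_self] at this
  refine this.trans (le_of_eq ?_)
  simp only [Matrix.submatrix_apply]
  rw [← Equiv.prod_comp e.symm (fun i => ∑ j, (A i j)^2)]
  apply Finset.prod_congr rfl; intro i _
  rw [← Equiv.sum_comp e.symm (fun j => (A (e.symm i) j)^2)]
end
end SC
end

noncomputable section
namespace SC
section

lemma pos_of_mul_pos_of_pos_left {a b : ℝ} (h : 0 < b * a) (hb : 0 < b) : 0 < a := by
  by_contra hc
  push Not at hc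
  exact absurd (mul_nonpos_of_nonneg_of_nonpos hb.le hc) (not_le.2 h)

def sg (a b : Pt) : ℝ := if a.1 < b.1 then 1 else -1
def bs (a b c : Pt) : ℝ :=
  if (a.1 < c.1 ∧ c.1 < b.1 ∧ o a b c < 0) ∨ (b.1 < c.1 ∧ c.1 < a.1 ∧ o b a c < 0) then -1 else 1

lemma bs_symm (a b c : Pt) : bs a b c = bs b a c := by
  unfold bs; simp only [or_comm]
lemma sg_anti {a b : Pt} (h : a.1 ≠ b.1) : sg a b = - sg b a := by
  unfold sg
  rcases lt_or_gt_of_ne h with h | h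
  · rw [if_pos h, if_neg (not_lt.2 h.le)]; norm_num
  · rw [if_pos h, if_neg (not_lt.2 h.le)]
lemma sg_sq (a b : Pt) : sg a b * sg a b = 1 := by
  unfold sg; split_ifs <;> norm_num
lemma bs_self_l (a b : Pt) : bs a b a = 1 := by unfold bs; simp
lemma bs_self_r (a b : Pt) : bs a b b = 1 := by unfold bs; simp

def pairOK (a b c d : Pt) : Prop :=
  bs a b c * bs a b d * (bs c d a * bs c d b) = sg a c * sg a d * (sg b c * sg b d)

lemma pair_aux {a b c d : Pt} (hab : a.1 < b.1) (hcd : c.1 < d.1) (hac : a.1 < c.1)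
    (had : a.1 ≠ d.1) (hbc : b.1 ≠ c.1) (hbd : b.1 ≠ d.1)
    (h1 : o a b c ≠ 0) (h2 : o a b d ≠ 0) (h3 : o c d a ≠ 0) (h4 : o c d b ≠ 0)
    (hn : ¬ cr a b c d) : pairOK a b c d := by
  have I1 : -(o c d b) * (b.1-a.1) = (d.1-b.1) * o a b c + (b.1-c.1) * o a b d := by unfold o; ring
  have I2 : -(o c d a) * (b.1-a.1) = (d.1-a.1) * o a b c + (a.1-c.1) * o a b d := by unfold o; ring
  have I3 : -(o a b d) * (d.1-c.1) = (b.1-d.1) * o c d a + (d.1-a.1) * o c d b := by unfold o; ring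
  have I4 : -(o a b c) * (d.1-c.1) = (b.1-c.1) * o c d a + (c.1-a.1) * o c d b := by unfold o; ring
  have had' : a.1 < d.1 := hac.trans hcd
  unfold pairOK
  have bda : bs c d a = 1 := by
    unfold bs; rw [if_neg]; rintro (h | h) <;> linarith [h.1, h.2.1]
  have s1 : sg a c = 1 := if_pos hac
  have s2 : sg a d = 1 := if_pos had'
  rcases lt_or_gt_of_ne hbc with hbc | hbc
  · have b1 : bs a b c = 1 := by
      unfold bs; rw [if_neg]; rintro (h | h) <;> linarith [h.1, h.2.1]
    have b2 : bs a b d = 1 := by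
      unfold bs; rw [if_neg]; rintro (h | h) <;> linarith [h.1, h.2.1]
    have b3 : bs c d b = 1 := by
      unfold bs; rw [if_neg]; rintro (h | h) <;> linarith [h.1, h.2.1]
    have s3 : sg b c = 1 := if_pos hbc
    have s4 : sg b d = 1 := if_pos (hbc.trans hcd)
    rw [b1, b2, b3, bda, s1, s2, s3, s4]
  · have s3 : sg b c = -1 := if_neg (not_lt.2 hbc.le)
    rcases lt_or_gt_of_ne hbd with hbd | hbd
    · -- interleaved
      have s4 : sg b d = 1 := if_pos hbd
      have b2 : bs a b d = 1 := by
        unfold bs; rw [if_neg]; rintro (h | h) <;> linarith [h.1, h.2.1]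
      have b1 : bs a b c = if o a b c < 0 then -1 else 1 := by
        unfold bs; congr 1; apply propext; constructor
        · rintro (h | h)
          · exact h.2.2
          · linarith [h.1, h.2.1]
        · intro h; exact Or.inl ⟨hac, hbc, h⟩
      have b3 : bs c d b = if o c d b < 0 then -1 else 1 := by
        unfold bs; congr 1; apply propext; constructor
        · rintro (h | h)
          · exact h.2.2
          · linarith [h.1, h.2.1]
        · intro h; exact Or.inl ⟨hbc, hbd, h⟩
      rw [b1, b2, b3, bda, s1, s2, s3, s4]
      rcases lt_or_gt_of_ne h1 with p | p <;> rcases lt_or_gt_of_ne h4 with q | q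
      · exfalso; apply hn
        have e1 : 0 < o a b d := by
          have := mul_pos (sub_pos.2 hbd) (neg_pos.2 p)
          have := mul_pos (sub_pos.2 hab) (neg_pos.2 q)
          refine pos_of_mul_pos_of_pos_left (b := b.1 - c.1) ?_ ?_ <;> linarith
        have e2 : 0 < o c d a := by
          have := mul_pos (sub_pos.2 hcd) (neg_pos.2 p)
          have := mul_pos (sub_pos.2 hac) (neg_pos.2 q)
          refine pos_of_mul_pos_of_pos_left (b := b.1 - c.1) ?_ ?_ <;> linarith
        exact ⟨mul_neg_of_neg_of_pos p e1, mul_neg_of_pos_of_neg e2 q⟩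
      · rw [if_pos p, if_neg (not_lt.2 q.le)]; norm_num
      · rw [if_pos q, if_neg (not_lt.2 p.le)]; norm_num
      · exfalso; apply hn
        have e1 : 0 < - o a b d := by
          have := mul_pos (sub_pos.2 hbd) p
          have := mul_pos (sub_pos.2 hab) q
          refine pos_of_mul_pos_of_pos_left (b := b.1 - c.1) ?_ ?_ <;> linarith
        have e2 : 0 < - o c d a := by
          have := mul_pos (sub_pos.2 hcd) p
          have := mul_pos (sub_pos.2 hac) q
          refine pos_of_mul_pos_of_pos_left (b := b.1 - c.1) ?_ ?_ <;> linarith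
        exact ⟨mul_neg_of_pos_of_neg p (by linarith), mul_neg_of_neg_of_pos (by linarith) q⟩
    · -- nested
      have s4 : sg b d = -1 := if_neg (not_lt.2 hbd.le)
      have b3 : bs c d b = 1 := by
        unfold bs; rw [if_neg]; rintro (h | h) <;> linarith [h.1, h.2.1]
      have b1 : bs a b c = if o a b c < 0 then -1 else 1 := by
        unfold bs; congr 1; apply propext; constructor
        · rintro (h | h)
          · exact h.2.2
          · linarith [h.1, h.2.1]
        · intro h; exact Or.inl ⟨hac, hbc, h⟩
      have b2 : bs a b d = if o a b d < 0 then -1 else 1 := by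
        unfold bs; congr 1; apply propext; constructor
        · rintro (h | h)
          · exact h.2.2
          · linarith [h.1, h.2.1]
        · intro h; exact Or.inl ⟨had', hbd, h⟩
      rw [b1, b2, b3, bda, s1, s2, s3, s4]
      rcases lt_or_gt_of_ne h1 with p | p <;> rcases lt_or_gt_of_ne h2 with q | q
      · rw [if_pos p, if_pos q]; norm_num
      · exfalso; apply hn
        have e1 : 0 < - o c d b := by
          have := mul_pos (sub_pos.2 hbd) (neg_pos.2 p)
          have := mul_pos (sub_pos.2 hbc) q
          refine pos_of_mul_pos_of_pos_left (b := b.1 - a.1) ?_ ?_ <;> linarith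
        have e2 : 0 < o c d a := by
          have := mul_pos (sub_pos.2 had') (neg_pos.2 p)
          have := mul_pos (sub_pos.2 hac) q
          refine pos_of_mul_pos_of_pos_left (b := b.1 - a.1) ?_ ?_ <;> linarith
        exact ⟨mul_neg_of_neg_of_pos p q, mul_neg_of_pos_of_neg e2 (by linarith)⟩
      · exfalso; apply hn
        have e1 : 0 < o c d b := by
          have := mul_pos (sub_pos.2 hbd) p
          have := mul_pos (sub_pos.2 hbc) (neg_pos.2 q)
          refine pos_of_mul_pos_of_pos_left (b := b.1 - a.1) ?_ ?_ <;> linarith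
        have e2 : 0 < - o c d a := by
          have := mul_pos (sub_pos.2 had') p
          have := mul_pos (sub_pos.2 hac) (neg_pos.2 q)
          refine pos_of_mul_pos_of_pos_left (b := b.1 - a.1) ?_ ?_ <;> linarith
        exact ⟨mul_neg_of_pos_of_neg p q, mul_neg_of_neg_of_pos (by linarith) e1⟩
      · rw [if_neg (not_lt.2 p.le), if_neg (not_lt.2 q.le)]; norm_num

lemma pairOK_swapL {a b c d : Pt} (h : pairOK b a c d) : pairOK a b c d := by
  unfold pairOK at *
  rw [bs_symm a b c, bs_symm a b d, mul_comm (bs c d a), h]; ring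
lemma pairOK_symm {a b c d : Pt} (hac : a.1 ≠ c.1) (had : a.1 ≠ d.1) (hbc : b.1 ≠ c.1) (hbd : b.1 ≠ d.1)
    (h : pairOK c d a b) : pairOK a b c d := by
  unfold pairOK at *
  rw [sg_anti hac, sg_anti had, sg_anti hbc, sg_anti hbd, mul_comm, h]; ring
lemma pairOK_swapR {a b c d : Pt} (h : pairOK a b d c) : pairOK a b c d := by
  unfold pairOK at *
  rw [bs_symm c d a, bs_symm c d b, mul_comm (bs a b c), h]; ring

lemma pair_ok {a b c d : Pt} (hab : a.1 ≠ b.1) (hcd : c.1 ≠ d.1) (hac : a.1 ≠ c.1)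
    (had : a.1 ≠ d.1) (hbc : b.1 ≠ c.1) (hbd : b.1 ≠ d.1)
    (h1 : o a b c ≠ 0) (h2 : o a b d ≠ 0) (h3 : o c d a ≠ 0) (h4 : o c d b ≠ 0)
    (hn : ¬ cr a b c d) : pairOK a b c d := by
  have sw : ∀ x y z, o x y z ≠ 0 → o y x z ≠ 0 := by
    intro x y z h; rw [o_swap]; simpa using h
  have step1 : ∀ a b c d : Pt, a.1 < b.1 → c.1 < d.1 → a.1 ≠ c.1 → a.1 ≠ d.1 → b.1 ≠ c.1 → b.1 ≠ d.1 →
      o a b c ≠ 0 → o a b d ≠ 0 → o c d a ≠ 0 → o c d b ≠ 0 → ¬ cr a b c d → pairOK a b c d := by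
    intro a b c d hab hcd hac had hbc hbd h1 h2 h3 h4 hn
    rcases lt_or_gt_of_ne hac with h | h
    · exact pair_aux hab hcd h had hbc hbd h1 h2 h3 h4 hn
    · exact pairOK_symm hac had hbc hbd
        (pair_aux hcd hab h hbc.symm had.symm hbd.symm h3 h4 h1 h2 (fun h => hn (cr_symm h)))
  rcases lt_or_gt_of_ne hab with p | p <;> rcases lt_or_gt_of_ne hcd with q | q
  · exact step1 a b c d p q hac had hbc hbd h1 h2 h3 h4 hn
  · exact pairOK_swapR (step1 a b d c p q had hac hbd hbc h2 h1 (sw _ _ _ h3) (sw _ _ _ h4) (fun h => hn (cr_swapR h)))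
  · exact pairOK_swapL (step1 b a c d p q hbc hbd hac had (sw _ _ _ h1) (sw _ _ _ h2) h4 h3 (fun h => hn (cr_swapL h)))
  · exact pairOK_swapL (pairOK_swapR (step1 b a d c p q hbd hbc had hac (sw _ _ _ h2) (sw _ _ _ h1) (sw _ _ _ h4)
      (sw _ _ _ h3) (fun h => hn (cr_swapL (cr_swapR h)))))
end
end SC
end

noncomputable section
namespace SC
section
open Equiv

lemma prod_lex {n : ℕ} (g : Fin n × Fin 2 → Fin n × Fin 2 → ℝ) :
    ∏ a : Fin (n*2), ∏ b ∈ Finset.Ioi a, g (finProdFinEquiv.symm a) (finProdFinEquiv.symm b)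
    = (∏ i, g (i,0) (i,1)) * ∏ i : Fin n, ∏ j ∈ Finset.Ioi i,
        (g (i,0) (j,0) * g (i,0) (j,1) * (g (i,1) (j,0) * g (i,1) (j,1))) := by
  have hI : ∀ (m : ℕ) (a : Fin m) (h : Fin m → ℝ), ∏ b ∈ Finset.Ioi a, h b = ∏ b, if a < b then h b else 1 := by
    intro m a h
    rw [← Finset.prod_filter]
    congr 1
    ext b; simp
  simp only [hI]
  rw [← Equiv.prod_comp finProdFinEquiv]
  have : ∀ a : Fin n × Fin 2, (∏ b : Fin (n*2), if finProdFinEquiv a < b then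
      g (finProdFinEquiv.symm (finProdFinEquiv a)) (finProdFinEquiv.symm b) else 1)
      = ∏ b : Fin n × Fin 2, if finProdFinEquiv a < finProdFinEquiv b then g a b else 1 := by
    intro a
    rw [← Equiv.prod_comp finProdFinEquiv]
    simp only [Equiv.symm_apply_apply]
  rw [Finset.prod_congr rfl (fun a _ => this a)]
  rw [Fintype.prod_prod_type]
  simp only [Fin.prod_univ_two]
  simp only [Fintype.prod_prod_type, Fin.prod_univ_two]
  rw [← Finset.prod_mul_distrib]
  apply Finset.prod_congr rfl
  intro i _
  have hd : g (i,0) (i,1) = ∏ j : Fin n, if i = j then g (i,0) (j,1) else 1 := by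
    rw [Finset.prod_ite_eq]; simp
  rw [hd, ← Finset.prod_mul_distrib, ← Finset.prod_mul_distrib]
  apply Finset.prod_congr rfl
  intro j _
  have c00 : ∀ k : Fin 2, finProdFinEquiv (i,k) < finProdFinEquiv (j,k) ↔ i < j := by
    intro k
    rw [Fin.lt_def, Fin.lt_def]; simp [finProdFinEquiv]
  have c10 : finProdFinEquiv (i,(1:Fin 2)) < finProdFinEquiv (j,(0:Fin 2)) ↔ i < j := by
    rw [Fin.lt_def, Fin.lt_def]; simp [finProdFinEquiv]; omega
  have c01 : finProdFinEquiv (i,(0:Fin 2)) < finProdFinEquiv (j,(1:Fin 2)) ↔ i ≤ j := by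
    rw [Fin.lt_def, Fin.le_def]; simp [finProdFinEquiv]; omega
  simp only [c00, c10, c01]
  rcases lt_trichotomy i j with h | h | h
  · rw [if_pos h, if_pos h.le, if_pos h, if_pos h, if_neg h.ne, if_pos h]; ring
  · subst h; simp
  · rw [if_neg h.not_gt, if_neg (not_le.2 h), if_neg h.not_gt, if_neg h.not_gt, if_neg h.ne', if_neg h.not_gt]
    norm_num

def Dp {n : ℕ} (g : Fin n × Fin 2 → Fin n × Fin 2 → ℝ) : ℝ :=
  (∏ i, g (i,0) (i,1)) * ∏ i : Fin n, ∏ j ∈ Finset.Ioi i,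
        (g (i,0) (j,0) * g (i,0) (j,1) * (g (i,1) (j,0) * g (i,1) (j,1)))

lemma Dp_perm {n : ℕ} (f : Fin n × Fin 2 → Fin n × Fin 2 → ℝ) (hf : ∀ a b, f a b = - f b a)
    (σ : Perm (Fin n × Fin 2)) :
    Dp (fun a b => f (σ a) (σ b)) = ((Perm.sign σ : ℤ) : ℝ) * Dp f := by
  unfold Dp
  rw [← prod_lex (fun a b => f (σ a) (σ b)), ← prod_lex f]
  have := Equiv.Perm.prod_Ioi_comp_eq_sign_mul_prod (finProdFinEquiv.permCongr σ)
    (f := fun a b => f (finProdFinEquiv.symm a) (finProdFinEquiv.symm b)) (fun a b => hf _ _)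
  rw [Perm.sign_permCongr] at this
  rw [← this]
  simp [Equiv.permCongr_apply]

variable {n : ℕ} (p : Fin n × Fin 2 → Pt) (w : Sym2 Pt → ℝ)

def KM : Matrix (Fin n × Fin 2) (Fin n × Fin 2) ℝ := fun a b =>
  if a = b then 0 else sg (p a) (p b) * (∏ c, bs (p a) (p b) (p c)) * w s(p a, p b)

def sgp (a b : Fin n × Fin 2) : ℝ := if a = b then 0 else sg (p a) (p b)

def vl (σ : Perm (Fin n × Fin 2)) : ℝ := ∏ i, w s(p (σ (i,0)), p (σ (i,1)))

lemma sgp_anti (hx : Function.Injective (fun a => (p a).1)) (a b) : sgp p a b = - sgp p b a := by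
  unfold sgp
  by_cases h : a = b
  · subst h; simp
  · rw [if_neg h, if_neg (Ne.symm h)]
    exact sg_anti (fun h' => h (hx h'))

lemma KM_anti (hx : Function.Injective (fun a => (p a).1)) (a b) : KM p w a b = - KM p w b a := by
  unfold KM
  by_cases h : a = b
  · subst h; simp
  · rw [if_neg h, if_neg (Ne.symm h), sg_anti (a := p a) (b := p b) (fun h' => h (hx h')), Sym2.eq_swap]
    have : ∀ c, bs (p a) (p b) (p c) = bs (p b) (p a) (p c) := fun c => bs_symm _ _ _
    simp only [this]; ring

lemma Dp_sq (g : Fin n × Fin 2 → Fin n × Fin 2 → ℝ) (hg : ∀ a b, a ≠ b → g a b * g a b = 1) : Dp g * Dp g = 1 := by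
  unfold Dp
  have h1 : (∏ i : Fin n, g (i,0) (i,1)) * (∏ i : Fin n, g (i,0) (i,1)) = 1 := by
    rw [← Finset.prod_mul_distrib]
    exact Finset.prod_eq_one (fun i _ => hg _ _ (by simp))
  rw [mul_mul_mul_comm, h1, one_mul, ← Finset.prod_mul_distrib]
  apply Finset.prod_eq_one
  intro i _
  rw [← Finset.prod_mul_distrib]
  apply Finset.prod_eq_one
  intro j hj
  have hij : i ≠ j := (Finset.mem_Ioi.1 hj).ne
  have := fun k l => hg (i,k) (j,l) (by simp [hij])
  linear_combination (g (i,0) (j,1) * g (i,0) (j,1) * (g (i,1) (j,0) * g (i,1) (j,0)) * (g (i,1) (j,1) * g (i,1) (j,1))) * this 0 0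
    + ((g (i,1) (j,0) * g (i,1) (j,0)) * (g (i,1) (j,1) * g (i,1) (j,1))) * this 0 1
    + (g (i,1) (j,1) * g (i,1) (j,1)) * this 1 0 + this 1 1

lemma sign_KM (hx : Function.Injective (fun a => (p a).1))
    (hgp : ∀ a b c, a ≠ b → a ≠ c → b ≠ c → o (p a) (p b) (p c) ≠ 0)
    (hpl : ∀ a b c d, w s(p a, p b) ≠ 0 → w s(p c, p d) ≠ 0 → ¬ cr (p a) (p b) (p c) (p d))
    (σ : Perm (Fin n × Fin 2)) :
    ((Perm.sign σ : ℤ) : ℝ) * ∏ i : Fin n, KM p w (σ (i,0)) (σ (i,1)) = Dp (sgp p) * vl p w σ := by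
  by_cases h0 : ∃ i : Fin n, w s(p (σ (i,0)), p (σ (i,1))) = 0
  · obtain ⟨i, hi⟩ := h0
    rw [Finset.prod_eq_zero (Finset.mem_univ i) (by unfold KM; rw [hi]; simp)]
    unfold vl
    rw [Finset.prod_eq_zero (Finset.mem_univ i) hi]; simp
  push Not at h0
  have hDσ := Dp_perm (sgp p) (sgp_anti p hx) σ
  have hsq : ((Perm.sign σ : ℤ) : ℝ) * ((Perm.sign σ : ℤ) : ℝ) = 1 := by
    rcases Int.units_eq_one_or (Perm.sign σ) with h | h <;> simp [h]
  have hD : Dp (sgp p) = ((Perm.sign σ : ℤ) : ℝ) * Dp (fun a b => sgp p (σ a) (σ b)) := by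
    rw [hDσ, ← mul_assoc, hsq, one_mul]
  rw [hD, mul_assoc]
  congr 1
  obtain ⟨q, hq⟩ : ∃ q : Fin n × Fin 2 → Pt, q = fun a => p (σ a) := ⟨_, rfl⟩
  have hq' : ∀ a, p (σ a) = q a := fun a => by rw [hq]
  have hne : ∀ a b : Fin n × Fin 2, a ≠ b → sgp p (σ a) (σ b) = sg (q a) (q b) := by
    intro a b h
    unfold sgp
    rw [if_neg (by simpa using h), hq', hq']
  have hK : ∀ i : Fin n, KM p w (σ (i,0)) (σ (i,1)) = sg (q (i,0)) (q (i,1)) *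
      (∏ j : Fin n, (bs (q (i,0)) (q (i,1)) (q (j,0)) * bs (q (i,0)) (q (i,1)) (q (j,1)))) *
      w s(p (σ (i,0)), p (σ (i,1))) := by
    intro i
    unfold KM
    rw [if_neg (by simp), ← Equiv.prod_comp σ, Fintype.prod_prod_type]
    simp only [Fin.prod_univ_two, hq']
  rw [Finset.prod_congr rfl (fun i _ => hK i), Finset.prod_mul_distrib]
  unfold vl
  congr 1
  rw [Finset.prod_mul_distrib]
  have hb := Finset.prod_prod_Ioi_mul_eq_prod_prod_off_diag
    (fun j i : Fin n => bs (q (i,0)) (q (i,1)) (q (j,0)) * bs (q (i,0)) (q (i,1)) (q (j,1)))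
  have hb2 : ∏ i : Fin n, (∏ j : Fin n, (bs (q (i,0)) (q (i,1)) (q (j,0)) * bs (q (i,0)) (q (i,1)) (q (j,1))))
     = ∏ i : Fin n, ∏ j ∈ {i}ᶜ, (bs (q (i,0)) (q (i,1)) (q (j,0)) * bs (q (i,0)) (q (i,1)) (q (j,1))) := by
    apply Finset.prod_congr rfl
    intro i _
    rw [Fintype.prod_eq_mul_prod_compl i, bs_self_l, bs_self_r]; simp
  rw [hb2, ← hb]
  unfold Dp
  congr 1
  · apply Finset.prod_congr rfl; intro i _; beta_reduce; rw [hne (i,0) (i,1) (by simp)]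
  · apply Finset.prod_congr rfl; intro i _
    apply Finset.prod_congr rfl; intro j hj
    have hij : i ≠ j := (Finset.mem_Ioi.1 hj).ne
    beta_reduce
    rw [hne (i,0) (j,0) (by simp [hij]), hne (i,0) (j,1) (by simp [hij]), hne (i,1) (j,0) (by simp [hij]), hne (i,1) (j,1) (by simp [hij])]
    have hxq : ∀ a b : Fin n × Fin 2, a ≠ b → (q a).1 ≠ (q b).1 := by
      intro a b h h'
      rw [hq] at h'
      exact h (σ.injective (hx h'))
    have hgq : ∀ a b c : Fin n × Fin 2, a ≠ b → a ≠ c → b ≠ c → o (q a) (q b) (q c) ≠ 0 := by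
      intro a b c h1 h2 h3
      rw [hq]
      exact hgp _ _ _ (by simpa using h1) (by simpa using h2) (by simpa using h3)
    have := pair_ok (a := q (i,0)) (b := q (i,1)) (c := q (j,0)) (d := q (j,1))
      (hxq _ _ (by simp)) (hxq _ _ (by simp)) (hxq _ _ (by simp [hij])) (hxq _ _ (by simp [hij]))
      (hxq _ _ (by simp [hij])) (hxq _ _ (by simp [hij]))
      (hgq _ _ _ (by simp) (by simp [hij]) (by simp [hij])) (hgq _ _ _ (by simp) (by simp [hij]) (by simp [hij]))
      (hgq _ _ _ (by simp) (by simp [hij.symm]) (by simp [hij.symm])) (hgq _ _ _ (by simp) (by simp [hij.symm]) (by simp [hij.symm]))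
      (by rw [← hq', ← hq', ← hq', ← hq']; exact hpl _ _ _ _ (h0 i) (h0 j))
    unfold pairOK at this
    rw [← this]

theorem kasteleyn (hx : Function.Injective (fun a => (p a).1))
    (hgp : ∀ a b c, a ≠ b → a ≠ c → b ≠ c → o (p a) (p b) (p c) ≠ 0)
    (hpl : ∀ a b c d, w s(p a, p b) ≠ 0 → w s(p c, p d) ≠ 0 → ¬ cr (p a) (p b) (p c) (p d)) :
    (∑ σ, vl p w σ)^4 ≤ (Hs n).card^4 * ∏ a, ∑ b, (if a = b then 0 else (w s(p a, p b))^2) := by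
  have h1 : PF (KM p w) = Dp (sgp p) * ∑ σ, vl p w σ := by
    unfold PF
    rw [Finset.mul_sum]
    exact Finset.sum_congr rfl (fun σ _ => sign_KM p w hx hgp hpl σ)
  have hDD : Dp (sgp p) * Dp (sgp p) = 1 := by
    apply Dp_sq
    intro a b h
    unfold sgp
    rw [if_neg h, sg_sq]
  have h2 := PF_sq_le (KM p w) (KM_anti p w hx)
  have h3 := hadamard (KM p w)
  have h4 : (PF (KM p w))^2 = (∑ σ, vl p w σ)^2 := by
    rw [h1]; linear_combination (∑ σ, vl p w σ)^2 * hDD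
  rw [h4] at h2
  have h5 : ∀ a b, (KM p w a b)^2 = if a = b then 0 else (w s(p a, p b))^2 := by
    intro a b
    unfold KM
    split_ifs with h
    · simp
    · have e1 := sg_sq (p a) (p b)
      have e2 : (∏ c, bs (p a) (p b) (p c))^2 = 1 := by
        rw [← Finset.prod_pow]
        apply Finset.prod_eq_one
        intro c _
        unfold bs; split_ifs <;> norm_num
      rw [mul_pow, mul_pow, e2, sq, e1]; ring
  simp only [h5] at h3
  calc (∑ σ, vl p w σ)^4 = ((∑ σ, vl p w σ)^2)^2 := by ring
    _ ≤ ((Hs n).card^2 * |(KM p w).det|)^2 := pow_le_pow_left₀ (sq_nonneg _) h2 2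
    _ = (Hs n).card^4 * (KM p w).det^2 := by rw [mul_pow, sq_abs]; ring
    _ ≤ _ := mul_le_mul_of_nonneg_left h3 (by positivity)
end
end SC
end

noncomputable section
namespace SC
section
open Equiv

def IsPM (U : Finset Pt) (M : Finset (Sym2 Pt)) : Prop :=
  ∃ (n : ℕ) (p : Fin n × Fin 2 → Pt), Function.Injective p ∧ Finset.univ.image p = U ∧
    M = Finset.univ.image (fun i : Fin n => s(p (i,0), p (i,1)))

lemma Hs_bij {n : ℕ} {σ : Perm (Fin n × Fin 2)} (hσ : σ ∈ Hs n) :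
    Function.Bijective (fun i => (σ (i,0)).1) := by
  simp only [Hs, Finset.mem_filter, Finset.mem_univ, true_and] at hσ
  have hinj : Function.Injective (fun i => (σ (i,0)).1) := by
    intro i j hij
    by_contra hne
    simp only at hij
    have e2 : ∀ a b : Fin n × Fin 2, a ≠ b → a.1 = b.1 → a.2 ≠ b.2 := by
      intro a b h1 h2 h3; exact h1 (Prod.ext h2 h3)
    have a1 := e2 (σ (i,0)) (σ (i,1)) (by simp) (hσ i)
    have a2 := e2 (σ (j,0)) (σ (i,1)) (by simp) (by rw [← hij]; exact hσ i)
    have a3 := e2 (σ (i,0)) (σ (j,0)) (by simpa using hne) hij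
    omega
  exact Finite.injective_iff_bijective.1 hinj

lemma Hs_edge {n : ℕ} {τ : Perm (Fin n × Fin 2)} (hτ : τ ∈ Hs n) (q : Fin n × Fin 2 → Pt) (i : Fin n) :
    s(q (τ (i,0)), q (τ (i,1))) = s(q ((τ (i,0)).1, 0), q ((τ (i,0)).1, 1)) := by
  simp only [Hs, Finset.mem_filter, Finset.mem_univ, true_and] at hτ
  have h := hτ i
  have hne : τ (i,0) ≠ τ (i,1) := by simp
  obtain ⟨a, k, e1⟩ : ∃ a k, τ (i,0) = (a,k) := ⟨_, _, rfl⟩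
  obtain ⟨b, l, e2⟩ : ∃ a k, τ (i,1) = (a,k) := ⟨_, _, rfl⟩
  rw [e1, e2] at h hne ⊢
  simp only at h
  subst h
  simp only [ne_eq, Prod.mk.injEq, true_and] at hne
  fin_cases k <;> fin_cases l
  · exact absurd rfl hne
  · rfl
  · exact Sym2.eq_swap
  · exact absurd rfl hne

lemma mat_Hs {n : ℕ} {τ : Perm (Fin n × Fin 2)} (hτ : τ ∈ Hs n) (q : Fin n × Fin 2 → Pt) :
    Finset.univ.image (fun i : Fin n => s(q (τ (i,0)), q (τ (i,1))))
      = Finset.univ.image (fun i : Fin n => s(q (i,0), q (i,1))) := by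
  simp only [Hs_edge hτ]
  have hb := Hs_bij hτ
  ext e
  simp only [Finset.mem_image, Finset.mem_univ, true_and]
  constructor
  · rintro ⟨i, hi⟩; exact ⟨_, hi⟩
  · rintro ⟨i, hi⟩
    obtain ⟨j, hj⟩ := hb.2 i
    refine ⟨j, ?_⟩
    simp only at hj
    rw [hj]; exact hi

lemma prod_mat {n : ℕ} {q : Fin n × Fin 2 → Pt} (hq : Function.Injective q) (w : Sym2 Pt → ℝ) :
    ∏ e ∈ Finset.univ.image (fun i : Fin n => s(q (i,0), q (i,1))), w e = ∏ i : Fin n, w s(q (i,0), q (i,1)) := by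
  rw [Finset.prod_image]
  intro i _ j _ hij
  simp only [Sym2.eq_iff] at hij
  rcases hij with ⟨h, _⟩ | ⟨h, _⟩
  · simpa using hq h
  · have := hq h; simp at this

lemma sum_pairs {n : ℕ} {p : Fin n × Fin 2 → Pt} (hp : Function.Injective p) (G : Finset (Sym2 Pt))
    (w : Sym2 Pt → ℝ) :
    ∑ a, ∑ b, (if a = b then 0 else ((if s(p a, p b) ∈ G then w s(p a, p b) else 0))^2) ≤ 2 * ∑ e ∈ G, (w e)^2 := by
  rw [← Fintype.sum_prod_type']
  have h1 : ∑ x : (Fin n × Fin 2) × (Fin n × Fin 2),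
      (if x.1 = x.2 then 0 else ((if s(p x.1, p x.2) ∈ G then w s(p x.1, p x.2) else 0))^2)
      ≤ ∑ x ∈ Finset.univ.filter (fun x : (Fin n × Fin 2) × (Fin n × Fin 2) => s(p x.1, p x.2) ∈ G), (w s(p x.1, p x.2))^2 := by
    rw [Finset.sum_filter]
    apply Finset.sum_le_sum
    intro x _
    split_ifs
    · positivity
    · simp
    · rfl
    · simp
  refine h1.trans ?_
  rw [← Finset.sum_fiberwise_of_maps_to (t := G) (g := fun x : (Fin n × Fin 2) × (Fin n × Fin 2) => s(p x.1, p x.2))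
    (fun x hx => (Finset.mem_filter.1 hx).2), Finset.mul_sum]
  apply Finset.sum_le_sum
  intro e he
  have hc : (Finset.filter (fun x : (Fin n × Fin 2) × (Fin n × Fin 2) => s(p x.1, p x.2) = e)
      (Finset.univ.filter (fun x : (Fin n × Fin 2) × (Fin n × Fin 2) => s(p x.1, p x.2) ∈ G))).card ≤ 2 := by
    rcases Finset.eq_empty_or_nonempty (Finset.filter (fun x : (Fin n × Fin 2) × (Fin n × Fin 2) => s(p x.1, p x.2) = e)
      (Finset.univ.filter (fun x : (Fin n × Fin 2) × (Fin n × Fin 2) => s(p x.1, p x.2) ∈ G))) with h | ⟨⟨a, b⟩, h⟩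
    · rw [h]; simp
    · have hab : s(p a, p b) = e := (Finset.mem_filter.1 h).2
      refine (Finset.card_le_card (t := {(a,b),(b,a)}) ?_).trans (Finset.card_le_two)
      rintro ⟨c, d⟩ hcd
      have hcd : s(p c, p d) = e := (Finset.mem_filter.1 hcd).2
      rw [← hab, Sym2.eq_iff] at hcd
      simp only [Finset.mem_insert, Finset.mem_singleton, Prod.mk.injEq]
      rcases hcd with ⟨h1, h2⟩ | ⟨h1, h2⟩
      · exact Or.inl ⟨hp h1, hp h2⟩
      · exact Or.inr ⟨hp h1, hp h2⟩
  calc _ = ∑ x ∈ (Finset.filter (fun x : (Fin n × Fin 2) × (Fin n × Fin 2) => s(p x.1, p x.2) = e)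
      (Finset.univ.filter (fun x : (Fin n × Fin 2) × (Fin n × Fin 2) => s(p x.1, p x.2) ∈ G))), (w e)^2 := by
        apply Finset.sum_congr rfl
        intro x hx
        rw [(Finset.mem_filter.1 hx).2]
    _ ≤ _ := by
        rw [Finset.sum_const, nsmul_eq_mul]
        apply mul_le_mul_of_nonneg_right _ (sq_nonneg _)
        exact_mod_cast hc

theorem pm_bound {U : Finset Pt} (hgp : GP U) (hx : ∀ p ∈ U, ∀ q ∈ U, p.1 = q.1 → p = q)
    (G : Finset (Sym2 Pt)) (hG : ∀ a b c d, s(a,b) ∈ G → s(c,d) ∈ G → ¬ cr a b c d)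
    (w : Sym2 Pt → ℝ) (hw : ∀ e, 0 ≤ w e) (Ms : Finset (Finset (Sym2 Pt)))
    (hM : ∀ M ∈ Ms, IsPM U M ∧ M ⊆ G) (y : ℝ) (hy : 0 < y) :
    (∑ M ∈ Ms, ∏ e ∈ M, w e)^4 ≤ (y * Real.exp (-1))^U.card * Real.exp (2 * (∑ e ∈ G, (w e)^2) / y) := by
  rcases Finset.eq_empty_or_nonempty Ms with hE | ⟨M0, hM0⟩
  · rw [hE]; simp; positivity
  obtain ⟨⟨n, p, hp, hpU, _⟩, _⟩ := hM M0 hM0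
  have hcard : U.card = n * 2 := by
    rw [← hpU, Finset.card_image_of_injective _ hp]; simp
  have hmem : ∀ a, p a ∈ U := fun a => by rw [← hpU]; simp
  have hσ : ∀ M ∈ Ms, ∃ σ : Perm (Fin n × Fin 2),
      M = Finset.univ.image (fun i : Fin n => s(p (σ (i,0)), p (σ (i,1)))) := by
    intro M h
    obtain ⟨⟨m, q, hq, hqU, hMq⟩, _⟩ := hM M h
    have : m = n := by
      have : U.card = m * 2 := by
        rw [← hqU, Finset.card_image_of_injective _ hq]; simp
      omega
    subst this
    have hex : ∀ a, ∃ b, p b = q a := by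
      intro a
      have : q a ∈ U := by rw [← hqU]; simp
      rw [← hpU] at this
      obtain ⟨b, _, hb⟩ := Finset.mem_image.1 this
      exact ⟨b, hb⟩
    choose f hf using hex
    have hfi : Function.Injective f := by
      intro a b hab
      apply hq
      rw [← hf, ← hf, hab]
    refine ⟨Equiv.ofBijective f (Finite.injective_iff_bijective.1 hfi), ?_⟩
    rw [hMq]
    simp [hf]
  choose! sM hsM using hσ
  obtain ⟨w', hw'⟩ : ∃ w' : Sym2 Pt → ℝ, w' = fun e => if e ∈ G then w e else 0 := ⟨_, rfl⟩
  have hw'0 : ∀ e, 0 ≤ w' e := by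
    intro e; rw [hw']; simp only; split_ifs
    · exact hw e
    · rfl
  have hK := kasteleyn p w' (by
      intro a b h; exact hp (hx _ (hmem a) _ (hmem b) h))
    (by
      intro a b c h1 h2 h3
      exact hgp _ (hmem a) _ (hmem b) _ (hmem c) (fun h => h1 (hp h)) (fun h => h2 (hp h)) (fun h => h3 (hp h)))
    (by
      intro a b c d h1 h2
      rw [hw'] at h1 h2
      simp only [ne_eq, ite_eq_right_iff, not_forall] at h1 h2
      exact hG _ _ _ _ h1.1 h2.1)
  have hvl : ∀ M ∈ Ms, ∀ τ ∈ Hs n, vl p w' (sM M * τ) = ∏ e ∈ M, w e := by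
    intro M h τ hτ
    have e1 := hsM M h
    have e2 := mat_Hs hτ (fun a => p (sM M a))
    have e3 : ∏ e ∈ M, w e = ∏ e ∈ M, w' e := by
      apply Finset.prod_congr rfl
      intro e he
      rw [hw']; simp only; rw [if_pos ((hM M h).2 he)]
    have e4 := prod_mat (q := fun a => p (sM M (τ a))) (fun a b hab => τ.injective ((sM M).injective (hp hab))) w'
    rw [e3]
    rw [e2, ← e1] at e4
    rw [e4]
    rfl
  have hsum : (Hs n).card * (∑ M ∈ Ms, ∏ e ∈ M, w e) ≤ ∑ σ, vl p w' σ := by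
    have h1 : (Hs n).card * (∑ M ∈ Ms, ∏ e ∈ M, w e) = ∑ x ∈ Ms ×ˢ Hs n, vl p w' (sM x.1 * x.2) := by
      rw [Finset.sum_product, Finset.mul_sum]
      apply Finset.sum_congr rfl
      intro M h
      rw [Finset.sum_congr rfl (fun τ hτ => hvl M h τ hτ)]
      simp
    rw [h1]
    have hinj : Set.InjOn (fun x : Finset (Sym2 Pt) × Perm (Fin n × Fin 2) => sM x.1 * x.2) (Ms ×ˢ Hs n : Finset _) := by
      rintro ⟨M, τ⟩ hx ⟨M', τ'⟩ hx' heq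
      simp only [Finset.coe_product, Set.mem_prod, Finset.mem_coe] at hx hx'
      simp only at heq
      have e1 := mat_Hs hx.2 (fun a => p (sM M a))
      have e2 := mat_Hs hx'.2 (fun a => p (sM M' a))
      rw [← hsM M hx.1] at e1
      rw [← hsM M' hx'.1] at e2
      have e3 : ∀ a, sM M (τ a) = sM M' (τ' a) := fun a => by
        have := congrArg (fun f => f a) heq
        simpa using this
      simp only [e3] at e1
      have : M = M' := e1.symm.trans e2
      subst this
      simpa using heq
    rw [← Finset.sum_image (f := fun σ => vl p w' σ) hinj]
    apply Finset.sum_le_univ_sum_of_nonneg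
    intro σ
    exact Finset.prod_nonneg (fun _ _ => hw'0 _)
  have hHpos : 0 < ((Hs n).card : ℝ) := by
    have : (1 : Perm (Fin n × Fin 2)) ∈ Hs n := by
      unfold Hs; rw [Finset.mem_filter]; exact ⟨Finset.mem_univ _, fun i => rfl⟩
    exact_mod_cast Finset.card_pos.2 ⟨_, this⟩
  have hZ0 : 0 ≤ ∑ M ∈ Ms, ∏ e ∈ M, w e :=
    Finset.sum_nonneg (fun M _ => Finset.prod_nonneg (fun _ _ => hw _))
  have hZ : (∑ M ∈ Ms, ∏ e ∈ M, w e)^4 ≤ ∏ a, ∑ b, (if a = b then 0 else (w' s(p a, p b))^2) := by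
    have h2 := pow_le_pow_left₀ (mul_nonneg hHpos.le hZ0) hsum 4
    have h3 := h2.trans hK
    rw [mul_pow] at h3
    exact le_of_mul_le_mul_left h3 (pow_pos hHpos 4)
  refine hZ.trans ?_
  have hr : ∀ r : ℝ, r ≤ (y * Real.exp (-1)) * Real.exp (r/y) := by
    intro r
    have := Real.add_one_le_exp (r/y + -1)
    rw [Real.exp_add] at this
    have h2 : r / y ≤ Real.exp (r/y) * Real.exp (-1) := by linarith
    rw [div_le_iff₀ hy] at h2
    linarith
  calc _ ≤ ∏ a : Fin n × Fin 2, (y * Real.exp (-1)) * Real.exp ((∑ b, (if a = b then 0 else (w' s(p a, p b))^2))/y) := by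
        apply Finset.prod_le_prod
        · intro a _; apply Finset.sum_nonneg; intro b _; split_ifs <;> positivity
        · intro a _; exact hr _
    _ = (y * Real.exp (-1))^U.card * Real.exp ((∑ a, ∑ b, (if a = b then 0 else (w' s(p a, p b))^2))/y) := by
        rw [Finset.prod_mul_distrib, ← Real.exp_sum, Finset.sum_div]
        simp [hcard]
    _ ≤ _ := by
        apply mul_le_mul_of_nonneg_left _ (by positivity)
        apply Real.exp_le_exp.2
        apply div_le_div_of_nonneg_right _ hy.le
        rw [hw']
        exact sum_pairs hp G w
end
end SC
end

noncomputable section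
namespace SC
section

lemma pm_bound2 {U : Finset Pt} (hgp : GP U) (hx : ∀ p ∈ U, ∀ q ∈ U, p.1 = q.1 → p = q)
    (G : Finset (Sym2 Pt)) (hG : ∀ a b c d, s(a,b) ∈ G → s(c,d) ∈ G → ¬ cr a b c d)
    (w : Sym2 Pt → ℝ) (hw : ∀ e, 0 ≤ w e) (Ms : Finset (Finset (Sym2 Pt)))
    (hM : ∀ M ∈ Ms, IsPM U M ∧ M ⊆ G) (y : ℝ) (hy : 5 ≤ y) (N : ℕ) (hN : U.card ≤ N) (W : ℝ)
    (hW : ∑ e ∈ G, (w e)^2 ≤ W) :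
    (∑ M ∈ Ms, ∏ e ∈ M, w e) ≤ Real.exp ((N * (Real.log y - 1) + 2 * W / y) / 4) := by
  have hy0 : 0 < y := by linarith
  have h := pm_bound hgp hx G hG w hw Ms hM y hy0
  have hZ0 : 0 ≤ ∑ M ∈ Ms, ∏ e ∈ M, w e :=
    Finset.sum_nonneg (fun M _ => Finset.prod_nonneg (fun _ _ => hw _))
  have hlog : 0 ≤ Real.log y - 1 := by
    have h1 : Real.exp 1 ≤ y := by
      have := Real.exp_one_lt_d9
      linarith
    have := (Real.le_log_iff_exp_le hy0).2 h1
    linarith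
  have hb : y * Real.exp (-1) = Real.exp (Real.log y - 1) := by
    rw [sub_eq_add_neg, Real.exp_add, Real.exp_log hy0]
  have h2 : (∑ M ∈ Ms, ∏ e ∈ M, w e)^4 ≤ (Real.exp ((N * (Real.log y - 1) + 2 * W / y) / 4))^4 := by
    rw [← Real.exp_nat_mul]
    refine h.trans ?_
    rw [hb, ← Real.exp_nat_mul, ← Real.exp_add]
    apply Real.exp_le_exp.2
    have e1 : (U.card : ℝ) * (Real.log y - 1) ≤ N * (Real.log y - 1) :=
      mul_le_mul_of_nonneg_right (by exact_mod_cast hN) hlog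
    have e2 : 2 * (∑ e ∈ G, (w e)^2) / y ≤ 2 * W / y := by
      apply div_le_div_of_nonneg_right _ hy0.le
      linarith
    push_cast
    linarith
  exact le_of_pow_le_pow_left₀ (by norm_num) (Real.exp_pos _).le h2

/-- exponent constant -/
def LL : ℝ := Real.log 7 + 1/7 + Real.log (5 + 4 * Real.exp (-(3/7)))

def w2 (F : Finset (Sym2 Pt)) (M : Finset (Sym2 Pt)) : ℝ := ∏ e ∈ M, if e ∈ F then (2:ℝ) else 1

lemma w2_eq (F M : Finset (Sym2 Pt)) (t : ℝ) : (∏ e ∈ M, if e ∈ F then t else 1) = t ^ (M ∩ F).card := by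
  rw [Finset.prod_ite, Finset.prod_const, Finset.prod_const_one, mul_one, Finset.filter_mem_eq_inter]

lemma sum_w (F G : Finset (Sym2 Pt)) (t : ℝ) :
    ∑ e ∈ G, (if e ∈ F then t else 1)^2 = G.card + (t^2 - 1) * (G ∩ F).card := by
  have : ∀ e, (if e ∈ F then t else (1:ℝ))^2 = 1 + if e ∈ F then (t^2-1) else 0 := by
    intro e; split_ifs <;> ring
  simp only [this]
  rw [Finset.sum_add_distrib, ← Finset.sum_filter, Finset.filter_mem_eq_inter]
  simp; ring

lemma PM_card {U : Finset Pt} {M : Finset (Sym2 Pt)} (h : IsPM U M) : 2 * M.card = U.card := by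
  obtain ⟨n, p, hp, rfl, rfl⟩ := h
  rw [Finset.card_image_of_injective _ hp, Finset.card_image_of_injective]
  · simp; ring
  · intro i j hij
    simp only [Sym2.eq_iff] at hij
    rcases hij with ⟨h, _⟩ | ⟨h, _⟩
    · simpa using hp h
    · have := hp h; simp at this

def A1 (T : Finset (Sym2 Pt)) (U : Finset Pt) : Finset (Finset (Sym2 Pt)) :=
  T.powerset.filter (fun M => IsPM U M)

lemma mem_A1 {T : Finset (Sym2 Pt)} {U : Finset Pt} {M} : M ∈ A1 T U ↔ M ⊆ T ∧ IsPM U M := by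
  unfold A1; rw [Finset.mem_filter, Finset.mem_powerset]

lemma two_sum {S U1 U2 : Finset Pt} (hgp : GP S) (hx : ∀ p ∈ S, ∀ q ∈ S, p.1 = q.1 → p = q)
    (hU1 : U1 ⊆ S) (hU2 : U2 ⊆ S) (hc1 : S.card ≤ U1.card + 2)
    (T F : Finset (Sym2 Pt)) (hT : ∀ a b c d, s(a,b) ∈ T → s(c,d) ∈ T → ¬ cr a b c d)
    (hTc : T.card ≤ 3 * S.card + 3) (hFT : F ⊆ T) (hF : 2 * F.card ≤ S.card) :
    ∑ M1 ∈ A1 T U1, ∑ M2 ∈ A1 (T \ M1) U2, w2 F M1 * w2 F M2 ≤ Real.exp (S.card * (LL / 4) + 2) := by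
  have gpm : ∀ U ⊆ S, GP U := fun U h a ha b hb c hc => hgp a (h ha) b (h hb) c (h hc)
  have xm : ∀ U ⊆ S, ∀ p ∈ U, ∀ q ∈ U, p.1 = q.1 → p = q := fun U h a ha b hb => hx a (h ha) b (h hb)
  have hF' : 2 * (F.card : ℝ) ≤ S.card := by exact_mod_cast hF
  have hTc' : (T.card : ℝ) ≤ 3 * S.card + 3 := by exact_mod_cast hTc
  have inner : ∀ M1 ∈ A1 T U1, ∑ M2 ∈ A1 (T \ M1) U2, w2 F M2
      ≤ Real.exp ((S.card * (Real.log 7 + 1/7) + 2)/4) * Real.exp (-(3/14)) ^ (M1 ∩ F).card := by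
    intro M1 hM1
    rw [mem_A1] at hM1
    have hcm := PM_card hM1.2
    have hcm' : (S.card : ℝ) ≤ 2 * M1.card + 2 := by
      have : S.card ≤ 2 * M1.card + 2 := by omega
      exact_mod_cast this
    have hW : ∑ e ∈ T \ M1, (if e ∈ F then (2:ℝ) else 1)^2 ≤ 4 * S.card + 4 - 3 * (M1 ∩ F).card := by
      rw [sum_w]
      have e1 : ((T \ M1).card : ℝ) = T.card - M1.card := by
        have := Finset.card_sdiff_add_card_eq_card hM1.1
        rw [← this]; push_cast; ring
      have e2 : (((T \ M1) ∩ F).card : ℝ) = F.card - (M1 ∩ F).card := by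
        have h1 : (T \ M1) ∩ F = F \ M1 := by
          ext e; simp only [Finset.mem_inter, Finset.mem_sdiff]
          constructor
          · rintro ⟨⟨_, h⟩, h'⟩; exact ⟨h', h⟩
          · rintro ⟨h', h⟩; exact ⟨⟨hFT h', h⟩, h'⟩
        have h2 := Finset.card_sdiff_add_card_inter F M1
        rw [h1, Finset.inter_comm M1 F, ← h2]; push_cast; ring
      rw [e1, e2]
      norm_num
      linarith
    have := pm_bound2 (gpm U2 hU2) (xm U2 hU2) (T \ M1)
      (fun a b c d h1 h2 => hT a b c d (Finset.sdiff_subset h1) (Finset.sdiff_subset h2))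
      (fun e => if e ∈ F then (2:ℝ) else 1) (fun e => by split_ifs <;> norm_num) (A1 (T \ M1) U2)
      (fun M hM => ⟨(mem_A1.1 hM).2, (mem_A1.1 hM).1⟩) 7 (by norm_num) S.card (Finset.card_le_card hU2) _ hW
    refine this.trans ?_
    rw [← Real.exp_nat_mul, ← Real.exp_add]
    apply Real.exp_le_exp.2
    linarith
  obtain ⟨y, hy⟩ : ∃ y, y = 5 + 4 * Real.exp (-(3/7)) := ⟨_, rfl⟩
  have hE : (Real.exp (-(3/14)))^2 = Real.exp (-(3/7)) := by
    rw [← Real.exp_nat_mul]; norm_num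
  have hy5 : 5 ≤ y := by rw [hy]; have := Real.exp_pos (-(3/7)); linarith
  have hW1 : ∑ e ∈ T, (if e ∈ F then (2 * Real.exp (-(3/14))) else 1)^2 ≤ y/2 * S.card + 3 := by
    rw [sum_w, mul_pow, hE, Finset.inter_eq_right.2 hFT]
    have h1 : (0:ℝ) ≤ 2^2 * Real.exp (-(3/7)) - 1 := by
      have := Real.add_one_le_exp (-(3/7))
      linarith
    have h2 := mul_le_mul_of_nonneg_left hF' h1
    rw [hy]
    linarith
  have outer := pm_bound2 (gpm U1 hU1) (xm U1 hU1) T hT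
      (fun e => if e ∈ F then (2 * Real.exp (-(3/14))) else 1) (fun e => by split_ifs <;> positivity) (A1 T U1)
      (fun M hM => ⟨(mem_A1.1 hM).2, (mem_A1.1 hM).1⟩) y hy5 S.card (Finset.card_le_card hU1) _ hW1
  have hy0 : 0 < y := by linarith
  calc _ = ∑ M1 ∈ A1 T U1, w2 F M1 * ∑ M2 ∈ A1 (T \ M1) U2, w2 F M2 := by
        apply Finset.sum_congr rfl; intro M _; rw [Finset.mul_sum]
    _ ≤ ∑ M1 ∈ A1 T U1, w2 F M1 * (Real.exp ((S.card * (Real.log 7 + 1/7) + 2)/4) * Real.exp (-(3/14)) ^ (M1 ∩ F).card) := by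
        apply Finset.sum_le_sum; intro M hM
        apply mul_le_mul_of_nonneg_left (inner M hM)
        exact Finset.prod_nonneg (fun e _ => by split_ifs <;> norm_num)
    _ = Real.exp ((S.card * (Real.log 7 + 1/7) + 2)/4) *
        ∑ M1 ∈ A1 T U1, ∏ e ∈ M1, (if e ∈ F then (2 * Real.exp (-(3/14))) else 1) := by
        rw [Finset.mul_sum]
        apply Finset.sum_congr rfl; intro M _
        unfold w2
        rw [w2_eq, w2_eq, mul_pow]; ring
    _ ≤ Real.exp ((S.card * (Real.log 7 + 1/7) + 2)/4) *
        Real.exp ((S.card * (Real.log y - 1) + 2 * (y/2 * S.card + 3) / y) / 4) :=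
        mul_le_mul_of_nonneg_left outer (Real.exp_pos _).le
    _ ≤ _ := by
        rw [← Real.exp_add]
        apply Real.exp_le_exp.2
        unfold LL
        rw [← hy]
        have e1 : 2 * (y/2 * S.card + 3) / y = S.card + 6 / y := by field_simp; ring
        have e2 : 6 / y ≤ 6 / 5 := by
          apply div_le_div_of_nonneg_left <;> linarith
        rw [e1]
        linarith

end
end SC
end

noncomputable section
namespace SC
section

def IsCyc (S : Finset Pt) (C : Finset (Sym2 Pt)) : Prop :=
  ∃ g : ℕ → Pt, (∀ i < S.card, ∀ j < S.card, g i = g j → i = j) ∧ (∀ i < S.card, g i ∈ S) ∧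
    C = insert s(g (S.card - 1), g 0) ((Finset.range (S.card - 1)).image (fun i => s(g i, g (i+1))))

lemma seg_PM {N : ℕ} {g : ℕ → Pt} (hg : ∀ i < N, ∀ j < N, g i = g j → i = j) (n t : ℕ) (h : 2 * n + t ≤ N) :
    ∃ U : Finset Pt, U.card = 2 * n ∧ (∀ x ∈ U, ∃ i < N, g i = x) ∧
      IsPM U ((Finset.range n).image (fun i => s(g (2*i+t), g (2*i+t+1)))) := by
  let p : Fin n × Fin 2 → Pt := fun a => g (2 * a.1 + t + a.2)
  have hp : Function.Injective p := by
    rintro ⟨i, k⟩ ⟨j, l⟩ hij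
    have := hg _ (by have := i.2; have := k.2; omega) _ (by have := j.2; have := l.2; omega) hij
    simp only at this
    have h1 := k.2
    have h2 := l.2
    ext <;> simp only <;> omega
  refine ⟨Finset.univ.image p, ?_, ?_, n, p, hp, rfl, ?_⟩
  · rw [Finset.card_image_of_injective _ hp]; simp; ring
  · intro x hx
    obtain ⟨⟨i, k⟩, _, rfl⟩ := Finset.mem_image.1 hx
    exact ⟨_, by have := i.2; have := k.2; simp only; omega, rfl⟩
  · ext e
    simp only [Finset.mem_image, Finset.mem_range, Finset.mem_univ, true_and, p]
    constructor
    · rintro ⟨i, hi, rfl⟩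
      exact ⟨⟨i, hi⟩, by simp⟩
    · rintro ⟨i, rfl⟩
      exact ⟨i, i.2, by simp⟩

lemma cyc_decomp {S : Finset Pt} {C : Finset (Sym2 Pt)} (h3 : 3 ≤ S.card) (h : IsCyc S C) :
    ∃ U1 U2 M1 M2 e, U1 ⊆ S ∧ U2 ⊆ S ∧ S.card ≤ U1.card + 2 ∧ S.card ≤ U2.card + 2 ∧
      IsPM U1 M1 ∧ IsPM U2 M2 ∧ Disjoint M1 M2 ∧ C = insert e (M1 ∪ M2) := by
  obtain ⟨g, hg, hgS, hC⟩ := h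
  obtain ⟨N, hN⟩ : ∃ N, N = S.card := ⟨_, rfl⟩
  rw [← hN] at hg hgS hC h3 ⊢
  obtain ⟨U1, c1, s1, p1⟩ := seg_PM hg (N/2) 0 (by omega)
  obtain ⟨U2, c2, s2, p2⟩ := seg_PM hg ((N-1)/2) 1 (by omega)
  refine ⟨U1, U2, _, _, s(g (N-1), g 0), ?_, ?_, by omega, by omega, p1, p2, ?_, ?_⟩
  · intro x hx; obtain ⟨i, hi, rfl⟩ := s1 x hx; exact hgS i hi
  · intro x hx; obtain ⟨i, hi, rfl⟩ := s2 x hx; exact hgS i hi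
  · rw [Finset.disjoint_left]
    intro e he1 he2
    simp only [Finset.mem_image, Finset.mem_range] at he1 he2
    obtain ⟨i, hi, rfl⟩ := he1
    obtain ⟨j, hj, hij⟩ := he2
    rw [Sym2.eq_iff] at hij
    rcases hij with ⟨a, b⟩ | ⟨a, b⟩
    · have := hg _ (by omega) _ (by omega) a; omega
    · have := hg _ (by omega) _ (by omega) a
      have := hg _ (by omega) _ (by omega) b; omega
  · rw [hC]
    congr 1
    ext e
    simp only [Finset.mem_image, Finset.mem_range, Finset.mem_union]
    constructor
    · rintro ⟨i, hi, rfl⟩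
      rcases Nat.even_or_odd' i with ⟨k, rfl | rfl⟩
      · left; exact ⟨k, by omega, rfl⟩
      · right; exact ⟨k, by omega, rfl⟩
    · rintro (⟨i, hi, rfl⟩ | ⟨i, hi, rfl⟩)
      · exact ⟨2*i, by omega, rfl⟩
      · exact ⟨2*i+1, by omega, rfl⟩

lemma sum_le_sum_choice {α β : Type*} (Cs : Finset α) (I : Finset β) (φ : β → α) (g : α → ℝ) (h : β → ℝ)
    (hh : ∀ x ∈ I, 0 ≤ h x) (H : ∀ C ∈ Cs, ∃ x ∈ I, φ x = C ∧ g C ≤ h x) : ∑ C ∈ Cs, g C ≤ ∑ x ∈ I, h x := by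
  rcases Finset.eq_empty_or_nonempty Cs with rfl | ⟨C0, hC0⟩
  · simpa using Finset.sum_nonneg hh
  haveI : Nonempty β := ⟨(H C0 hC0).choose⟩
  choose! f hf1 hf2 hf3 using H
  calc _ ≤ ∑ C ∈ Cs, h (f C) := Finset.sum_le_sum hf3
    _ = ∑ x ∈ Cs.image f, h x := by
        rw [Finset.sum_image]
        intro a ha b hb hab
        rw [← hf2 a ha, ← hf2 b hb, hab]
    _ ≤ _ := by
        apply Finset.sum_le_sum_of_subset_of_nonneg
        · intro x hx
          obtain ⟨C, hC, rfl⟩ := Finset.mem_image.1 hx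
          exact hf1 C hC
        · intro x hx _; exact hh x hx

def UU (X S : Finset Pt) : Finset (Finset Pt) := (X ×ˢ X).image (fun x : Pt × Pt => S \ {x.1, x.2})

lemma mem_UU {X S U : Finset Pt} {z : Pt} (hz : z ∈ X) (hzS : z ∉ S) (hSX : S ⊆ X) (hU : U ⊆ S)
    (hc : S.card ≤ U.card + 2) : U ∈ UU X S := by
  have h1 : (S \ U).card ≤ 2 := by
    have := Finset.card_sdiff_add_card_eq_card hU; omega
  have h2 : U = S \ (S \ U) := by rw [Finset.sdiff_sdiff_eq_self hU]
  have hD : S \ U ⊆ S := Finset.sdiff_subset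
  unfold UU
  rw [Finset.mem_image]
  have h3 : (S \ U).card = 0 ∨ (S \ U).card = 1 ∨ (S \ U).card = 2 := by omega
  rcases h3 with h | h | h
  · refine ⟨(z, z), Finset.mk_mem_product hz hz, ?_⟩
    rw [Finset.card_eq_zero] at h
    rw [h] at h2
    rw [h2]
    ext x; simp; rintro hx rfl; exact hzS hx
  · rw [Finset.card_eq_one] at h
    obtain ⟨a, ha⟩ := h
    have : a ∈ X := hSX (hD (by rw [ha]; simp))
    refine ⟨(a, a), Finset.mk_mem_product this this, ?_⟩
    rw [ha] at h2
    rw [h2]; simp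
  · rw [Finset.card_eq_two] at h
    obtain ⟨a, b, _, ha⟩ := h
    have h3 : a ∈ X := hSX (hD (by rw [ha]; simp))
    have h4 : b ∈ X := hSX (hD (by rw [ha]; simp))
    refine ⟨(a, b), Finset.mk_mem_product h3 h4, ?_⟩
    rw [ha] at h2
    rw [h2]

lemma w2_insert (F M1 M2 : Finset (Sym2 Pt)) (e : Sym2 Pt) :
    w2 F (insert e (M1 ∪ M2)) ≤ 2 * (w2 F M1 * w2 F M2) := by
  unfold w2
  rw [w2_eq, w2_eq, w2_eq]
  rw [← pow_add, ← pow_succ']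
  apply pow_le_pow_right₀ (by norm_num)
  have : (insert e (M1 ∪ M2)) ∩ F ⊆ insert e ((M1 ∩ F) ∪ (M2 ∩ F)) := by
    intro x hx
    simp only [Finset.mem_inter, Finset.mem_insert, Finset.mem_union] at hx ⊢
    tauto
  refine (Finset.card_le_card this).trans ((Finset.card_insert_le _ _).trans ?_)
  have := Finset.card_union_le (M1 ∩ F) (M2 ∩ F)
  omega

lemma cyc_sum {X S : Finset Pt} (hSX : S ⊆ X) (hXc : X.card = S.card + 3) (h3 : 3 ≤ S.card)
    (hgp : GP S) (hx : ∀ p ∈ S, ∀ q ∈ S, p.1 = q.1 → p = q)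
    (T F : Finset (Sym2 Pt)) (hT : ∀ a b c d, s(a,b) ∈ T → s(c,d) ∈ T → ¬ cr a b c d)
    (hTc : T.card ≤ 3 * S.card + 3) (hFT : F ⊆ T) (hF : 2 * F.card ≤ S.card)
    (Cs : Finset (Finset (Sym2 Pt))) (hCs : ∀ C ∈ Cs, IsCyc S C ∧ C ⊆ T) :
    ∑ C ∈ Cs, w2 F C ≤ 6 * (S.card + 3 : ℝ)^5 * Real.exp (S.card * (LL / 4) + 2) := by
  obtain ⟨z, hz, hzS⟩ : ∃ z ∈ X, z ∉ S := by
    by_contra hcon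
    push Not at hcon
    have := Finset.card_le_card (show X ⊆ S from hcon)
    omega
  let I0 := (UU X S ×ˢ UU X S ×ˢ T).filter (fun u => u.1 ⊆ S ∧ u.2.1 ⊆ S ∧ S.card ≤ u.1.card + 2)
  let I := I0.sigma (fun u => (A1 T u.1).sigma (fun M1 => A1 (T \ M1) u.2.1))
  have hnn : ∀ M, 0 ≤ w2 F M := fun M => Finset.prod_nonneg (fun e _ => by split_ifs <;> norm_num)
  have step := sum_le_sum_choice Cs I (fun x => insert x.1.2.2 (x.2.1 ∪ x.2.2)) (w2 F)
    (fun x => 2 * (w2 F x.2.1 * w2 F x.2.2))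
    (fun x _ => mul_nonneg (by norm_num) (mul_nonneg (hnn _) (hnn _))) (by
      intro C hC
      obtain ⟨hcyc, hCT⟩ := hCs C hC
      obtain ⟨U1, U2, M1, M2, e, u1, u2, c1, c2, p1, p2, hd, rfl⟩ := cyc_decomp h3 hcyc
      refine ⟨⟨(U1, U2, e), ⟨M1, M2⟩⟩, ?_, rfl, w2_insert _ _ _ _⟩
      simp only [I, I0, Finset.mem_sigma, Finset.mem_filter, Finset.mem_product, mem_A1]
      refine ⟨⟨⟨mem_UU hz hzS hSX u1 c1, mem_UU hz hzS hSX u2 c2, hCT (by simp)⟩, u1, u2, c1⟩, ⟨?_, p1⟩, ?_, p2⟩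
      · intro x hx; exact hCT (by simp [hx])
      · intro x hx
        rw [Finset.mem_sdiff]
        exact ⟨hCT (by simp [hx]), fun h => Finset.disjoint_left.1 hd h hx⟩)
  refine step.trans ?_
  rw [Finset.sum_sigma]
  have hb : ∀ u ∈ I0, ∑ x ∈ (A1 T u.1).sigma (fun M1 => A1 (T \ M1) u.2.1), 2 * (w2 F x.1 * w2 F x.2)
      ≤ 2 * Real.exp (S.card * (LL / 4) + 2) := by
    intro u hu
    simp only [I0, Finset.mem_filter] at hu
    rw [← Finset.mul_sum, Finset.sum_sigma]
    exact mul_le_mul_of_nonneg_left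
      (two_sum hgp hx hu.2.1 hu.2.2.1 hu.2.2.2 T F hT hTc hFT hF) (by norm_num)
  refine (Finset.sum_le_sum hb).trans ?_
  rw [Finset.sum_const, nsmul_eq_mul]
  have hUc : (UU X S).card ≤ (S.card + 3)^2 := by
    unfold UU
    refine Finset.card_image_le.trans ?_
    rw [Finset.card_product, hXc]; exact le_of_eq (by ring)
  have hIc : I0.card ≤ 3 * (S.card + 3)^5 := by
    refine (Finset.card_filter_le _ _).trans ?_
    rw [Finset.card_product, Finset.card_product]
    calc _ ≤ (S.card + 3)^2 * ((S.card + 3)^2 * (3 * (S.card + 3))) :=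
          Nat.mul_le_mul hUc (Nat.mul_le_mul hUc (by omega))
      _ = _ := by ring
  have hIc' : (I0.card : ℝ) ≤ 3 * (S.card + 3 : ℝ)^5 := by exact_mod_cast hIc
  have := mul_le_mul_of_nonneg_right hIc' (by positivity : 0 ≤ 2 * Real.exp (S.card * (LL / 4) + 2))
  linarith
end
end SC
end

noncomputable section
namespace SC
section
variable {X : Finset Pt} {A B C : Pt}

lemma exists_sparse' (hC : Cfg X A B C) {T : Finset (Sym2 Pt)} (hT : Tri X T) {N : ℕ} (hN : X.card = N + 3) :
    ∃ F ⊆ T, Blk X (T \ F) ∧ F.card = N / 2 := by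
  obtain ⟨F, hF, hB, hc⟩ := exists_sparse hC hT
  obtain ⟨F', hF', hc'⟩ := Finset.exists_subset_card_eq (show N / 2 ≤ F.card by omega)
  exact ⟨F', hF'.trans hF, hB.mono (Finset.sdiff_subset_sdiff le_rfl hF'), hc'⟩

lemma supp_cyc (hC : Cfg X A B C) {T F G : Finset (Sym2 Pt)} (hT : Tri X T) (hF : F ⊆ T) (hB : Blk X (T \ F)) (hG : G ⊆ T) :
    2 ^ (F \ G).card ≤ ((TS X).filter (fun T2 => G ⊆ T2)).card := by
  refine (supp_bound hC _ T (F \ G) rfl hT (Finset.sdiff_subset.trans hF)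
    (hB.mono (Finset.sdiff_subset_sdiff le_rfl Finset.sdiff_subset))).trans (Finset.card_le_card ?_)
  intro T2 h
  rw [Finset.mem_filter] at h ⊢
  refine ⟨h.1, fun e he => h.2 ?_⟩
  simp only [Finset.mem_sdiff, not_and, not_not]
  exact ⟨hG he, fun _ => he⟩

theorem total (hC : Cfg X A B C) (S : Finset Pt) (hSX : S ⊆ X) (hXc : X.card = S.card + 3) (h3 : 3 ≤ S.card)
    (Cs : Finset (Finset (Sym2 Pt))) (hCs : ∀ G ∈ Cs, IsCyc S G ∧ Plane X G) :
    (Cs.card : ℝ) ≤ 28 ^ S.card * (((2:ℝ) ^ (S.card / 2))⁻¹ * (6 * (S.card + 3 : ℝ)^5 * Real.exp (S.card * (LL/4) + 2))) := by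
  have hF0 : ∀ T : Finset (Sym2 Pt), ∃ F, Tri X T → F ⊆ T ∧ Blk X (T \ F) ∧ F.card = S.card / 2 := by
    intro T
    by_cases hT : Tri X T
    · obtain ⟨F, h⟩ := exists_sparse' hC hT hXc
      exact ⟨F, fun _ => h⟩
    · exact ⟨∅, fun h => absurd h hT⟩
  choose F hF using hF0
  let sup : Finset (Sym2 Pt) → ℝ := fun G => (((TS X).filter (fun T2 => G ⊆ T2)).card : ℝ)
  have e1 : (Cs.card : ℝ) = ∑ G ∈ Cs, ∑ T ∈ (TS X).filter (fun T2 => G ⊆ T2), (sup G)⁻¹ := by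
    rw [Finset.card_eq_sum_ones]
    push_cast
    refine Finset.sum_congr rfl fun G hG => ?_
    rw [Finset.sum_const, nsmul_eq_mul]
    obtain ⟨T, hT, hGT⟩ := (hCs G hG).2.extend
    have : 0 < ((TS X).filter (fun T2 => G ⊆ T2)).card :=
      Finset.card_pos.2 ⟨T, Finset.mem_filter.2 ⟨mem_TS.2 hT, hGT⟩⟩
    refine (mul_inv_cancel₀ ?_).symm
    exact_mod_cast this.ne'
  have e2 : ∑ G ∈ Cs, ∑ T ∈ (TS X).filter (fun T2 => G ⊆ T2), (sup G)⁻¹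
      = ∑ T ∈ TS X, ∑ G ∈ Cs.filter (fun G => G ⊆ T), (sup G)⁻¹ := by
    simp only [Finset.sum_filter]
    exact Finset.sum_comm
  rw [e1, e2]
  have e3 : ∀ T ∈ TS X, ∑ G ∈ Cs.filter (fun G => G ⊆ T), (sup G)⁻¹ ≤
      ((2:ℝ) ^ (S.card / 2))⁻¹ * (6 * (S.card + 3 : ℝ)^5 * Real.exp (S.card * (LL/4) + 2)) := by
    intro T hT
    rw [mem_TS] at hT
    obtain ⟨f1, f2, f3⟩ := hF T hT
    have key : ∑ G ∈ Cs.filter (fun G => G ⊆ T), w2 (F T) G ≤ 6 * (S.card + 3 : ℝ)^5 * Real.exp (S.card * (LL/4) + 2) := by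
      refine cyc_sum hSX hXc h3 (fun a ha b hb c hc => hC.gp a (hSX ha) b (hSX hb) c (hSX hc))
        (fun p hp q hq => hC.xinj p (hSX hp) q (hSX hq)) T (F T) (fun a b c d hab hcd => (hT.plane a b hab).2.2.2 c d hcd)
        (by have := card_Tri hC hT; omega) f1 (by omega) _ ?_
      intro G hG
      rw [Finset.mem_filter] at hG
      exact ⟨(hCs G hG.1).1, hG.2⟩
    refine le_trans ?_ (mul_le_mul_of_nonneg_left key (by positivity))
    rw [Finset.mul_sum]
    refine Finset.sum_le_sum fun G hG => ?_
    rw [Finset.mem_filter] at hG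
    have h1 : (2:ℝ) ^ (F T \ G).card ≤ sup G := by
      have := supp_cyc hC hT f1 f2 hG.2
      simp only [sup]
      exact_mod_cast this
    have h2 : (F T \ G).card + (G ∩ F T).card = S.card / 2 := by
      rw [← f3, Finset.inter_comm]; exact Finset.card_sdiff_add_card_inter _ _
    unfold w2
    rw [w2_eq, ← h2, pow_add, mul_inv, mul_assoc, inv_mul_cancel₀ (by positivity), mul_one]
    exact inv_anti₀ (by positivity) h1
  refine (Finset.sum_le_sum e3).trans ?_
  rw [Finset.sum_const, nsmul_eq_mul]
  refine mul_le_mul_of_nonneg_right ?_ (by positivity)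
  exact_mod_cast tr_bound _ X hC hXc
end
end SC
end

noncomputable section
namespace SC
section

lemma exp_LL : Real.exp LL ≤ 62 := by
  have h4 : 0 < 5 + 4 * Real.exp (-(3/7)) := by positivity
  have e : Real.exp LL = 7 * Real.exp (1/7) * (5 + 4 * Real.exp (-(3/7))) := by
    unfold LL
    rw [Real.exp_add, Real.exp_add, Real.exp_log (by norm_num), Real.exp_log h4]
  have h1 : Real.exp (1/7) ≤ 1.154 := by
    refine le_of_pow_le_pow_left₀ (n := 7) (by norm_num) (by norm_num) ?_
    rw [← Real.exp_nat_mul]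
    norm_num
    have := Real.exp_one_lt_d9
    linarith
  have h2 : Real.exp (-(3/7)) ≤ 0.66 := by
    refine le_of_pow_le_pow_left₀ (n := 7) (by norm_num) (by norm_num) ?_
    rw [← Real.exp_nat_mul]
    have h3 : Real.exp 3 = Real.exp 1 ^ 3 := by rw [← Real.exp_nat_mul]; norm_num
    have h5 : Real.exp (((7:ℕ):ℝ) * (-(3/7))) = (Real.exp 1 ^ 3)⁻¹ := by
      rw [← h3, ← Real.exp_neg]; norm_num
    rw [h5]
    have h6 : (2.718 : ℝ) ^ 3 ≤ Real.exp 1 ^ 3 := by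
      have := Real.exp_one_gt_d9
      exact pow_le_pow_left₀ (by norm_num) (by linarith) 3
    refine (inv_anti₀ (by norm_num) h6).trans ?_
    norm_num
  rw [e]
  have h5 : 5 + 4 * Real.exp (-(3/7)) ≤ 7.64 := by linarith
  calc 7 * Real.exp (1/7) * (5 + 4 * Real.exp (-(3/7))) ≤ 7 * 1.154 * 7.64 := by gcongr
    _ ≤ 62 := by norm_num

lemma numerics : ∃ c : ℝ, 0 < c ∧ ∀ N : ℕ,
    28 ^ N * (((2:ℝ) ^ (N / 2))⁻¹ * (6 * (N + 3 : ℝ)^5 * Real.exp (N * (LL/4) + 2))) ≤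
      c * (30 * (12 : ℝ) ^ ((1 : ℝ) / 4)) ^ N := by
  obtain ⟨B, hB⟩ : ∃ B : ℝ, B = 30 * (12 : ℝ) ^ ((1 : ℝ) / 4) := ⟨_, rfl⟩
  have hB0 : 0 < B := by rw [hB]; positivity
  have hB4 : B ^ 4 = 30 ^ 4 * 12 := by
    rw [hB, mul_pow, ← Real.rpow_natCast ((12:ℝ) ^ _), ← Real.rpow_mul (by norm_num)]
    norm_num
  rw [← hB]
  obtain ⟨s, hs⟩ : ∃ s : ℝ, s = Real.sqrt 2 := ⟨_, rfl⟩
  have hs2 : s ^ 2 = 2 := by rw [hs]; exact Real.sq_sqrt (by norm_num)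
  have hs0 : 0 < s := by rw [hs]; positivity
  have hs1 : 1 ≤ s := by rw [hs]; exact Real.one_le_sqrt.2 (by norm_num)
  obtain ⟨E, hE⟩ : ∃ E : ℝ, E = Real.exp (LL/4) := ⟨_, rfl⟩
  have hE0 : 0 < E := by rw [hE]; positivity
  have hE4 : E ^ 4 ≤ 62 := by
    rw [hE, ← Real.exp_nat_mul]
    convert exp_LL using 2
    push_cast; ring
  obtain ⟨q, hq⟩ : ∃ q, q = 28 * E / s / B := ⟨_, rfl⟩
  have hq0 : 0 < q := by rw [hq]; positivity
  have hq1 : q < 1 := by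
    rw [hq, div_lt_one hB0]
    refine lt_of_pow_lt_pow_left₀ 4 hB0.le ?_
    rw [hB4, div_pow, mul_pow, show s ^ 4 = (s^2)^2 by ring, hs2, div_lt_iff₀ (by norm_num)]
    linarith
  have ht := tendsto_pow_const_mul_const_pow_of_abs_lt_one 5 (show |q| < 1 by rw [abs_of_pos hq0]; exact hq1)
  obtain ⟨M, hM⟩ := ht.bddAbove_range
  have hM' : ∀ n : ℕ, (n:ℝ)^5 * q ^ n ≤ M := fun n => hM ⟨n, rfl⟩
  have hM0 : 0 < M := by
    have := hM' 1
    have : ((1:ℕ):ℝ)^5 * q^1 = q := by simp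
    linarith
  refine ⟨6 * s * Real.exp 2 * (M / q^3), by positivity, fun N => ?_⟩
  have h1 : ((2:ℝ) ^ (N / 2))⁻¹ ≤ s / s ^ N := by
    rw [← hs2, ← pow_mul, inv_le_comm₀ (by positivity) (by positivity), inv_div, div_le_iff₀ hs0, ← pow_succ]
    exact pow_le_pow_right₀ hs1 (by omega)
  have h2 : Real.exp (N * (LL/4) + 2) = E ^ N * Real.exp 2 := by
    rw [Real.exp_add, Real.exp_nat_mul, hE]
  have h3 : (N + 3 : ℝ)^5 * q ^ N ≤ M / q^3 := by
    rw [le_div_iff₀ (by positivity), mul_assoc, ← pow_add]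
    have := hM' (N+3)
    push_cast at this
    exact this
  have h4 : 28 ^ N * E ^ N / s ^ N = q ^ N * B ^ N := by
    rw [hq, ← mul_pow, ← div_pow, ← mul_pow, div_mul_cancel₀ _ hB0.ne']
  rw [h2]
  calc 28 ^ N * (((2:ℝ) ^ (N / 2))⁻¹ * (6 * (N + 3 : ℝ)^5 * (E ^ N * Real.exp 2)))
      ≤ 28 ^ N * ((s / s ^ N) * (6 * (N + 3 : ℝ)^5 * (E ^ N * Real.exp 2))) := by gcongr
    _ = 6 * s * Real.exp 2 * (N + 3 : ℝ)^5 * (28 ^ N * E ^ N / s ^ N) := by ring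
    _ = 6 * s * Real.exp 2 * ((N + 3 : ℝ)^5 * q ^ N) * B ^ N := by rw [h4]; ring
    _ ≤ _ := by gcongr
end
end SC
end

noncomputable section
namespace SC
section

lemma GP_of_GenPos {S : Finset Pt} (h : GenPos S) : GP S := by
  intro a ha b hb c hc hab hac hbc h0
  refine h a ha b hb c hc hab hac hbc ?_
  rw [collinear_iff_of_mem (p₀ := a) (by simp)]
  refine ⟨b - a, ?_⟩
  have hc' : ∃ r : ℝ, c = r • (b - a) +ᵥ a := by
    unfold o at h0
    by_cases h1 : b.1 - a.1 = 0
    · have h2 : b.2 - a.2 ≠ 0 := by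
        intro h2
        exact hab (Prod.ext (by linarith) (by linarith))
      have h3 : c.1 - a.1 = 0 := by
        rw [h1] at h0
        have : (b.2 - a.2) * (c.1 - a.1) = 0 := by linarith
        exact (mul_eq_zero.1 this).resolve_left h2
      refine ⟨(c.2 - a.2) / (b.2 - a.2), Prod.ext ?_ ?_⟩
      · simp [h1]; linarith
      · simp [div_mul_cancel₀ _ h2]
    · refine ⟨(c.1 - a.1) / (b.1 - a.1), Prod.ext ?_ ?_⟩
      · simp [div_mul_cancel₀ _ h1]
      · simp only [vadd_eq_add, Prod.snd_add, Prod.smul_snd, Prod.snd_sub, smul_eq_mul]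
        field_simp
        linarith
  intro p hp
  simp only [Set.mem_insert_iff, Set.mem_singleton_iff] at hp
  rcases hp with rfl | rfl | rfl
  · exact ⟨0, by simp⟩
  · exact ⟨1, by simp⟩
  · exact hc'

def sh (t : ℝ) (p : Pt) : Pt := (p.1 + t * p.2, p.2)

lemma sh_inj (t : ℝ) : Function.Injective (sh t) := by
  intro p q h
  simp only [sh, Prod.mk.injEq] at h
  obtain ⟨h1, h2⟩ := h
  rw [h2] at h1
  exact Prod.ext (by linarith) h2

lemma o_sh (t : ℝ) (a b c : Pt) : o (sh t a) (sh t b) (sh t c) = o a b c := by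
  unfold o sh; ring

lemma cr_sh (t : ℝ) (a b c d : Pt) : cr (sh t a) (sh t b) (sh t c) (sh t d) ↔ cr a b c d := by
  unfold cr; simp only [o_sh]

lemma exists_sh (S : Finset Pt) : ∃ t, ∀ p ∈ S, ∀ q ∈ S, (sh t p).1 = (sh t q).1 → p = q := by
  obtain ⟨t, ht⟩ := Infinite.exists_notMem_finset ((S ×ˢ S).image (fun u => -(u.1.1 - u.2.1) / (u.1.2 - u.2.2)))
  refine ⟨t, fun p hp q hq h => ?_⟩
  simp only [sh] at h
  by_cases h2 : p.2 - q.2 = 0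
  · have : p.2 = q.2 := by linarith
    rw [this] at h
    exact Prod.ext (by linarith) this
  · exfalso
    refine ht (Finset.mem_image.2 ⟨(p, q), by simp [hp, hq], ?_⟩)
    simp only
    rw [div_eq_iff h2]
    linarith

lemma GP_insert {S : Finset Pt} {z : Pt} (h : GP S) (hz : ∀ p ∈ S, ∀ q ∈ S, p ≠ q → o p q z ≠ 0) : GP (insert z S) := by
  intro a ha b hb c hc hab hac hbc
  rw [Finset.mem_insert] at ha hb hc
  rcases ha with rfl | ha
  · have hb := hb.resolve_left hab.symm
    have hc := hc.resolve_left hac.symm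
    rw [← o_rot]; exact hz b hb c hc hbc
  · rcases hb with rfl | hb
    · have hc := hc.resolve_left hbc.symm
      rw [← o_rot, ← o_rot]; exact hz c hc a ha hac.symm
    · rcases hc with rfl | hc
      · exact hz a ha b hb hab
      · exact h a ha b hb c hc hab hac hbc

lemma quad_ev (a b c : ℝ) (ha : a ≠ 0) : ∀ᶠ R : ℝ in Filter.atTop, a * R^2 + b * R + c ≠ 0 := by
  have ha' : 0 < |a| := abs_pos.2 ha
  filter_upwards [Filter.eventually_ge_atTop (1 + (|b| + |c|) / |a|)] with R hR h0
  have h1 : 1 ≤ R := by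
    have : 0 ≤ (|b| + |c|) / |a| := by positivity
    linarith
  have h2 : |a| + (|b| + |c|) ≤ |a| * R := by
    have := mul_le_mul_of_nonneg_left hR ha'.le
    rwa [mul_add, mul_one, mul_div_cancel₀ _ ha'.ne'] at this
  have h3 : |a| * R^2 ≤ |b| * R + |c| := by
    have e : a * R^2 = -(b * R + c) := by linarith
    have : |a * R^2| ≤ |b * R| + |c| := by rw [e, abs_neg]; exact abs_add_le _ _
    rwa [abs_mul, abs_mul, abs_of_nonneg (sq_nonneg R), abs_of_nonneg (by linarith : 0 ≤ R)] at this
  have h4 := mul_le_mul_of_nonneg_right h2 (by linarith : 0 ≤ R)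
  have h5 : |c| ≤ |c| * R := le_mul_of_one_le_right (abs_nonneg c) h1
  have h6 : 0 < |a| * R := by positivity
  have h7 : |a| * R ^ 2 = |a| * R * R := by ring
  linarith

lemma gen_ev {S : Finset Pt} (hx : ∀ p ∈ S, ∀ q ∈ S, p.1 = q.1 → p = q) (u v : ℝ) (hv : v ≠ 0) :
    ∀ᶠ R : ℝ in Filter.atTop, ∀ p ∈ S, ∀ q ∈ S, p ≠ q → o p q (u * R, v * R^2) ≠ 0 := by
  rw [Filter.eventually_all_finset]
  intro p hp
  rw [Filter.eventually_all_finset]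
  intro q hq
  by_cases hpq : p = q
  · exact Filter.Eventually.of_forall fun _ h => absurd hpq h
  · have h1 : q.1 - p.1 ≠ 0 := fun h => hpq (hx p hp q hq (by linarith))
    filter_upwards [quad_ev ((q.1 - p.1) * v) (-(q.2 - p.2) * u) (-(q.1 - p.1) * p.2 + (q.2 - p.2) * p.1)
      (mul_ne_zero h1 hv)] with R hR _ h0
    apply hR
    rw [← h0]
    unfold o
    ring

lemma exists_cfg {S : Finset Pt} (hS : GP S) (hx : ∀ p ∈ S, ∀ q ∈ S, p.1 = q.1 → p = q) :
    ∃ X A B C, Cfg X A B C ∧ S ⊆ X ∧ X.card = S.card + 3 := by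
  have hev : ∀ᶠ R : ℝ in Filter.atTop, ∀ p ∈ S, 1 + 4 * |p.1| + |p.2| ≤ R := by
    rw [Filter.eventually_all_finset]
    intro p hp
    exact Filter.eventually_ge_atTop _
  obtain ⟨R, hA, hB, hC, hR, hR1⟩ := ((gen_ev hx (-1) (-1) (by norm_num)).and ((gen_ev hx 2 (-1) (by norm_num)).and
    ((gen_ev hx 1 3 (by norm_num)).and (hev.and (Filter.eventually_ge_atTop 1))))).exists
  obtain ⟨A, eA⟩ : ∃ A : Pt, A = ((-1) * R, (-1) * R^2) := ⟨_, rfl⟩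
  obtain ⟨B, eB⟩ : ∃ B : Pt, B = (2 * R, (-1) * R^2) := ⟨_, rfl⟩
  obtain ⟨C, eC⟩ : ∃ C : Pt, C = (1 * R, 3 * R^2) := ⟨_, rfl⟩
  rw [← eA] at hA
  rw [← eB] at hB
  rw [← eC] at hC
  have a1 : A.1 = -R := by rw [eA]; ring
  have b1 : B.1 = 2 * R := by rw [eB]
  have c1 : C.1 = R := by rw [eC]; ring
  have hp1 : ∀ p ∈ S, -R < p.1 ∧ p.1 < R := by
    intro p hp
    have h := hR p hp
    have h1 := abs_nonneg p.1
    have h2 := abs_nonneg p.2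
    have h3 := le_abs_self p.1
    have h4 := neg_abs_le p.1
    constructor <;> linarith
  have hABC : 0 < o A B C := by
    rw [eA, eB, eC]; unfold o; simp only
    have : 0 < R ^ 3 := by positivity
    ring_nf; linarith
  have hpos : ∀ p ∈ S, 0 < o A B p ∧ 0 < o B C p ∧ 0 < o C A p := by
    intro p hp
    have h := hR p hp
    have h1 := abs_nonneg p.1
    have h2 := abs_nonneg p.2
    have h3 := le_abs_self p.1
    have h4 := neg_abs_le p.1
    have h5 := le_abs_self p.2
    have h6 := neg_abs_le p.2
    have k1 : R * (1 + 4 * |p.1| + |p.2|) ≤ R * R := mul_le_mul_of_nonneg_left h (by linarith)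
    have k2 : |p.2| ≤ R * |p.2| := le_mul_of_one_le_left h2 hR1
    have k3 : R * p.1 ≤ R * |p.1| := mul_le_mul_of_nonneg_left h3 (by linarith)
    have k4 : R * -|p.1| ≤ R * p.1 := mul_le_mul_of_nonneg_left h4 (by linarith)
    have k5 : 0 ≤ R * |p.1| := mul_nonneg (by linarith) h1
    have k6 : 0 < R := by linarith
    refine ⟨?_, ?_, ?_⟩
    · have : o A B p = 3 * R * (p.2 + R * R) := by rw [eA, eB]; unfold o; simp only; ring
      rw [this]; refine mul_pos (by linarith) ?_
      linarith
    · have : o B C p = R * (7 * (R * R) - 4 * (R * p.1) - p.2) := by rw [eC, eB]; unfold o; simp only; ring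
      rw [this]; refine mul_pos (by linarith) ?_
      linarith
    · have : o C A p = 2 * R * (R * R + 2 * (R * p.1) - p.2) := by rw [eC, eA]; unfold o; simp only; ring
      rw [this]; refine mul_pos (by linarith) ?_
      linarith
  have nC : C ∉ S := fun h => by have := hp1 C h; linarith
  have nB : B ∉ insert C S := by
    rw [Finset.mem_insert]
    rintro (h | h)
    · rw [h] at b1; linarith
    · have := hp1 B h; linarith
  have nA : A ∉ insert B (insert C S) := by
    rw [Finset.mem_insert, Finset.mem_insert]
    rintro (h | h | h)
    · rw [h] at a1; linarith
    · rw [h] at a1; linarith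
    · have := hp1 A h; linarith
  refine ⟨insert A (insert B (insert C S)), A, B, C, ?_, ?_, ?_⟩
  · have mem : ∀ q, q ∈ insert A (insert B (insert C S)) → q = A ∨ q = B ∨ q = C ∨ q ∈ S := by
      intro q hq; simpa only [Finset.mem_insert] using hq
    refine ⟨?_, by simp, by simp, by simp, hABC, ?_, ?_, ?_, ?_, ?_⟩
    · refine GP_insert (GP_insert (GP_insert hS hC) ?_) ?_
      · intro p hp q hq hpq
        rw [Finset.mem_insert] at hp hq
        rcases hp with rfl | hp <;> rcases hq with rfl | hq
        · exact absurd rfl hpq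
        · have := (hpos q hq).2.1
          have e : o p q B = o B p q := by unfold o; ring
          rw [e]; exact this.ne'
        · have := (hpos p hp).2.1
          have e : o p q B = - o B q p := by unfold o; ring
          rw [e]; exact (neg_neg_of_pos this).ne
        · exact hB p hp q hq hpq
      · intro p hp q hq hpq
        rw [Finset.mem_insert, Finset.mem_insert] at hp hq
        have e1 : ∀ p q : Pt, o p q A = o A p q := by intro p q; unfold o; ring
        have e2 : ∀ p q : Pt, o p q A = - o A q p := by intro p q; unfold o; ring
        have e3 : ∀ p q : Pt, o p q A = - o p A q := by intro p q; unfold o; ring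
        have e4 : ∀ p q : Pt, o p q A = o q A p := by intro p q; unfold o; ring
        rcases hp with rfl | rfl | hp <;> rcases hq with rfl | rfl | hq
        · exact absurd rfl hpq
        · rw [e1]; exact hABC.ne'
        · rw [e1]; exact (hpos q hq).1.ne'
        · rw [e2]; exact (neg_neg_of_pos hABC).ne
        · exact absurd rfl hpq
        · rw [e3]; exact (neg_neg_of_pos (hpos q hq).2.2).ne
        · rw [e2]; exact (neg_neg_of_pos (hpos p hp).1).ne
        · rw [e4]; exact (hpos p hp).2.2.ne'
        · exact hA p hp q hq hpq
    · intro q hq h1 h2 h3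
      exact hpos q ((((mem q hq).resolve_left h1).resolve_left h2).resolve_left h3)
    · intro p hp q hq h
      rcases mem p hp with rfl | rfl | rfl | hp' <;> rcases mem q hq with rfl | rfl | rfl | hq'
      all_goals first
        | rfl
        | exact hx p hp' q hq' h
        | (exfalso; linarith)
        | (exfalso; have := hp1 _ hp'; linarith)
        | (exfalso; have := hp1 _ hq'; linarith)
    · intro q hq h
      rcases mem q hq with rfl | rfl | rfl | hq'
      all_goals first
        | exact absurd rfl h
        | linarith
        | (have := hp1 _ hq'; linarith)
    · intro q hq h
      rcases mem q hq with rfl | rfl | rfl | hq'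
      all_goals first
        | exact absurd rfl h
        | linarith
        | (have := hp1 _ hq'; linarith)
    · intro q hq h h'
      rcases mem q hq with rfl | rfl | rfl | hq'
      all_goals first
        | exact absurd rfl h
        | exact absurd rfl h'
        | linarith
        | (have := hp1 _ hq'; linarith)
  · intro p hp; simp [hp]
  · rw [Finset.card_insert_of_notMem nA, Finset.card_insert_of_notMem nB, Finset.card_insert_of_notMem nC]
end
end SC
end

noncomputable section
namespace SC
section

lemma rot_image (n : ℕ) (hn : 3 ≤ n) (f : Fin n → Pt) (g : ℕ → Pt) (h : ∀ i : Fin n, g i = f i) :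
    Finset.image (fun i : Fin n => s(f i, f (finRotate n i))) Finset.univ =
      insert s(g (n-1), g 0) ((Finset.range (n-1)).image (fun i => s(g i, g (i+1)))) := by
  obtain ⟨m, rfl⟩ : ∃ m, n = m + 1 := ⟨n - 1, by omega⟩
  have hlt : ∀ i (hi : i < m), s(f ⟨i, by omega⟩, f (finRotate (m+1) ⟨i, by omega⟩)) = s(g i, g (i+1)) := by
    intro i hi
    rw [finRotate_of_lt hi, ← h, ← h]
  have hla : s(f ⟨m, by omega⟩, f (finRotate (m+1) ⟨m, by omega⟩)) = s(g m, g 0) := by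
    have : finRotate (m+1) ⟨m, by omega⟩ = 0 := finRotate_last'
    rw [this, ← h, ← h]; rfl
  ext e
  simp only [Finset.mem_image, Finset.mem_univ, true_and, Finset.mem_insert, Finset.mem_range, Nat.add_sub_cancel]
  constructor
  · rintro ⟨⟨i, hi⟩, rfl⟩
    rcases Nat.lt_or_ge i m with h1 | h1
    · right; exact ⟨i, h1, (hlt i h1).symm⟩
    · left
      have : i = m := by omega
      subst this
      exact hla
  · rintro (rfl | ⟨i, hi, rfl⟩)
    · exact ⟨⟨m, by omega⟩, hla⟩
    · exact ⟨⟨i, by omega⟩, hlt i hi⟩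

lemma PG_nocr {S : Finset Pt} (G : PlaneGraph S) {a b c d : Pt} (h1 : s(a,b) ∈ G.edges) (h2 : s(c,d) ∈ G.edges) :
    ¬ cr a b c d := by
  intro h
  have hne : s(a,b) ≠ s(c,d) := by
    intro he
    have hc : c ∈ s(a,b) := by rw [he]; simp
    have h0 := h.1
    rw [Sym2.mem_iff] at hc
    rcases hc with rfl | rfl
    · rw [o_aba] at h0; simp at h0
    · rw [o_abb] at h0; simp at h0
  obtain ⟨r, u, hr, hr1, hu, hu1, he⟩ := exists_meet_of_cr h
  have hseg : ∀ (r : ℝ) (a b : Pt), 0 < r → r < 1 → lerp r a b ∈ seg2 s(a,b) := by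
    intro r a b h0 h1
    show lerp r a b ∈ segment ℝ a b
    refine ⟨1 - r, r, by linarith, by linarith, by ring, ?_⟩
    unfold lerp
    ext <;> simp <;> ring
  have hx := G.noncrossing _ h1 _ h2 hne (lerp r a b) ⟨hseg r a b hr hr1, by rw [he]; exact hseg u c d hu hu1⟩
  obtain ⟨hxa, hxc⟩ := hx
  have hz : o c d (lerp r a b) = 0 := by
    rw [Sym2.mem_iff] at hxc
    rcases hxc with h | h <;> rw [h]
    · exact o_aba _ _
    · exact o_abb _ _
  have h0 := h.2
  rw [Sym2.mem_iff] at hxa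
  rcases hxa with h | h <;> rw [h] at hz <;> rw [hz] at h0 <;> simp at h0

theorem sc_le {S : Finset Pt} (hS : GenPos S) (h3 : 3 ≤ S.card) :
    (scCount S : ℝ) ≤ 28 ^ S.card * (((2:ℝ) ^ (S.card / 2))⁻¹ * (6 * (S.card + 3 : ℝ)^5 * Real.exp (S.card * (LL/4) + 2))) := by
  obtain ⟨t, ht⟩ := exists_sh S
  obtain ⟨S', eS'⟩ : ∃ S', S' = S.image (sh t) := ⟨_, rfl⟩
  have hc : S'.card = S.card := by rw [eS']; exact Finset.card_image_of_injective _ (sh_inj t)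
  have hm : ∀ p ∈ S, sh t p ∈ S' := fun p hp => by rw [eS']; exact Finset.mem_image_of_mem _ hp
  have hm' : ∀ p' ∈ S', ∃ p ∈ S, sh t p = p' := fun p hp => by rw [eS'] at hp; exact Finset.mem_image.1 hp
  have hGP : GP S' := by
    intro a ha b hb c hc
    obtain ⟨a, ha0, rfl⟩ := hm' a ha
    obtain ⟨b, hb0, rfl⟩ := hm' b hb
    obtain ⟨c, hc0, rfl⟩ := hm' c hc
    intro hab hac hbc
    rw [o_sh]
    exact GP_of_GenPos hS a ha0 b hb0 c hc0 (fun h => hab (by rw [h])) (fun h => hac (by rw [h])) (fun h => hbc (by rw [h]))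
  have hxi : ∀ p ∈ S', ∀ q ∈ S', p.1 = q.1 → p = q := by
    intro a ha b hb h
    obtain ⟨a, ha0, rfl⟩ := hm' a ha
    obtain ⟨b, hb0, rfl⟩ := hm' b hb
    rw [ht a ha0 b hb0 h]
  obtain ⟨X, A, B, C, hC, hSX, hXc⟩ := exists_cfg hGP hxi
  let Cs := X.sym2.powerset.filter (fun G => IsCyc S' G ∧ Plane X G)
  have key := total hC S' hSX hXc (by omega) Cs (fun G hG => (Finset.mem_filter.1 hG).2)
  rw [hc] at key
  refine le_trans ?_ key
  have hcard : (scCount S) ≤ Cs.card := by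
    unfold scCount
    have hmem : ∀ G : {G : PlaneGraph S // IsSpanningCycle G}, G.1.edges.image (Sym2.map (sh t)) ∈ Cs := by
      rintro ⟨G, h3', f, hf⟩
      simp only
      have hP : Plane X (G.edges.image (Sym2.map (sh t))) := by
        have pre : ∀ a b, s(a,b) ∈ G.edges.image (Sym2.map (sh t)) → ∃ a0 b0, s(a0,b0) ∈ G.edges ∧ sh t a0 = a ∧ sh t b0 = b := by
          intro a b hab
          obtain ⟨e, he, hab⟩ := Finset.mem_image.1 hab
          induction e using Sym2.ind with
          | _ x y =>
            rw [Sym2.map_mk] at hab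
            rcases Sym2.eq_iff.1 hab with ⟨h1, h2⟩ | ⟨h1, h2⟩
            · exact ⟨x, y, he, h1, h2⟩
            · exact ⟨y, x, by rw [Sym2.eq_swap]; exact he, h2, h1⟩
        intro a b hab
        obtain ⟨a, b, hab0, rfl, rfl⟩ := pre a b hab
        refine ⟨hSX (hm a (G.endpoint_mem _ hab0 a (by simp))), hSX (hm b (G.endpoint_mem _ hab0 b (by simp))), ?_, ?_⟩
        · intro h
          exact G.not_isDiag _ hab0 (by rw [Sym2.mk_isDiag_iff]; exact sh_inj t h)
        · intro c d hcd
          obtain ⟨c, d, hcd0, rfl, rfl⟩ := pre c d hcd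
          rw [cr_sh]
          exact PG_nocr G hab0 hcd0
      refine Finset.mem_filter.2 ⟨Finset.mem_powerset.2 hP.sub, ?_, hP⟩
      let g : ℕ → Pt := fun i => if h : i < S.card then sh t (f ⟨i, h⟩ : Pt) else 0
      have hg : ∀ i (h : i < S.card), g i = sh t (f ⟨i, h⟩ : Pt) := fun i h => by simp only [g, dif_pos h]
      refine ⟨g, ?_, ?_, ?_⟩
      · rw [hc]
        intro i hi j hj hij
        rw [hg i hi, hg j hj] at hij
        have := f.injective (Subtype.ext (sh_inj t hij))
        exact Fin.mk.inj_iff.1 this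
      · rw [hc]
        intro i hi
        rw [hg i hi]
        exact hm _ (f _).2
      · rw [hc, ← rot_image S.card h3 (fun i => sh t (f i : Pt)) g (fun i => hg i i.2), hf, Finset.image_image]
        rfl
    have hinj : Function.Injective (fun G : {G : PlaneGraph S // IsSpanningCycle G} => (⟨_, hmem G⟩ : Cs)) := by
      rintro ⟨G, hG⟩ ⟨H, hH⟩ h
      have h := Subtype.mk.inj h
      have h := Finset.image_injective (Sym2.map.injective (sh_inj t)) h
      simp only at h
      cases G; cases H
      simp only at h
      subst h
      rfl
    have := Nat.card_le_card_of_injective _ hinj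
    simpa using this
  exact_mod_cast hcard

theorem final : ∃ c : ℝ, 0 < c ∧ ∀ (N : ℕ) (S : Finset Pt), S.card = N → GenPos S →
      (scCount S : ℝ) ≤ c * (30 * (12 : ℝ) ^ ((1 : ℝ) / 4)) ^ N := by
  obtain ⟨c, hc, h⟩ := numerics
  refine ⟨c, hc, ?_⟩
  rintro N S rfl hS
  by_cases h3 : 3 ≤ S.card
  · exact (sc_le hS h3).trans (h _)
  · have : scCount S = 0 := by
      unfold scCount
      have : IsEmpty {G : PlaneGraph S // IsSpanningCycle G} := ⟨fun G => h3 G.2.1⟩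
      exact Nat.card_of_isEmpty
    rw [this]
    push_cast
    positivity
end
end SC
end

/-- `sc(N) = O((30 · 12^{1/4})^N) = O(55.8363^N)`. -/
theorem statement1 :
    ∃ c : ℝ, 0 < c ∧ ∀ (N : ℕ) (S : Finset Pt), S.card = N → GenPos S →
      (scCount S : ℝ) ≤ c * (30 * (12 : ℝ) ^ ((1 : ℝ) / 4)) ^ N := by
  exact SC.final

end
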